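/- Assume A1–A4 hold. For any T>0 and p ≥ 2 with E|ξ|^{3p/2} + E|ζ|^{3p} < ∞, there exists C_{p,T} > 0 such that for all 0 ≤ t ≤ t+h ≤ T and ε ∈ (0,1), E|X^ε_{t+h} − X^ε_t|^p ≤ C_{p,T} (1 + E|ξ|^{3p/2} + E|ζ|^{3p}) (h^{p/2} + h^p ε^{-p/2}). -/

import Mathlib

open MeasureTheory Filter
open scoped ENNReal NNReal Topology RealInnerProductSpace

set_option maxSynthPendingDepth 3

noncomputable section

namespace DiffApprox

/-- Euclidean space `ℝ^k`. -/
abbrev Vec (k : ℕ) : Type := EuclideanSpace ℝ (Fin k)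

/-- `k × l` real matrices, viewed as continuous linear maps `ℝ^l → ℝ^k`. -/
abbrev Mat (k l : ℕ) : Type := Vec l →L[ℝ] Vec k

/-- `μ` belongs to the 2-Wasserstein space `𝒫₂(ℝ^k)`. -/
def memP2 {k : ℕ} (μ : Measure (Vec k)) : Prop :=
  IsProbabilityMeasure μ ∧ (∫⁻ x, (‖x‖₊ : ℝ≥0∞) ^ (2 : ℕ) ∂μ) < ⊤

/-- `π` is a coupling of `μ` and `ν`. -/
def IsCoupling {k : ℕ} (π : Measure (Vec k × Vec k)) (μ ν : Measure (Vec k)) : Prop :=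
  π.map Prod.fst = μ ∧ π.map Prod.snd = ν

/-- The 2-Wasserstein distance. -/
def W2 {k : ℕ} (μ ν : Measure (Vec k)) : ℝ :=
  sInf {c : ℝ | ∃ π : Measure (Vec k × Vec k), IsCoupling π μ ν ∧
    c = Real.sqrt (∫ p, ‖p.1 - p.2‖ ^ (2 : ℕ) ∂π)}

/-- Trace of an endomorphism of `ℝ^k`. -/
def trCLM {k : ℕ} (A : Vec k →L[ℝ] Vec k) : ℝ :=
  LinearMap.trace ℝ (Vec k) A.toLinearMap

/-- Hilbert space adjoint (matrix transpose). -/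
def adj {k l : ℕ} (A : Mat k l) : Mat l k := ContinuousLinearMap.adjoint A

/-- The outer product `(a ⊗ b) v = ⟪b, v⟫ • a`, i.e. `(a ⊗ b)_{ij} = aᵢ bⱼ`. -/
def outer {k : ℕ} (a b : Vec k) : Mat k k := (innerSL ℝ b).smulRight a

/-- Hessian of a scalar function. -/
def hess {k : ℕ} (φ : Vec k → ℝ) (y : Vec k) : Vec k →L[ℝ] Vec k :=
  fderiv ℝ (gradient φ) y

/-- Mixed second derivative `∂²_{xy} φ`. -/
def hessMixed {k l : ℕ} (φ : Vec k → Vec l → ℝ) (x : Vec k) (y : Vec l) :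
    Vec k →L[ℝ] Vec l :=
  fderiv ℝ (fun x' => gradient (φ x') y) x

/-- `C²` test function with compact support. -/
def TestFun {k : ℕ} (φ : Vec k → ℝ) : Prop :=
  ContDiff ℝ 2 φ ∧ HasCompactSupport φ

/-- `C²` test function of two variables with compact support. -/
def TestFun2 {k l : ℕ} (φ : Vec k → Vec l → ℝ) : Prop :=
  ContDiff ℝ 2 (Function.uncurry φ) ∧ HasCompactSupport (Function.uncurry φ)

/-- Generator `L₂(x,μ)` of the frozen equation `dY = f(x,μ,Y)dt + g(x,μ,Y)dW`. -/
def genFrozen {n m d : ℕ} (f : Vec n → Measure (Vec n) → Vec m → Vec m)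
    (g : Vec n → Measure (Vec n) → Vec m → Mat m d) (x : Vec n) (μ : Measure (Vec n))
    (φ : Vec m → ℝ) (y : Vec m) : ℝ :=
  ⟪f x μ y, gradient φ y⟫ +
    (1 / 2) * trCLM (((g x μ y).comp (adj (g x μ y))).comp (hess φ y))

/-- `ν` is an invariant probability measure of the frozen equation. -/
def IsInvariantMeasure {n m d : ℕ} (f : Vec n → Measure (Vec n) → Vec m → Vec m)
    (g : Vec n → Measure (Vec n) → Vec m → Mat m d) (x : Vec n) (μ : Measure (Vec n))
    (ν : Measure (Vec m)) : Prop :=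
  IsProbabilityMeasure ν ∧ ∀ φ : Vec m → ℝ, TestFun φ → ∫ y, genFrozen f g x μ φ y ∂ν = 0

/-- `M` is a martingale on `[0, ∞)` w.r.t. the filtration `ℱ`. -/
def MartOn {Ω : Type} {mΩ : MeasurableSpace Ω} (P : Measure Ω) (ℱ : Filtration ℝ mΩ)
    (M : ℝ → Ω → ℝ) : Prop :=
  (∀ t : ℝ, 0 ≤ t → StronglyMeasurable[ℱ t] (M t) ∧ Integrable (M t) P) ∧
    ∀ s t : ℝ, 0 ≤ s → s ≤ t → P[M t|ℱ s] =ᵐ[P] M s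

/-- The coefficients of the slow–fast McKean–Vlasov system. -/
structure Coeffs (n m d : ℕ) where
  b : Vec n → Measure (Vec n) → Vec m → Vec n
  K : Vec n → Measure (Vec n) → Vec m → Vec n
  σ : Vec n → Measure (Vec n) → Vec m → Mat n d
  f : Vec n → Measure (Vec n) → Vec m → Vec m
  h : Vec n → Measure (Vec n) → Vec m → Vec m
  g : Vec n → Measure (Vec n) → Vec m → Mat m d

/-- Generator of the coupled slow–fast system `(X^ε, Y^ε)` with frozen distribution `μ`. -/
def genSF {n m d : ℕ} (C : Coeffs n m d) (ε : ℝ) (μ : Measure (Vec n))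
    (φ : Vec n → Vec m → ℝ) (x : Vec n) (y : Vec m) : ℝ :=
  ⟪C.b x μ y + (Real.sqrt ε)⁻¹ • C.K x μ y, gradient (fun x' => φ x' y) x⟫ +
    ⟪ε⁻¹ • C.f x μ y + (Real.sqrt ε)⁻¹ • C.h x μ y, gradient (φ x) y⟫ +
    (1 / 2) * trCLM (((C.σ x μ y).comp (adj (C.σ x μ y))).comp (hess (fun x' => φ x' y) x)) +
    (1 / (2 * ε)) * trCLM (((C.g x μ y).comp (adj (C.g x μ y))).comp (hess (φ x) y)) +
    (Real.sqrt ε)⁻¹ * trCLM (((C.σ x μ y).comp (adj (C.g x μ y))).comp (hessMixed φ x y))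

/-- `(X, Y)` is a (weak–martingale problem) solution of the slow–fast McKean–Vlasov
system with scale parameter `ε` and initial data `(ξ, ζ)`. -/
structure IsSFSolution {n m d : ℕ} (C : Coeffs n m d) (ε : ℝ) {Ω : Type}
    [mΩ : MeasurableSpace Ω] (P : Measure Ω) (ℱ : Filtration ℝ mΩ)
    (X : ℝ → Ω → Vec n) (Y : ℝ → Ω → Vec m) (ξ : Ω → Vec n) (ζ : Ω → Vec m) : Prop where
  measX : ∀ t, Measurable (X t)
  measY : ∀ t, Measurable (Y t)
  adaptX : Adapted ℱ X
  adaptY : Adapted ℱ Y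
  initX : ∀ᵐ ω ∂P, X 0 ω = ξ ω
  initY : ∀ᵐ ω ∂P, Y 0 ω = ζ ω
  lawP2X : ∀ t, 0 ≤ t → memP2 (P.map (X t))
  contX : ∀ ω, Continuous fun t => X t ω
  contY : ∀ ω, Continuous fun t => Y t ω
  mart : ∀ φ : Vec n → Vec m → ℝ, TestFun2 φ →
    MartOn P ℱ fun t ω =>
      φ (X t ω) (Y t ω) -
        ∫ s in Set.Ioc (0 : ℝ) t, genSF C ε (P.map (X s)) φ (X s ω) (Y s ω)

/-- Generator of a distribution dependent SDE `dX = Θ(X, ℒ_X) dt + Σ(X, ℒ_X) dW`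
with `A = Σ Σ*`. -/
def genLim {n : ℕ} (Θ : Vec n → Measure (Vec n) → Vec n)
    (A : Vec n → Measure (Vec n) → Mat n n) (μ : Measure (Vec n)) (U : Vec n → ℝ)
    (x : Vec n) : ℝ :=
  ⟪Θ x μ, gradient U x⟫ + (1 / 2) * trCLM ((A x μ).comp (hess U x))

/-- `X` is a (weak) solution of the McKean–Vlasov SDE with drift `Θ`, squared diffusion
`A = Σ Σ*` and initial datum `ξ`. -/
structure IsLimitSolution {n : ℕ} (Θ : Vec n → Measure (Vec n) → Vec n)
    (A : Vec n → Measure (Vec n) → Mat n n) {Ω : Type} [mΩ : MeasurableSpace Ω]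
    (P : Measure Ω) (ℱ : Filtration ℝ mΩ) (X : ℝ → Ω → Vec n) (ξ : Ω → Vec n) : Prop where
  measX : ∀ t, Measurable (X t)
  adaptX : Adapted ℱ X
  initX : ∀ᵐ ω ∂P, X 0 ω = ξ ω
  contX : ∀ ω, Continuous fun t => X t ω
  mart : ∀ U : Vec n → ℝ, TestFun U →
    MartOn P ℱ fun t ω =>
      U (X t ω) - ∫ s in Set.Ioc (0 : ℝ) t, genLim Θ A (P.map (X s)) U (X s ω)

/-- Generator of the synchronous coupling of two copies of the frozen equation,
driven by the same Brownian motion. -/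
def genPair {n m d : ℕ} (f : Vec n → Measure (Vec n) → Vec m → Vec m)
    (g : Vec n → Measure (Vec n) → Vec m → Mat m d) (x1 : Vec n) (μ1 : Measure (Vec n))
    (x2 : Vec n) (μ2 : Measure (Vec n)) (φ : Vec m → Vec m → ℝ) (y1 y2 : Vec m) : ℝ :=
  ⟪f x1 μ1 y1, gradient (fun z => φ z y2) y1⟫ + ⟪f x2 μ2 y2, gradient (φ y1) y2⟫ +
    (1 / 2) * trCLM (((g x1 μ1 y1).comp (adj (g x1 μ1 y1))).comp (hess (fun z => φ z y2) y1)) +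
    (1 / 2) * trCLM (((g x2 μ2 y2).comp (adj (g x2 μ2 y2))).comp (hess (φ y1) y2)) +
    trCLM (((g x1 μ1 y1).comp (adj (g x2 μ2 y2))).comp (hessMixed φ y1 y2))

/-- The uniform probability measure on `[0,1]`, a rich atomless probability space used
to define the Lions derivative by lifting to `L²`. -/
def P01 : Measure ℝ := volume.restrict (Set.Icc (0 : ℝ) 1)

/-- `D` is the Lions derivative of `u : 𝒫₂(ℝ^k) → E` at `μ`: the lift of `u` to
`L²(Ω₀; ℝ^k)` is Fréchet differentiable at every `X` with law `μ` with derivative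
represented by `D ∘ X`. -/
def IsLionsDeriv {k : ℕ} {E : Type*} [NormedAddCommGroup E] [NormedSpace ℝ E]
    [CompleteSpace E] (u : Measure (Vec k) → E) (μ : Measure (Vec k))
    (D : Vec k → (Vec k →L[ℝ] E)) : Prop :=
  ∀ X : Lp (Vec k) 2 P01, P01.map (X : ℝ → Vec k) = μ →
    ∃ L : Lp (Vec k) 2 P01 →L[ℝ] E,
      HasFDerivAt (fun Z : Lp (Vec k) 2 P01 => u (P01.map (Z : ℝ → Vec k))) L X ∧
        ∀ H : Lp (Vec k) 2 P01, L H = ∫ ω, D (X ω) (H ω) ∂P01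

/-- `L²(μ)`-norm of a kernel `D`. -/
def l2n {k : ℕ} {E : Type*} [NormedAddCommGroup E] (μ : Measure (Vec k)) (D : Vec k → E) : ℝ :=
  Real.sqrt (∫ z, ‖D z‖ ^ (2 : ℕ) ∂μ)

/-- `F(·, μ, ·) ∈ C_b^{3,3}` uniformly in `μ`:
three bounded continuous (mixed) derivatives in `(x,y)`. -/
def Cb3 {n m : ℕ} {E : Type*} [NormedAddCommGroup E] [NormedSpace ℝ E]
    (F : Vec n → Measure (Vec n) → Vec m → E) (CB : ℝ) : Prop :=
  ∀ μ : Measure (Vec n), memP2 μ →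
    ContDiff ℝ 3 (fun p : Vec n × Vec m => F p.1 μ p.2) ∧
      ∀ i : ℕ, 1 ≤ i → i ≤ 3 → ∀ p : Vec n × Vec m,
        ‖iteratedFDeriv ℝ i (fun q : Vec n × Vec m => F q.1 μ q.2) p‖ ≤ CB

/-- The Lions-derivative part of condition A3: `F` admits a Lions derivative in the
measure variable, bounded, with bounded and `γ₁`-Hölder (in `y`) derivatives. -/
def A3lions {n m : ℕ} {E : Type*} [NormedAddCommGroup E] [NormedSpace ℝ E] [CompleteSpace E]
    (F : Vec n → Measure (Vec n) → Vec m → E) (CB γ1 : ℝ) : Prop :=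
  ∃ D : Vec n → Measure (Vec n) → Vec m → Vec n → (Vec n →L[ℝ] E),
    (∀ x μ y, memP2 μ → IsLionsDeriv (fun μ' => F x μ' y) μ (D x μ y)) ∧
    (∀ x μ y z, ‖D x μ y z‖ ≤ CB) ∧
    (∀ x μ y z, ‖fderiv ℝ (D x μ y) z‖ ≤ CB) ∧
    (∀ x μ y1 y2 z,
      ‖fderiv ℝ (D x μ y1) z - fderiv ℝ (D x μ y2) z‖ ≤ CB * ‖y1 - y2‖ ^ γ1) ∧
    (∀ x μ z y, ‖fderiv ℝ (fun y' => D x μ y' z) y‖ ≤ CB) ∧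
    (∀ x μ z y1 y2,
      ‖fderiv ℝ (fun y' => D x μ y' z) y1 - fderiv ℝ (fun y' => D x μ y' z) y2‖ ≤
        CB * ‖y1 - y2‖ ^ γ1)

/-- Conditions A1–A3 of the paper for the coefficients of the slow–fast system. -/
structure SA13 {n m d : ℕ} (C : Coeffs n m d) where
  CL : ℝ
  γ : ℝ
  hγ : 0 < γ
  ς : ℝ
  hς : ς ∈ Set.Ioo (0 : ℝ) 1
  CG : ℝ
  CB : ℝ
  γ1 : ℝ
  hγ1 : γ1 ∈ Set.Ioc (0 : ℝ) 1
  lipSlow : ∀ x1 x2 μ1 μ2 y1 y2, memP2 μ1 → memP2 μ2 →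
    ‖C.b x1 μ1 y1 - C.b x2 μ2 y2‖ + ‖C.K x1 μ1 y1 - C.K x2 μ2 y2‖ +
        ‖C.σ x1 μ1 y1 - C.σ x2 μ2 y2‖ ≤
      CL * (‖x1 - x2‖ + ‖y1 - y2‖ + W2 μ1 μ2)
  lipFast : ∀ x1 x2 μ1 μ2 y1 y2, memP2 μ1 → memP2 μ2 →
    ‖C.f x1 μ1 y1 - C.f x2 μ2 y2‖ + ‖C.h x1 μ1 y1 - C.h x2 μ2 y2‖ +
        ‖C.g x1 μ1 y1 - C.g x2 μ2 y2‖ ≤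
      CL * (‖x1 - x2‖ + ‖y1 - y2‖ + W2 μ1 μ2)
  dissip : ∀ x μ y1 y2, memP2 μ →
    2 * ⟪C.f x μ y1 - C.f x μ y2, y1 - y2⟫ + ‖C.g x μ y1 - C.g x μ y2‖ ^ (2 : ℕ) ≤
      -γ * ‖y1 - y2‖ ^ (2 : ℕ)
  growth : ∀ x μ y, memP2 μ →
    ‖C.K x μ y‖ + ‖C.f x μ y‖ + ‖C.h x μ y‖ + ‖C.σ x μ y‖ ≤ CG * (1 + ‖y‖)
  growthg : ∀ x μ y, memP2 μ → ‖C.g x μ y‖ ≤ CG * (1 + ‖y‖ ^ ς)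
  smoothK : Cb3 C.K CB
  smoothf : Cb3 C.f CB
  smoothg : Cb3 C.g CB
  lionsK : A3lions C.K CB γ1
  lionsf : A3lions C.f CB γ1
  lionsg : A3lions C.g CB γ1

/-- Conditions A1–A4 of the paper, together with the invariant measures `ν^{x,μ}` of the
frozen equation and the solution `Φ` of the Poisson equation `-L₂(x,μ)Φ = K`. -/
structure SA {n m d : ℕ} (C : Coeffs n m d) extends SA13 C where
  ν : Vec n → Measure (Vec n) → Measure (Vec m)
  Φ : Vec n → Measure (Vec n) → Vec m → Vec n
  invν : ∀ x μ, memP2 μ → IsInvariantMeasure C.f C.g x μ (ν x μ)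
  uniqν : ∀ x μ, memP2 μ → ∀ ν' : Measure (Vec m), IsInvariantMeasure C.f C.g x μ ν' →
    ν' = ν x μ
  centering : ∀ x μ, memP2 μ → ∫ y, C.K x μ y ∂(ν x μ) = 0
  smoothΦ : ∀ μ, memP2 μ → ContDiff ℝ 3 fun p : Vec n × Vec m => Φ p.1 μ p.2
  poisson : ∀ x μ y (i : Fin n), memP2 μ →
    genFrozen C.f C.g x μ (fun y' => Φ x μ y' i) y = -(C.K x μ y i)

/-- The matrix-valued map `(∂_y Φ) g`. -/
def dyPhiG {n m d : ℕ} (Φ : Vec n → Measure (Vec n) → Vec m → Vec n)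
    (g : Vec n → Measure (Vec n) → Vec m → Mat m d) (x : Vec n) (μ : Measure (Vec n))
    (y : Vec m) : Mat n d :=
  (fderiv ℝ (fun y' => Φ x μ y') y).comp (g x μ y)

/-- Averaged drift `Θ(x,μ) = (b + ∂ₓΦ_K + ∂_yΦ_h + Tr[∂²_{xy}Φ_{σg*}])‾(x,μ)`. -/
def Theta {n m d : ℕ} (C : Coeffs n m d) (ν : Vec n → Measure (Vec n) → Measure (Vec m))
    (Φ : Vec n → Measure (Vec n) → Vec m → Vec n) (x : Vec n) (μ : Measure (Vec n)) :
    Vec n :=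
  ∫ y,
    (C.b x μ y + fderiv ℝ (fun x' => Φ x' μ y) x (C.K x μ y) +
      fderiv ℝ (fun y' => Φ x μ y') y (C.h x μ y) +
      (EuclideanSpace.equiv (Fin n) ℝ).symm fun i =>
        trCLM (((C.σ x μ y).comp (adj (C.g x μ y))).comp
          (fderiv ℝ (fun x' => gradient (fun y' => Φ x' μ y' i) y) x)))
    ∂(ν x μ)

/-- Averaged squared diffusion
`((K⊗Φ) + (K⊗Φ)* + (σg*)∂_yΦ + [(σg*)∂_yΦ]* + σσ*)‾(x,μ)`. -/
def AMat1 {n m d : ℕ} (C : Coeffs n m d) (ν : Vec n → Measure (Vec n) → Measure (Vec m))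
    (Φ : Vec n → Measure (Vec n) → Vec m → Vec n) (x : Vec n) (μ : Measure (Vec n)) :
    Mat n n :=
  ∫ y,
    (outer (C.K x μ y) (Φ x μ y) + adj (outer (C.K x μ y) (Φ x μ y)) +
      ((C.σ x μ y).comp (adj (C.g x μ y))).comp (adj (fderiv ℝ (fun y' => Φ x μ y') y)) +
      adj (((C.σ x μ y).comp (adj (C.g x μ y))).comp
        (adj (fderiv ℝ (fun y' => Φ x μ y') y))) +
      (C.σ x μ y).comp (adj (C.σ x μ y)))
    ∂(ν x μ)

/-- Averaged squared diffusion `((∂_yΦ_g + σ)(∂_yΦ_g + σ)*)‾(x,μ)`. -/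
def AMat2 {n m d : ℕ} (C : Coeffs n m d) (ν : Vec n → Measure (Vec n) → Measure (Vec m))
    (Φ : Vec n → Measure (Vec n) → Vec m → Vec n) (x : Vec n) (μ : Measure (Vec n)) :
    Mat n n :=
  ∫ y, ((dyPhiG Φ C.g x μ y + C.σ x μ y).comp (adj (dyPhiG Φ C.g x μ y + C.σ x μ y)))
    ∂(ν x μ)

/-- `A` is a symmetric positive semi-definite matrix. -/
def IsPSD {k : ℕ} (A : Mat k k) : Prop :=
  adj A = A ∧ ∀ v : Vec k, 0 ≤ ⟪A v, v⟫

instance instPathMeasurableSpace {α E : Type*} [TopologicalSpace α] [TopologicalSpace E] :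
    MeasurableSpace C(α, E) := borel _

/-- The path `t ↦ X t ω` on `[0,T]`, as an element of `C([0,T]; ℝ^k)`
(junk value if the path is not continuous). -/
def pathOf {Ω : Type} {k : ℕ} (X : ℝ → Ω → Vec k) (T : ℝ) (ω : Ω) :
    C(Set.Icc (0 : ℝ) T, Vec k) := by
  classical
  exact if h : Continuous fun t : ℝ => X t ω then
    ⟨fun t => X t.1 ω, h.comp continuous_subtype_val⟩
  else 0

/-- A family of measures is (uniformly) tight. -/
def TightFamily {α : Type*} [TopologicalSpace α] [MeasurableSpace α]
    (S : Set (Measure α)) : Prop :=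
  ∀ δ : ℝ, 0 < δ → ∃ Kc : Set α, IsCompact Kc ∧ ∀ μ ∈ S, μ Kcᶜ ≤ ENNReal.ofReal δ

/-- The frozen equation `dY_t = f(x,μ,Y_t) dt + g(x,μ,Y_t) dW_t` under conditions A1–A2:
`Y x μ y` is its solution starting from `y` (weak/martingale-problem formulation, with the
synchronous coupling of any two copies recorded via `martPair`), and `ν x μ` is its unique
invariant probability measure. -/
structure FrozenSetting (n m d : ℕ) (Ω : Type) [mΩ : MeasurableSpace Ω] (P : Measure Ω)
    (ℱ : Filtration ℝ mΩ) where
  f : Vec n → Measure (Vec n) → Vec m → Vec m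
  g : Vec n → Measure (Vec n) → Vec m → Mat m d
  CL : ℝ
  γ : ℝ
  hγ : 0 < γ
  ς : ℝ
  hς : ς ∈ Set.Ioo (0 : ℝ) 1
  CG : ℝ
  probP : IsProbabilityMeasure P
  lip : ∀ x1 x2 μ1 μ2 y1 y2, memP2 μ1 → memP2 μ2 →
    ‖f x1 μ1 y1 - f x2 μ2 y2‖ + ‖g x1 μ1 y1 - g x2 μ2 y2‖ ≤
      CL * (‖x1 - x2‖ + ‖y1 - y2‖ + W2 μ1 μ2)
  dissip : ∀ x μ y1 y2, memP2 μ →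
    2 * ⟪f x μ y1 - f x μ y2, y1 - y2⟫ + ‖g x μ y1 - g x μ y2‖ ^ (2 : ℕ) ≤
      -γ * ‖y1 - y2‖ ^ (2 : ℕ)
  growthf : ∀ x μ y, memP2 μ → ‖f x μ y‖ ≤ CG * (1 + ‖y‖)
  growthg : ∀ x μ y, memP2 μ → ‖g x μ y‖ ≤ CG * (1 + ‖y‖ ^ ς)
  Y : Vec n → Measure (Vec n) → Vec m → ℝ → Ω → Vec m
  measY : ∀ x μ y t, Measurable (Y x μ y t)
  initY : ∀ x μ y ω, Y x μ y 0 ω = y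
  contY : ∀ x μ y ω, Continuous fun t => Y x μ y t ω
  mart : ∀ x μ y, memP2 μ → ∀ φ : Vec m → ℝ, TestFun φ →
    MartOn P ℱ fun t ω =>
      φ (Y x μ y t ω) - ∫ s in Set.Ioc (0 : ℝ) t, genFrozen f g x μ φ (Y x μ y s ω)
  martPair : ∀ x1 μ1 y1 x2 μ2 y2, memP2 μ1 → memP2 μ2 → ∀ φ : Vec m → Vec m → ℝ,
    TestFun2 φ →
    MartOn P ℱ fun t ω =>
      φ (Y x1 μ1 y1 t ω) (Y x2 μ2 y2 t ω) -
        ∫ s in Set.Ioc (0 : ℝ) t,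
          genPair f g x1 μ1 x2 μ2 φ (Y x1 μ1 y1 s ω) (Y x2 μ2 y2 s ω)
  ν : Vec n → Measure (Vec n) → Measure (Vec m)
  invν : ∀ x μ, memP2 μ → IsInvariantMeasure f g x μ (ν x μ)
  uniqν : ∀ x μ, memP2 μ → ∀ ν' : Measure (Vec m), IsInvariantMeasure f g x μ ν' →
    ν' = ν x μ

/-- `Φ(x,μ,y) = ∫_0^∞ E[K(x, μ, Y_t^{x,μ,y})] dt`, the solution of the Poisson equation. -/
def PoissonPhi {n m d : ℕ} {Ω : Type} [mΩ : MeasurableSpace Ω] {P : Measure Ω}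
    {ℱ : Filtration ℝ mΩ} (FS : FrozenSetting n m d Ω P ℱ)
    (K : Vec n → Measure (Vec n) → Vec m → Vec n) (x : Vec n) (μ : Measure (Vec n))
    (y : Vec m) : Vec n :=
  ∫ t in Set.Ioi (0 : ℝ), (∫ ω, K x μ (FS.Y x μ y t ω) ∂P)

/-- Conditions A1–A4 for the coefficient `K` (relative to a frozen fast dynamics):
Lipschitz continuity, linear growth, the regularity condition A3 for `K, f, g`,
and the centering condition A4. -/
structure KAssumptions {n m d : ℕ} {Ω : Type} [mΩ : MeasurableSpace Ω] {P : Measure Ω}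
    {ℱ : Filtration ℝ mΩ} (FS : FrozenSetting n m d Ω P ℱ)
    (K : Vec n → Measure (Vec n) → Vec m → Vec n) where
  CK : ℝ
  CB : ℝ
  γ1 : ℝ
  hγ1 : γ1 ∈ Set.Ioc (0 : ℝ) 1
  lip : ∀ x1 x2 μ1 μ2 y1 y2, memP2 μ1 → memP2 μ2 →
    ‖K x1 μ1 y1 - K x2 μ2 y2‖ ≤ CK * (‖x1 - x2‖ + ‖y1 - y2‖ + W2 μ1 μ2)
  growth : ∀ x μ y, memP2 μ → ‖K x μ y‖ ≤ CK * (1 + ‖y‖)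
  smoothK : Cb3 K CB
  lionsK : A3lions K CB γ1
  smoothf : Cb3 FS.f CB
  lionsf : A3lions FS.f CB γ1
  smoothg : Cb3 FS.g CB
  lionsg : A3lions FS.g CB γ1
  centering : ∀ x μ, memP2 μ → ∫ y, K x μ y ∂(FS.ν x μ) = 0

end DiffApprox

section Aux
set_option linter.unusedSectionVars false
set_option maxSynthPendingDepth 3
open MeasureTheory Filter
open scoped ENNReal NNReal Topology RealInnerProductSpace
namespace DiffApprox

/-- Second order operator in canonical form. -/
def Lop {E ι : Type*} [NormedAddCommGroup E] [NormedSpace ℝ E] [Fintype ι]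
    (B : ℝ → E → E) (S : ι → ℝ → E → E) (φ : E → ℝ) (s : ℝ) (z : E) : ℝ :=
  fderiv ℝ φ z (B s z) + (1 / 2) * ∑ k, fderiv ℝ (fderiv ℝ φ) z (S k s z) (S k s z)

section Calc
variable {E ι : Type*} [NormedAddCommGroup E] [NormedSpace ℝ E] [Fintype ι]

lemma fderiv_comp_scalar {V : E → ℝ} (hV : ContDiff ℝ 2 V) {θ θ' : ℝ → ℝ}
    (h1 : ∀ z, HasDerivAt θ (θ' (V z)) (V z)) :
    fderiv ℝ (fun z => θ (V z)) = fun z => θ' (V z) • fderiv ℝ V z := by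
  funext z
  have hd : HasFDerivAt V (fderiv ℝ V z) z :=
    ((hV.differentiable (by norm_num)) z).hasFDerivAt
  exact ((h1 z).comp_hasFDerivAt z hd).fderiv

lemma fderiv2_comp_scalar {V : E → ℝ} (hV : ContDiff ℝ 2 V) {θ θ' θ'' : ℝ → ℝ}
    (h1 : ∀ z, HasDerivAt θ (θ' (V z)) (V z)) (h2 : ∀ z, HasDerivAt θ' (θ'' (V z)) (V z))
    (z v w : E) :
    fderiv ℝ (fderiv ℝ (fun z => θ (V z))) z v w =
      θ' (V z) * fderiv ℝ (fderiv ℝ V) z v w +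
        θ'' (V z) * (fderiv ℝ V z v) * (fderiv ℝ V z w) := by
  rw [fderiv_comp_scalar hV h1]
  have hd : HasFDerivAt V (fderiv ℝ V z) z :=
    ((hV.differentiable (by norm_num)) z).hasFDerivAt
  have hd2 : HasFDerivAt (fderiv ℝ V) (fderiv ℝ (fderiv ℝ V) z) z :=
    (((hV.fderiv_right (m := 1) (by norm_num)).differentiable (by norm_num)) z).hasFDerivAt
  have h3 : HasFDerivAt (fun z => θ' (V z)) (θ'' (V z) • fderiv ℝ V z) z :=
    (h2 z).comp_hasFDerivAt z hd
  have h4 := h3.smul hd2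
  have h5 : fderiv ℝ (fun z => θ' (V z) • fderiv ℝ V z) z = _ := h4.fderiv
  rw [h5]
  simp

lemma Lop_comp (B : ℝ → E → E) (S : ι → ℝ → E → E) {V : E → ℝ} (hV : ContDiff ℝ 2 V)
    {θ θ' θ'' : ℝ → ℝ}
    (h1 : ∀ z, HasDerivAt θ (θ' (V z)) (V z)) (h2 : ∀ z, HasDerivAt θ' (θ'' (V z)) (V z))
    (s : ℝ) (z : E) :
    Lop B S (fun z => θ (V z)) s z =
      θ' (V z) * Lop B S V s z +
        (1 / 2) * θ'' (V z) * ∑ k, (fderiv ℝ V z (S k s z)) ^ 2 := by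
  unfold Lop
  simp_rw [fderiv2_comp_scalar hV h1 h2]
  rw [fderiv_comp_scalar hV h1, Finset.sum_add_distrib, ← Finset.mul_sum]
  have : ∑ i, θ'' (V z) * (fderiv ℝ V z (S i s z)) * (fderiv ℝ V z (S i s z)) =
      θ'' (V z) * ∑ k, (fderiv ℝ V z (S k s z)) ^ 2 := by
    rw [Finset.mul_sum]; exact Finset.sum_congr rfl fun i _ => by ring
  rw [this]
  simp
  ring

lemma Lop_add (B : ℝ → E → E) (S : ι → ℝ → E → E) {V W : E → ℝ} (hV : ContDiff ℝ 2 V)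
    (hW : ContDiff ℝ 2 W) (c : ℝ) (s : ℝ) (z : E) :
    Lop B S (fun z => V z + c * W z) s z = Lop B S V s z + c * Lop B S W s z := by
  have hd := hV.differentiable (by norm_num)
  have hd' := hW.differentiable (by norm_num)
  have hd2 : Differentiable ℝ (fderiv ℝ V) :=
    (hV.fderiv_right (m := 1) (by norm_num)).differentiable (by norm_num)
  have hd2' : Differentiable ℝ (fderiv ℝ W) :=
    (hW.fderiv_right (m := 1) (by norm_num)).differentiable (by norm_num)
  have e1 : fderiv ℝ (fun z => V z + c * W z) = fun z => fderiv ℝ V z + c • fderiv ℝ W z := by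
    funext z
    exact ((hd z).hasFDerivAt.add ((hd' z).hasFDerivAt.const_mul c)).fderiv
  have e2 : fderiv ℝ (fun z => fderiv ℝ V z + c • fderiv ℝ W z) z =
      fderiv ℝ (fderiv ℝ V) z + c • fderiv ℝ (fderiv ℝ W) z :=
    ((hd2 z).hasFDerivAt.add ((hd2' z).hasFDerivAt.const_smul c)).fderiv
  unfold Lop
  rw [e1, e2]
  simp [Finset.sum_add_distrib, ← Finset.mul_sum]
  ring

/-- `x ↦ (max x 0)^3` has derivative `3 (max x 0)^2`. -/
lemma hasDerivAt_pos_pow (k : ℕ) (hk : 1 ≤ k) (x : ℝ) :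
    HasDerivAt (fun x : ℝ => (max x 0) ^ (k + 1)) ((k + 1) * (max x 0) ^ k) x := by
  rcases lt_trichotomy x 0 with h | h | h
  · have : (fun x : ℝ => (max x 0) ^ (k + 1)) =ᶠ[𝓝 x] fun _ => 0 := by
      filter_upwards [gt_mem_nhds h] with y hy
      rw [max_eq_right hy.le]; simp
    rw [max_eq_right h.le, zero_pow (by omega), mul_zero]
    exact (hasDerivAt_const x (0:ℝ)).congr_of_eventuallyEq this
  · subst h
    rw [max_self, zero_pow (by omega), mul_zero]
    have hO : (fun y : ℝ => (max y 0) ^ (k + 1)) =O[𝓝 0] fun y : ℝ => y ^ (k + 1) := by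
      apply Asymptotics.isBigO_of_le
      intro y
      rw [norm_pow, norm_pow]
      apply pow_le_pow_left₀ (norm_nonneg _)
      rw [Real.norm_eq_abs, Real.norm_eq_abs]
      rcases le_total y 0 with h | h
      · rw [max_eq_right h]; simp
      · rw [max_eq_left h]
    have ho : (fun y : ℝ => y ^ (k + 1)) =o[𝓝 0] fun y : ℝ => y := by
      have := Asymptotics.isLittleO_pow_pow (𝕜 := ℝ) (show 1 < k + 1 by omega)
      simpa using this
    rw [hasDerivAt_iff_isLittleO]
    simpa using hO.trans_isLittleO ho
  · have : (fun x : ℝ => (max x 0) ^ (k + 1)) =ᶠ[𝓝 x] fun y => y ^ (k + 1) := by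
      filter_upwards [lt_mem_nhds h] with y hy
      rw [max_eq_left hy.le]
    rw [max_eq_left h.le]
    have h2 := hasDerivAt_pow (k + 1) x
    simp only [Nat.add_sub_cancel] at h2
    push_cast at h2
    exact h2.congr_of_eventuallyEq this

lemma contDiff_pos_cube : ContDiff ℝ 2 (fun x : ℝ => (max x 0) ^ 3) := by
  have h3 : deriv (fun x : ℝ => (max x 0) ^ 3) = fun x => 3 * (max x 0) ^ 2 := by
    funext x
    have := (hasDerivAt_pos_pow 2 (by norm_num) x).deriv
    norm_num at this ⊢; exact this
  have h2 : deriv (fun x : ℝ => (max x 0) ^ 2) = fun x => 2 * (max x 0) := by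
    funext x
    have := (hasDerivAt_pos_pow 1 (by norm_num) x).deriv
    norm_num at this ⊢; exact this
  have c2 : ContDiff ℝ 1 (fun x : ℝ => (max x 0) ^ 2) := by
    rw [contDiff_one_iff_deriv]
    refine ⟨fun x => (hasDerivAt_pos_pow 1 (by norm_num) x).differentiableAt, ?_⟩
    rw [h2]; fun_prop
  have : (2 : WithTop ℕ∞) = 1 + 1 := by norm_num
  rw [this, contDiff_succ_iff_deriv]
  refine ⟨fun x => (hasDerivAt_pos_pow 2 (by norm_num) x).differentiableAt, by simp, ?_⟩
  rw [h3]
  exact contDiff_const.mul c2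

/-- concave truncation -/
def thR (R u : ℝ) : ℝ := (R / 3) * (1 - (max (1 - u / R) 0) ^ 3)
/-- derivative of the concave truncation -/
def thR' (R u : ℝ) : ℝ := (max (1 - u / R) 0) ^ 2
/-- second derivative of the concave truncation -/
def thR'' (R u : ℝ) : ℝ := - (2 / R) * (max (1 - u / R) 0)

lemma thR_hasDeriv {R : ℝ} (hR : 0 < R) (u : ℝ) : HasDerivAt (thR R) (thR' R u) u := by
  have h0 : HasDerivAt (fun u : ℝ => 1 - u / R) (-(1 / R)) u := by
    simpa using ((hasDerivAt_id u).div_const R).const_sub 1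
  have h1 := (hasDerivAt_pos_pow 2 (by norm_num) (1 - u / R)).comp u h0
  have h2 := (h1.const_sub 1).const_mul (R / 3)
  refine h2.congr_deriv ?_
  unfold thR'
  push_cast
  field_simp
  ring

lemma thR'_hasDeriv {R : ℝ} (hR : 0 < R) (u : ℝ) : HasDerivAt (thR' R) (thR'' R u) u := by
  have h0 : HasDerivAt (fun u : ℝ => 1 - u / R) (-(1 / R)) u := by
    simpa using ((hasDerivAt_id u).div_const R).const_sub 1
  have h1 := (hasDerivAt_pos_pow 1 (by norm_num) (1 - u / R)).comp u h0
  refine h1.congr_deriv ?_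
  unfold thR''
  push_cast
  field_simp
  ring

lemma thR''_nonpos {R : ℝ} (hR : 0 < R) (u : ℝ) : thR'' R u ≤ 0 := by
  unfold thR''
  have : 0 ≤ 2 / R * max (1 - u / R) 0 := by positivity
  linarith

lemma thR'_nonneg (R u : ℝ) : 0 ≤ thR' R u := by unfold thR'; positivity

lemma thR'_le_one {R u : ℝ} (hR : 0 < R) (hu : 0 ≤ u) : thR' R u ≤ 1 := by
  unfold thR'
  apply pow_le_one₀ (by positivity)
  apply max_le _ zero_le_one
  have : 0 ≤ u / R := by positivity
  linarith

lemma thR_bounds {R u : ℝ} (hR : 0 < R) (hu : 0 ≤ u) :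
    0 ≤ thR R u ∧ thR R u ≤ u ∧ thR R u ≤ R ∧ thR' R u * u ≤ thR R u := by
  unfold thR thR'
  have hx : 0 ≤ u / R := by positivity
  have huR : u = R * (u / R) := by field_simp
  set x := u / R
  have m0 : 0 ≤ max (1 - x) 0 := le_max_right _ _
  have m1 : max (1 - x) 0 ≤ 1 := max_le (by linarith) zero_le_one
  have m2 : 1 - x ≤ max (1 - x) 0 := le_max_left _ _
  have m3 : max (1 - x) 0 = 1 - x ∨ max (1 - x) 0 = 0 := by
    rcases max_choice (1 - x) 0 with h | h <;> simp [h]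
  set y := max (1 - x) 0
  have y3 : y ^ 3 ≤ 1 := pow_le_one₀ m0 m1
  refine ⟨?_, ?_, ?_, ?_⟩
  · have : 0 ≤ 1 - y ^ 3 := by linarith
    positivity
  · rw [huR]
    have : 1 - y ^ 3 ≤ 3 * x := by nlinarith [sq_nonneg (y - 1), sq_nonneg y]
    nlinarith
  · have : 0 ≤ y ^ 3 := by positivity
    nlinarith
  · rw [huR]
    have : 3 * (y ^ 2 * x) ≤ 1 - y ^ 3 := by
      rcases m3 with h | h
      · have : x = 1 - y := by linarith
        rw [this]; nlinarith [sq_nonneg (y - 1), sq_nonneg y, mul_nonneg m0 (sq_nonneg (y-1))]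
      · rw [h]; norm_num
    nlinarith

lemma thR_tendsto (u : ℝ) :
    Tendsto (fun k : ℕ => thR ((k : ℝ) + 1) u) atTop (𝓝 u) := by
  have hR : Tendsto (fun k : ℕ => (k : ℝ) + 1) atTop atTop :=
    tendsto_atTop_add_const_right _ _ tendsto_natCast_atTop_atTop
  have h0 : Tendsto (fun k : ℕ => u / ((k : ℝ) + 1)) atTop (𝓝 0) :=
    tendsto_const_nhds.div_atTop hR
  have h1 : Tendsto (fun k : ℕ => u * (1 - u / ((k : ℝ) + 1) + (u / ((k : ℝ) + 1)) ^ 2 / 3))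
      atTop (𝓝 (u * (1 - 0 + 0 ^ 2 / 3))) :=
    tendsto_const_nhds.mul ((tendsto_const_nhds.sub h0).add ((h0.pow 2).div_const 3))
  have : u * (1 - 0 + 0 ^ 2 / 3) = u := by ring
  rw [this] at h1
  refine h1.congr' ?_
  filter_upwards [h0.eventually (gt_mem_nhds (show (0:ℝ) < 1 by norm_num))] with k hk
  unfold thR
  rw [max_eq_left (by linarith)]
  have : (k : ℝ) + 1 ≠ 0 := by positivity
  field_simp
  ring

lemma thR'_tendsto (u : ℝ) :
    Tendsto (fun k : ℕ => thR' ((k : ℝ) + 1) u) atTop (𝓝 1) := by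
  have hR : Tendsto (fun k : ℕ => (k : ℝ) + 1) atTop atTop :=
    tendsto_atTop_add_const_right _ _ tendsto_natCast_atTop_atTop
  have h0 : Tendsto (fun k : ℕ => u / ((k : ℝ) + 1)) atTop (𝓝 0) :=
    tendsto_const_nhds.div_atTop hR
  have h1 : Tendsto (fun k : ℕ => (max (1 - u / ((k : ℝ) + 1)) 0) ^ 2) atTop
      (𝓝 ((max (1 - 0) 0) ^ 2)) := ((tendsto_const_nhds.sub h0).max tendsto_const_nhds).pow 2
  simpa [thR'] using h1

lemma thR_continuous (R : ℝ) : Continuous (thR R) := by unfold thR; fun_prop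
lemma thR'_continuous (R : ℝ) : Continuous (thR' R) := by unfold thR'; fun_prop

end Calc


/-- Abstract martingale problem. -/
structure MP {E ι : Type*} [NormedAddCommGroup E] [NormedSpace ℝ E] [MeasurableSpace E]
    [Fintype ι] {Ω : Type} [mΩ : MeasurableSpace Ω] (P : Measure Ω) (ℱ : Filtration ℝ mΩ)
    (Z : ℝ → Ω → E) (B : ℝ → E → E) (S : ι → ℝ → E → E) (β : ℝ → ℝ) (Λ : ℝ) : Prop where
  measZ : ∀ t, Measurable[ℱ t] (Z t)
  cont : ∀ ω, Continuous fun t => Z t ω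
  measB : Measurable (fun q : ℝ × E => B q.1 q.2)
  measS : ∀ k, Measurable (fun q : ℝ × E => S k q.1 q.2)
  measβ : Measurable β
  βnn : ∀ s, 0 ≤ β s
  Λnn : 0 ≤ Λ
  boundB : ∀ s z, ‖B s z‖ ≤ Λ * (1 + ‖z‖) + β s
  boundS : ∀ k s z, ‖S k s z‖ ≤ Λ * (1 + ‖z‖)
  mart : ∀ φ : E → ℝ, ContDiff ℝ 2 φ → HasCompactSupport φ →
    MartOn P ℱ fun t ω => φ (Z t ω) - ∫ s in Set.Ioc (0 : ℝ) t, Lop B S φ s (Z s ω)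

section Abs
variable {E ι : Type*} [NormedAddCommGroup E] [NormedSpace ℝ E] [FiniteDimensional ℝ E]
  [MeasurableSpace E] [BorelSpace E] [SecondCountableTopology E]
  [Fintype ι] {Ω : Type} [mΩ : MeasurableSpace Ω] {P : Measure Ω} [IsProbabilityMeasure P]
  {ℱ : Filtration ℝ mΩ}
  {Z : ℝ → Ω → E} {B : ℝ → E → E} {S : ι → ℝ → E → E} {β : ℝ → ℝ} {Λ : ℝ}

lemma Lop_meas (hB : Measurable (fun q : ℝ × E => B q.1 q.2))
    (hS : ∀ k, Measurable (fun q : ℝ × E => S k q.1 q.2)) {φ : E → ℝ} (hφ : ContDiff ℝ 2 φ) :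
    Measurable (fun q : ℝ × E => Lop B S φ q.1 q.2) := by
  unfold Lop
  have c1 : Continuous fun p : E × E => (fderiv ℝ φ p.1) p.2 :=
    hφ.continuous_fderiv_apply (by norm_num)
  have c2 : Continuous fun p : E × E => (fderiv ℝ (fderiv ℝ φ) p.1) p.2 p.2 := by
    have h : ContDiff ℝ 1 (fderiv ℝ φ) := hφ.fderiv_right (by norm_num)
    have := h.continuous_fderiv_apply (by norm_num)
    exact this.clm_apply continuous_snd
  refine Measurable.add (c1.measurable.comp (measurable_snd.prodMk hB)) ?_
  refine Measurable.const_mul ?_ _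
  refine Finset.measurable_sum _ fun k _ => ?_
  exact c2.measurable.comp (measurable_snd.prodMk (hS k))

lemma MP.measZ' (h : MP P ℱ Z B S β Λ) (t : ℝ) : Measurable (Z t) :=
  (h.measZ t).mono (ℱ.le t) le_rfl

lemma MP.measJ (h : MP P ℱ Z B S β Λ) : Measurable (fun q : ℝ × Ω => Z q.1 q.2) :=
  measurable_uncurry_of_continuous_of_measurable h.cont h.measZ'

lemma MP.measG (h : MP P ℱ Z B S β Λ) {G : ℝ × E → ℝ} (hG : Measurable G) :
    Measurable (fun q : ℝ × Ω => G (q.1, Z q.1 q.2)) :=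
  hG.comp (measurable_fst.prodMk h.measJ)

lemma cs_bound {F : Type*} [NormedAddCommGroup F] {f : E → F} (hf : Continuous f)
    (hc : HasCompactSupport f) (k : ℕ) : ∃ M, 0 ≤ M ∧ ∀ z, (1 + ‖z‖) ^ k * ‖f z‖ ≤ M := by
  have h2 : HasCompactSupport fun z => (1 + ‖z‖) ^ k * ‖f z‖ :=
    HasCompactSupport.mul_left hc.norm
  obtain ⟨M, hM⟩ := h2.exists_bound_of_continuous (by fun_prop)
  exact ⟨M, (norm_nonneg _).trans (hM 0), fun z => (Real.le_norm_self _).trans (hM z)⟩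

lemma MP.Lop_bound (h : MP P ℱ Z B S β Λ) {φ : E → ℝ} (hφ : ContDiff ℝ 2 φ)
    (hc : HasCompactSupport φ) : ∃ M, 0 ≤ M ∧ ∀ s z, |Lop B S φ s z| ≤ M * (1 + β s) := by
  have k1 : HasCompactSupport (fderiv ℝ φ) := hc.fderiv ℝ
  have k2 : HasCompactSupport (fderiv ℝ (fderiv ℝ φ)) := k1.fderiv ℝ
  have c1 : Continuous (fderiv ℝ φ) := hφ.continuous_fderiv (by norm_num)
  have c2 : Continuous (fderiv ℝ (fderiv ℝ φ)) :=
    (hφ.fderiv_right (m := 1) (by norm_num)).continuous_fderiv (by norm_num)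
  obtain ⟨M1, M1nn, hM1⟩ := cs_bound c1 k1 1
  obtain ⟨M2, M2nn, hM2⟩ := cs_bound c2 k2 2
  have hΛ := h.Λnn
  refine ⟨M1 * Λ + M1 + (1 / 2) * (Fintype.card ι * (M2 * Λ ^ 2)), by positivity, fun s z => ?_⟩
  have hβ := h.βnn s
  have e1 := hM1 z
  have e2 := hM2 z
  have b1 := h.boundB s z
  have b2 := fun k => h.boundS k s z
  unfold Lop
  have l1 : |fderiv ℝ φ z (B s z)| ≤ ‖fderiv ℝ φ z‖ * ‖B s z‖ := (fderiv ℝ φ z).le_opNorm _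
  have l2 : ∀ k, |fderiv ℝ (fderiv ℝ φ) z (S k s z) (S k s z)| ≤
      ‖fderiv ℝ (fderiv ℝ φ) z‖ * ‖S k s z‖ * ‖S k s z‖ := fun k => by
    rw [← Real.norm_eq_abs]
    exact (fderiv ℝ (fderiv ℝ φ) z).le_opNorm₂ (S k s z) (S k s z)
  have N1 : 0 ≤ ‖fderiv ℝ φ z‖ := norm_nonneg _
  have N2 : 0 ≤ ‖fderiv ℝ (fderiv ℝ φ) z‖ := norm_nonneg _
  have N3 : 0 ≤ ‖z‖ := norm_nonneg _
  have N4 : ∀ k, 0 ≤ ‖S k s z‖ := fun k => norm_nonneg _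
  generalize ‖fderiv ℝ φ z‖ = D1 at *
  generalize ‖fderiv ℝ (fderiv ℝ φ) z‖ = D2 at *
  generalize ‖z‖ = nz at *
  generalize fderiv ℝ φ z (B s z) = U1 at *
  generalize ‖B s z‖ = nB at *
  have a1 : |U1| ≤ M1 * Λ + M1 * β s := by
    have e1' : D1 ≤ M1 := by nlinarith
    calc |U1| ≤ D1 * nB := l1
      _ ≤ D1 * (Λ * (1 + nz) + β s) := by gcongr
      _ = ((1 + nz) ^ 1 * D1) * Λ + D1 * β s := by ring
      _ ≤ _ := by gcongr
  have a2 : ∀ k, |fderiv ℝ (fderiv ℝ φ) z (S k s z) (S k s z)| ≤ M2 * Λ ^ 2 := fun k => by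
    have b2k := b2 k
    have N4k := N4 k
    refine (l2 k).trans ?_
    generalize ‖S k s z‖ = sk at *
    calc D2 * sk * sk
        ≤ D2 * (Λ * (1 + nz)) * (Λ * (1 + nz)) := by gcongr
      _ = ((1 + nz) ^ 2 * D2) * Λ ^ 2 := by ring
      _ ≤ _ := by gcongr
  have a3 : |∑ k, fderiv ℝ (fderiv ℝ φ) z (S k s z) (S k s z)| ≤
      Fintype.card ι * (M2 * Λ ^ 2) := by
    refine (Finset.abs_sum_le_sum_abs _ _).trans ?_
    refine (Finset.sum_le_sum fun k _ => a2 k).trans ?_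
    simp
  generalize (∑ k, fderiv ℝ (fderiv ℝ φ) z (S k s z) (S k s z)) = U2 at *
  have q : 0 ≤ (1 / 2 : ℝ) * (Fintype.card ι * (M2 * Λ ^ 2)) := by positivity
  calc |U1 + (1 / 2) * U2| ≤ |U1| + |(1 / 2) * U2| := abs_add_le _ _
    _ ≤ (M1 * Λ + M1 * β s) + (1 / 2) * (Fintype.card ι * (M2 * Λ ^ 2)) := by
        rw [abs_mul, abs_of_pos (show (0:ℝ) < 1 / 2 by norm_num)]
        gcongr
    _ ≤ _ := by nlinarith [mul_nonneg (mul_nonneg M1nn hΛ) hβ, mul_nonneg q hβ]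

/-- Martingale identity against events. -/
lemma MP.mart_set (h : MP P ℱ Z B S β Λ) {φ : E → ℝ} (hφ : ContDiff ℝ 2 φ)
    (hc : HasCompactSupport φ) {s t : ℝ} (hs : 0 ≤ s) (hst : s ≤ t) {A : Set Ω}
    (hA : MeasurableSet[ℱ s] A) :
    ∫ ω in A, (φ (Z t ω) - ∫ r in Set.Ioc (0 : ℝ) t, Lop B S φ r (Z r ω)) ∂P =
    ∫ ω in A, (φ (Z s ω) - ∫ r in Set.Ioc (0 : ℝ) s, Lop B S φ r (Z r ω)) ∂P := by
  have hm := h.mart φ hφ hc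
  have h1 := setIntegral_condExp (ℱ.le s) (hm.1 t (hs.trans hst)).2 hA
  rw [← h1]
  exact setIntegral_congr_ae (ℱ.le s _ hA) ((hm.2 s t hs hst).mono fun ω hω _ => hω)

lemma MP.dynkin_test (h : MP P ℱ Z B S β Λ) {φ : E → ℝ} (hφ : ContDiff ℝ 2 φ)
    (hc : HasCompactSupport φ) {s t : ℝ} (hs : 0 ≤ s) (hst : s ≤ t)
    (hβ : IntegrableOn β (Set.Ioc 0 t)) {A : Set Ω} (hA : MeasurableSet[ℱ s] A) :
    Integrable (fun q : ℝ × Ω => Lop B S φ q.1 (Z q.1 q.2))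
      ((volume.restrict (Set.Ioc s t)).prod (P.restrict A)) ∧
    ∫ ω in A, φ (Z t ω) ∂P = ∫ ω in A, φ (Z s ω) ∂P +
      ∫ q, Lop B S φ q.1 (Z q.1 q.2) ∂((volume.restrict (Set.Ioc s t)).prod (P.restrict A)) := by
  obtain ⟨M, hM0, hM⟩ := h.Lop_bound hφ hc
  have hmeas : Measurable (fun q : ℝ × Ω => Lop B S φ q.1 (Z q.1 q.2)) :=
    h.measG (G := fun q => Lop B S φ q.1 q.2) (Lop_meas h.measB h.measS hφ)
  have key : ∀ u v, 0 ≤ u → v ≤ t → Integrable (fun q : ℝ × Ω => Lop B S φ q.1 (Z q.1 q.2))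
      ((volume.restrict (Set.Ioc u v)).prod (P.restrict A)) := by
    intro u v hu hv
    have hb : IntegrableOn β (Set.Ioc u v) := hβ.mono_set (Set.Ioc_subset_Ioc hu hv)
    have hb1 : Integrable (fun s => M * (1 + β s)) (volume.restrict (Set.Ioc u v)) :=
      ((integrable_const 1).add hb).const_mul M
    have hb2 := hb1.comp_fst (P.restrict A)
    exact hb2.mono' hmeas.aestronglyMeasurable (Eventually.of_forall fun q => hM _ _)
  refine ⟨key s t hs le_rfl, ?_⟩
  have h1 := h.mart_set hφ hc hs hst hA
  have hφb : ∀ r, Integrable (fun ω => φ (Z r ω)) (P.restrict A) := by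
    intro r
    obtain ⟨C, hC⟩ := hc.exists_bound_of_continuous hφ.continuous
    exact Integrable.of_bound ((hφ.continuous.measurable.comp (h.measZ' r)).aestronglyMeasurable) C
      (Eventually.of_forall fun ω => hC _)
  have i1 := (key 0 t le_rfl le_rfl)
  have i2 := (key 0 s le_rfl hst)
  rw [integral_sub (hφb t) i1.integral_prod_right, integral_sub (hφb s) i2.integral_prod_right,
    ← integral_prod_symm _ i1, ← integral_prod_symm _ i2] at h1
  have hsplit : (volume.restrict (Set.Ioc (0:ℝ) t)).prod (P.restrict A) =
      (volume.restrict (Set.Ioc (0:ℝ) s)).prod (P.restrict A) +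
      (volume.restrict (Set.Ioc s t)).prod (P.restrict A) := by
    rw [← Measure.add_prod, ← Measure.restrict_union (Set.Ioc_disjoint_Ioc_of_le le_rfl)
      measurableSet_Ioc, Set.Ioc_union_Ioc_eq_Ioc hs hst]
  rw [hsplit, integral_add_measure i2 (key s t hs le_rfl)] at h1
  linarith

end Abs


lemma gron {a b N A0 Mb : ℝ} {v κ2 : ℝ → ℝ} (hN : 0 < N) (hA0 : 0 ≤ A0)
    (hv0 : ∀ t ∈ Set.Icc a b, 0 ≤ v t) (hvM : ∀ t ∈ Set.Icc a b, v t ≤ Mb)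
    (hκ0 : ∀ s, 0 ≤ κ2 s) (hκ : IntegrableOn κ2 (Set.Ioc a b))
    (hκ4 : ∫ s in Set.Ioc a b, κ2 s ≤ 1 / 4)
    (h : ∀ t ∈ Set.Icc a b, v t ≤ A0 + ∫ s in Set.Ioc a t, (N + κ2 s) * v s) :
    ∀ t ∈ Set.Icc a b, v t ≤ 2 * A0 * Real.exp (4 * N * (t - a)) := by
  intro t ht
  set w : ℝ → ℝ := fun t => v t * Real.exp (-(4 * N * (t - a))) with hw
  have hwb : BddAbove (w '' Set.Icc a b) := by
    refine ⟨Mb, ?_⟩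
    rintro _ ⟨s, hs, rfl⟩
    have h1 : Real.exp (-(4 * N * (s - a))) ≤ 1 := by
      rw [Real.exp_le_one_iff]
      have : 0 ≤ s - a := by linarith [hs.1]
      have : 0 ≤ 4 * N * (s - a) := by positivity
      linarith
    calc w s ≤ v s * 1 := mul_le_mul_of_nonneg_left h1 (hv0 s hs)
      _ ≤ Mb := by rw [mul_one]; exact hvM s hs
  set m := sSup (w '' Set.Icc a b) with hm
  have hle : ∀ s ∈ Set.Icc a b, v s ≤ m * Real.exp (4 * N * (s - a)) := by
    intro s hs
    have : w s ≤ m := le_csSup hwb ⟨s, hs, rfl⟩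
    have e : v s = w s * Real.exp (4 * N * (s - a)) := by
      simp only [hw]
      rw [mul_assoc, ← Real.exp_add]; simp
    rw [e]; gcongr
  have hm0 : 0 ≤ m := by
    have h1 := hle t ht
    have h2 := hv0 t ht
    by_contra hc
    push Not at hc
    have := mul_neg_of_neg_of_pos hc (Real.exp_pos (4 * N * (t - a)))
    linarith
  have step : ∀ u ∈ Set.Icc a b, w u ≤ A0 + m / 2 := by
    intro u hu
    have hexp1 : IntegrableOn (fun s => N * (m * Real.exp (4 * N * (s - a)))) (Set.Ioc a u) :=
      (Continuous.integrableOn_Ioc (by fun_prop))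
    have hκu : IntegrableOn κ2 (Set.Ioc a u) := hκ.mono_set (Set.Ioc_subset_Ioc_right hu.2)
    have hexp2 : IntegrableOn (fun s => κ2 s * (m * Real.exp (4 * N * (u - a)))) (Set.Ioc a u) :=
      hκu.mul_const _
    have I1 : ∫ s in Set.Ioc a u, (N + κ2 s) * v s ≤
        ∫ s in Set.Ioc a u, (N * (m * Real.exp (4 * N * (s - a))) +
          κ2 s * (m * Real.exp (4 * N * (u - a)))) := by
      refine integral_mono_of_nonneg ?_ (hexp1.add hexp2) ?_
      · filter_upwards [ae_restrict_mem measurableSet_Ioc] with s hs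
        exact mul_nonneg (add_nonneg hN.le (hκ0 s)) (hv0 s ⟨hs.1.le, hs.2.trans hu.2⟩)
      · filter_upwards [ae_restrict_mem measurableSet_Ioc] with s hs
        have e1 := hle s ⟨hs.1.le, hs.2.trans hu.2⟩
        have e2 : m * Real.exp (4 * N * (s - a)) ≤ m * Real.exp (4 * N * (u - a)) := by
          gcongr; exact hs.2
        rw [add_mul]
        exact add_le_add (mul_le_mul_of_nonneg_left e1 hN.le)
          (mul_le_mul_of_nonneg_left (e1.trans e2) (hκ0 s))
    have I2 : ∫ s in Set.Ioc a u, N * (m * Real.exp (4 * N * (s - a))) ≤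
        m / 4 * Real.exp (4 * N * (u - a)) := by
      rw [← intervalIntegral.integral_of_le hu.1]
      have hd : ∀ s ∈ Set.uIcc a u, HasDerivAt (fun s => m / 4 * Real.exp (4 * N * (s - a)))
          (N * (m * Real.exp (4 * N * (s - a)))) s := by
        intro s _
        have h1 : HasDerivAt (fun s => 4 * N * (s - a)) (4 * N) s := by
          simpa using ((hasDerivAt_id s).sub_const a).const_mul (4 * N)
        refine (h1.exp.const_mul (m / 4)).congr_deriv ?_
        ring
      rw [intervalIntegral.integral_eq_sub_of_hasDerivAt hd
        (Continuous.intervalIntegrable (by fun_prop) _ _)]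
      have : 0 ≤ m / 4 * Real.exp (4 * N * (a - a)) := by positivity
      linarith
    have I3 : ∫ s in Set.Ioc a u, κ2 s * (m * Real.exp (4 * N * (u - a))) ≤
        m / 4 * Real.exp (4 * N * (u - a)) := by
      rw [integral_mul_const]
      have : ∫ s in Set.Ioc a u, κ2 s ≤ 1 / 4 := by
        refine le_trans ?_ hκ4
        exact setIntegral_mono_set hκ (Eventually.of_forall hκ0)
          (Set.Ioc_subset_Ioc_right hu.2).eventuallyLE
      have e0 : 0 ≤ m * Real.exp (4 * N * (u - a)) := by positivity
      calc _ ≤ 1 / 4 * (m * Real.exp (4 * N * (u - a))) := mul_le_mul_of_nonneg_right this e0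
        _ = _ := by ring
    rw [integral_add hexp1 hexp2] at I1
    have H := h u hu
    have H2 : v u ≤ A0 + m / 2 * Real.exp (4 * N * (u - a)) := by linarith
    have hu0 : 0 ≤ 4 * N * (u - a) := by
      have : 0 ≤ u - a := by linarith [hu.1]
      positivity
    have e1 : 1 ≤ Real.exp (4 * N * (u - a)) := Real.one_le_exp hu0
    have H3 : v u ≤ (A0 + m / 2) * Real.exp (4 * N * (u - a)) := by nlinarith
    calc w u ≤ (A0 + m / 2) * Real.exp (4 * N * (u - a)) * Real.exp (-(4 * N * (u - a))) := by
          simp only [hw]; gcongr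
      _ = A0 + m / 2 := by rw [mul_assoc, ← Real.exp_add]; simp
  have hmle : m ≤ A0 + m / 2 := by
    apply csSup_le (Set.Nonempty.image _ ⟨t, ht⟩)
    rintro _ ⟨s, hs, rfl⟩
    exact step s hs
  calc v t ≤ m * Real.exp (4 * N * (t - a)) := hle t ht
    _ ≤ _ := by gcongr; linarith

lemma split_kappa {κ : ℝ → ℝ} {a b : ℝ} (hm : Measurable κ)
    (hi : IntegrableOn κ (Set.Ioc a b)) :
    ∃ (N : ℝ) (κ2 : ℝ → ℝ), 0 < N ∧ Measurable κ2 ∧ (∀ s, 0 ≤ κ2 s) ∧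
      IntegrableOn κ2 (Set.Ioc a b) ∧ ∫ s in Set.Ioc a b, κ2 s ≤ 1 / 4 ∧
      ∀ s, κ s ≤ N + κ2 s := by
  have ht : Tendsto (fun k : ℕ => ∫ s in Set.Ioc a b, max (κ s - ((k : ℝ) + 1)) 0) atTop (𝓝 0) := by
    have := tendsto_integral_of_dominated_convergence (μ := volume.restrict (Set.Ioc a b))
      (F := fun (k : ℕ) s => max (κ s - ((k : ℝ) + 1)) 0) (f := fun _ => (0 : ℝ))
      (fun s => |κ s|) (fun k => (by fun_prop : Measurable _).aestronglyMeasurable) hi.abs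
      (fun k => Eventually.of_forall fun s => ?_) (Eventually.of_forall fun s => ?_)
    · simpa using this
    · rw [Real.norm_eq_abs, abs_of_nonneg (le_max_right _ _)]
      apply max_le _ (abs_nonneg _)
      have := le_abs_self (κ s)
      have : (0 : ℝ) ≤ k := k.cast_nonneg
      linarith
    · apply tendsto_const_nhds.congr'
      obtain ⟨k0, hk0⟩ := exists_nat_ge (κ s)
      filter_upwards [eventually_ge_atTop k0] with k hk
      rw [max_eq_right]
      have : (k0 : ℝ) ≤ k := by exact_mod_cast hk
      linarith
  obtain ⟨k, hk⟩ := (ht.eventually (gt_mem_nhds (show (0 : ℝ) < 1 / 4 by norm_num))).exists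
  refine ⟨(k : ℝ) + 1, fun s => max (κ s - ((k : ℝ) + 1)) 0, by positivity, by fun_prop,
    fun s => le_max_right _ _, ?_, hk.le, fun s => ?_⟩
  · refine hi.abs.mono' (by fun_prop : Measurable _).aestronglyMeasurable
      (Eventually.of_forall fun s => ?_)
    rw [Real.norm_eq_abs, abs_of_nonneg (le_max_right _ _)]
    apply max_le _ (abs_nonneg _)
    have := le_abs_self (κ s)
    have : (0 : ℝ) ≤ k := k.cast_nonneg
    linarith
  · have := le_max_left (κ s - ((k : ℝ) + 1)) 0
    linarith

section Abs
variable {E ι : Type*} [NormedAddCommGroup E] [NormedSpace ℝ E] [FiniteDimensional ℝ E]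
  [MeasurableSpace E] [BorelSpace E] [SecondCountableTopology E]
  [Fintype ι] {Ω : Type} [mΩ : MeasurableSpace Ω] {P : Measure Ω} [IsProbabilityMeasure P]
  {ℱ : Filtration ℝ mΩ}
  {Z : ℝ → Ω → E} {B : ℝ → E → E} {S : ι → ℝ → E → E} {β : ℝ → ℝ} {Λ : ℝ}

lemma MP.thInt (h : MP P ℱ Z B S β Λ) {V : E → ℝ} (hV : Continuous V) (V0 : ∀ z, 0 ≤ V z)
    {R : ℝ} (hR : 0 < R) (r : ℝ) (A : Set Ω) :
    Integrable (fun ω => thR R (V (Z r ω))) (P.restrict A) := by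
  refine Integrable.of_bound (((thR_continuous R).comp hV).measurable.comp
    (h.measZ' r)).aestronglyMeasurable R (Eventually.of_forall fun ω => ?_)
  have := thR_bounds hR (V0 (Z r ω))
  rw [Real.norm_eq_abs, abs_of_nonneg this.1]
  exact this.2.2.1

lemma MP.trunc (h : MP P ℱ Z B S β Λ) {V : E → ℝ} (hV : ContDiff ℝ 2 V) (V0 : ∀ z, 0 ≤ V z)
    {δ : ℝ} (hδ : 0 < δ) (hp : ∀ z, δ * ‖z‖ ≤ V z) {R : ℝ} (hR : 0 < R)
    {s t : ℝ} (hs : 0 ≤ s) (hst : s ≤ t) (hβ : IntegrableOn β (Set.Ioc 0 t))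
    {A : Set Ω} (hA : MeasurableSet[ℱ s] A) {H : ℝ × Ω → ℝ}
    (hH : ∀ r ∈ Set.Ioc s t, ∀ ω, thR' R (V (Z r ω)) * Lop B S V r (Z r ω) ≤ H (r, ω))
    (hHi : Integrable H ((volume.restrict (Set.Ioc s t)).prod (P.restrict A))) :
    ∫ ω in A, thR R (V (Z t ω)) ∂P ≤ ∫ ω in A, thR R (V (Z s ω)) ∂P +
      ∫ q, H q ∂((volume.restrict (Set.Ioc s t)).prod (P.restrict A)) := by
  set θ : ℝ → ℝ := fun u => R / 3 - thR R u with hθ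
  have θeq : θ = fun u => (R / 3) * (max (1 - u / R) 0) ^ 3 := by
    funext u; simp only [hθ, thR]; ring
  have hφ : ContDiff ℝ 2 fun z => θ (V z) := by
    rw [θeq]
    have : ContDiff ℝ 2 fun z => 1 - V z / R := contDiff_const.sub (hV.div_const R)
    exact contDiff_const.mul (contDiff_pos_cube.comp this)
  have hc : HasCompactSupport fun z => θ (V z) := by
    refine HasCompactSupport.intro (isCompact_closedBall (0 : E) (R / δ)) fun z hz => ?_
    have hz' : R / δ < ‖z‖ := by simpa using hz
    rw [div_lt_iff₀ hδ] at hz'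
    have h1 : R ≤ V z := by nlinarith [hp z]
    have h2 : 1 - V z / R ≤ 0 := by
      rw [sub_nonpos, le_div_iff₀ hR]; linarith
    rw [θeq]; simp [max_eq_right h2]
  have hd1 : ∀ z, HasDerivAt θ ((fun u => -thR' R u) (V z)) (V z) := fun z =>
    (thR_hasDeriv hR (V z)).const_sub (R / 3)
  have hd2 : ∀ z, HasDerivAt (fun u => -thR' R u) ((fun u => -thR'' R u) (V z)) (V z) := fun z =>
    (thR'_hasDeriv hR (V z)).neg
  have hL := fun r z => Lop_comp B S hV (θ' := fun u => -thR' R u)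
    (θ'' := fun u => -thR'' R u) hd1 hd2 r z
  obtain ⟨d1, d2⟩ := h.dynkin_test hφ hc hs hst hβ hA
  have hcmp : - ∫ q, Lop B S (fun z => θ (V z)) q.1 (Z q.1 q.2)
      ∂((volume.restrict (Set.Ioc s t)).prod (P.restrict A)) ≤
      ∫ q, H q ∂((volume.restrict (Set.Ioc s t)).prod (P.restrict A)) := by
    rw [← integral_neg]
    refine integral_mono_ae d1.neg hHi ?_
    have hmem : ∀ᵐ q ∂((volume.restrict (Set.Ioc s t)).prod (P.restrict A)),
        q.1 ∈ Set.Ioc s t :=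
      Measure.quasiMeasurePreserving_fst.ae (ae_restrict_mem measurableSet_Ioc)
    filter_upwards [hmem] with q hq
    have h1 := hH q.1 hq q.2
    have h2 : 0 ≤ ∑ k, (fderiv ℝ V (Z q.1 q.2) (S k q.1 (Z q.1 q.2))) ^ 2 :=
      Finset.sum_nonneg fun k _ => sq_nonneg _
    have h3 := thR''_nonpos hR (V (Z q.1 q.2))
    rw [hL]
    have := mul_nonneg (neg_nonneg.2 h3) h2
    show _ ≤ H (q.1, q.2)
    refine le_trans ?_ h1
    nlinarith
  have hi := fun r => h.thInt hV.continuous V0 hR r A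
  have e : ∀ r, ∫ ω in A, θ (V (Z r ω)) ∂P =
      ∫ ω in A, R / 3 ∂P - ∫ ω in A, thR R (V (Z r ω)) ∂P := fun r =>
    integral_sub (integrable_const _) (hi r)
  rw [e, e] at d2
  linarith

end Abs


lemma fatou_real {Ω : Type*} [MeasurableSpace Ω] {μ : Measure Ω} {f : ℕ → Ω → ℝ} {g : Ω → ℝ}
    {c : ℝ} (hf0 : ∀ k ω, 0 ≤ f k ω) (hfi : ∀ k, Integrable (f k) μ) (hc : ∀ k, ∫ ω, f k ω ∂μ ≤ c)
    (hg : AEStronglyMeasurable g μ) (hlim : ∀ ω, Tendsto (fun k => f k ω) atTop (𝓝 (g ω))) :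
    Integrable g μ ∧ ∫ ω, g ω ∂μ ≤ c := by
  have hg0 : ∀ ω, 0 ≤ g ω := fun ω => ge_of_tendsto' (hlim ω) fun k => hf0 k ω
  have hc0 : 0 ≤ c := (integral_nonneg (hf0 0)).trans (hc 0)
  have h1 : ∫⁻ ω, ENNReal.ofReal (g ω) ∂μ ≤ ENNReal.ofReal c := by
    calc ∫⁻ ω, ENNReal.ofReal (g ω) ∂μ
        = ∫⁻ ω, liminf (fun k => ENNReal.ofReal (f k ω)) atTop ∂μ := by
          refine lintegral_congr fun ω => ?_
          exact ((ENNReal.continuous_ofReal.tendsto _).comp (hlim ω)).liminf_eq.symm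
      _ ≤ liminf (fun k => ∫⁻ ω, ENNReal.ofReal (f k ω) ∂μ) atTop :=
          lintegral_liminf_le' fun k => (hfi k).aestronglyMeasurable.aemeasurable.ennreal_ofReal
      _ ≤ ENNReal.ofReal c := by
          refine liminf_le_of_le (by isBoundedDefault) fun b hb => ?_
          obtain ⟨k, hk⟩ := hb.exists
          refine hk.trans ?_
          rw [← ofReal_integral_eq_lintegral_ofReal (hfi k) (Eventually.of_forall (hf0 k))]
          exact ENNReal.ofReal_le_ofReal (hc k)
  have hi : Integrable g μ := by
    refine ⟨hg, ?_⟩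
    rw [hasFiniteIntegral_iff_ofReal (Eventually.of_forall hg0)]
    exact h1.trans_lt ENNReal.ofReal_lt_top
  refine ⟨hi, ?_⟩
  rw [← ofReal_integral_eq_lintegral_ofReal hi (Eventually.of_forall hg0)] at h1
  exact (ENNReal.ofReal_le_ofReal_iff hc0).1 h1

section Abs
variable {E ι : Type*} [NormedAddCommGroup E] [NormedSpace ℝ E] [FiniteDimensional ℝ E]
  [MeasurableSpace E] [BorelSpace E] [SecondCountableTopology E]
  [Fintype ι] {Ω : Type} [mΩ : MeasurableSpace Ω] {P : Measure Ω} [IsProbabilityMeasure P]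
  {ℱ : Filtration ℝ mΩ}
  {Z : ℝ → Ω → E} {B : ℝ → E → E} {S : ι → ℝ → E → E} {β : ℝ → ℝ} {Λ : ℝ}

lemma MP.lemA (h : MP P ℱ Z B S β Λ) {V : E → ℝ} (hV : ContDiff ℝ 2 V) (V0 : ∀ z, 0 ≤ V z)
    {δ : ℝ} (hδ : 0 < δ) (hp : ∀ z, δ * ‖z‖ ≤ V z)
    {s t : ℝ} (hs : 0 ≤ s) (hst : s ≤ t) (hβ : IntegrableOn β (Set.Ioc 0 t))
    {A : Set Ω} (hA : MeasurableSet[ℱ s] A) {N : ℝ} {κ2 : ℝ → ℝ} (hN : 0 < N)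
    (hκm : Measurable κ2)
    (hκ0 : ∀ s, 0 ≤ κ2 s) (hκ : IntegrableOn κ2 (Set.Ioc s t))
    (hκ4 : ∫ r in Set.Ioc s t, κ2 r ≤ 1 / 4) {F : ℝ × Ω → ℝ} (F0 : ∀ q, 0 ≤ F q)
    (Fi : Integrable F ((volume.restrict (Set.Ioc s t)).prod (P.restrict A)))
    (hL : ∀ r ∈ Set.Ioc s t, ∀ ω, Lop B S V r (Z r ω) ≤ (N + κ2 r) * V (Z r ω) + F (r, ω))
    (hVs : Integrable (fun ω => V (Z s ω)) (P.restrict A)) :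
    Integrable (fun ω => V (Z t ω)) (P.restrict A) ∧
    ∫ ω in A, V (Z t ω) ∂P ≤ 2 * (∫ ω in A, V (Z s ω) ∂P +
      ∫ q, F q ∂((volume.restrict (Set.Ioc s t)).prod (P.restrict A))) *
        Real.exp (4 * N * (t - s)) := by
  have hi := fun R (hR : 0 < R) r => h.thInt hV.continuous V0 hR r A
  set IF := ∫ q, F q ∂((volume.restrict (Set.Ioc s t)).prod (P.restrict A)) with hIF
  have hVs0 : 0 ≤ ∫ ω in A, V (Z s ω) ∂P := integral_nonneg fun _ => V0 _
  have key : ∀ R : ℝ, 0 < R → ∫ ω in A, thR R (V (Z t ω)) ∂P ≤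
      2 * (∫ ω in A, V (Z s ω) ∂P + IF) * Real.exp (4 * N * (t - s)) := by
    intro R hR
    have IF0 : 0 ≤ IF := integral_nonneg F0
    refine gron (a := s) (b := t) (v := fun u => ∫ ω in A, thR R (V (Z u ω)) ∂P) (Mb := R)
      hN (by positivity)
      (fun u _ => integral_nonneg fun _ => (thR_bounds hR (V0 _)).1) (fun u _ => ?_) hκ0 hκ hκ4
      (fun u hu => ?_) t ⟨hst, le_rfl⟩
    · calc ∫ ω in A, thR R (V (Z u ω)) ∂P ≤ ∫ ω in A, R ∂P :=
            integral_mono (hi R hR u) (integrable_const _) fun _ => (thR_bounds hR (V0 _)).2.2.1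
        _ ≤ R := by
            rw [integral_const, smul_eq_mul]
            have : (P.restrict A).real Set.univ ≤ 1 := by
              simp only [measureReal_restrict_apply_univ]; exact measureReal_le_one
            nlinarith
    · have hsub : Set.Ioc s u ⊆ Set.Ioc s t := Set.Ioc_subset_Ioc_right hu.2
      have hmle : (volume.restrict (Set.Ioc s u)).prod (P.restrict A) ≤
          (volume.restrict (Set.Ioc s t)).prod (P.restrict A) :=
        Measure.prod_mono (Measure.restrict_mono hsub le_rfl) le_rfl
      have Fiu := Fi.mono_measure hmle
      have hm1 : Measurable (fun q : ℝ × Ω => (N + κ2 q.1) * thR R (V (Z q.1 q.2))) :=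
        (measurable_const.add (hκm.comp measurable_fst)).mul
          ((((thR_continuous R).comp hV.continuous).measurable).comp h.measJ)
      have Gi : Integrable (fun q : ℝ × Ω => (N + κ2 q.1) * thR R (V (Z q.1 q.2)))
          ((volume.restrict (Set.Ioc s u)).prod (P.restrict A)) := by
        have hb : Integrable (fun r => (N + κ2 r) * R) (volume.restrict (Set.Ioc s u)) :=
          ((integrable_const N).add (hκ.mono_set hsub)).mul_const R
        refine (hb.comp_fst (P.restrict A)).mono' hm1.aestronglyMeasurable
          (Eventually.of_forall fun q => ?_)
        have b := thR_bounds hR (V0 (Z q.1 q.2))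
        have k0 := hκ0 q.1
        rw [Real.norm_eq_abs, abs_of_nonneg (mul_nonneg (by positivity) b.1)]
        exact mul_le_mul_of_nonneg_left b.2.2.1 (by positivity)
      have T := h.trunc hV V0 hδ hp hR hs hu.1 (hβ.mono_set (Set.Ioc_subset_Ioc_right hu.2)) hA
        (H := fun q => (N + κ2 q.1) * thR R (V (Z q.1 q.2)) + F q) (fun r hr ω => ?_)
        (Gi.add Fiu)
      · rw [integral_add Gi Fiu, integral_prod _ Gi] at T
        simp only [integral_const_mul] at T
        have e1 : ∫ q, F q ∂((volume.restrict (Set.Ioc s u)).prod (P.restrict A)) ≤ IF :=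
          integral_mono_measure hmle (Eventually.of_forall F0) Fi
        have e2 : ∫ ω in A, thR R (V (Z s ω)) ∂P ≤ ∫ ω in A, V (Z s ω) ∂P :=
          integral_mono (hi R hR s) hVs fun _ => (thR_bounds hR (V0 _)).2.1
        linarith
      · have b := thR_bounds hR (V0 (Z r ω))
        have b1 := thR'_le_one hR (V0 (Z r ω))
        have b0 := thR'_nonneg R (V (Z r ω))
        have k0 := hκ0 r
        have f0 := F0 (r, ω)
        have l := hL r (hsub hr) ω
        calc thR' R (V (Z r ω)) * Lop B S V r (Z r ω)
            ≤ thR' R (V (Z r ω)) * ((N + κ2 r) * V (Z r ω) + F (r, ω)) :=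
              mul_le_mul_of_nonneg_left l b0
          _ = (N + κ2 r) * (thR' R (V (Z r ω)) * V (Z r ω)) + thR' R (V (Z r ω)) * F (r, ω) := by
              ring
          _ ≤ (N + κ2 r) * thR R (V (Z r ω)) + F (r, ω) := by
              refine add_le_add (mul_le_mul_of_nonneg_left b.2.2.2 (by positivity)) ?_
              exact mul_le_of_le_one_left f0 b1
  exact fatou_real (f := fun k ω => thR ((k : ℝ) + 1) (V (Z t ω)))
    (fun k ω => (thR_bounds (by positivity) (V0 _)).1) (fun k => hi _ (by positivity) t)
    (fun k => key _ (by positivity))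
    (hV.continuous.measurable.comp (h.measZ' t)).aestronglyMeasurable
    (fun ω => thR_tendsto _)

lemma MP.lemB (h : MP P ℱ Z B S β Λ) {V : E → ℝ} (hV : ContDiff ℝ 2 V) (V0 : ∀ z, 0 ≤ V z)
    {δ : ℝ} (hδ : 0 < δ) (hp : ∀ z, δ * ‖z‖ ≤ V z)
    {s t : ℝ} (hs : 0 ≤ s) (hst : s ≤ t) (hβ : IntegrableOn β (Set.Ioc 0 t))
    {G : ℝ × Ω → ℝ}
    (Gi : Integrable G ((volume.restrict (Set.Ioc s t)).prod P))
    (hL : ∀ r ∈ Set.Ioc s t, ∀ ω, Lop B S V r (Z r ω) ≤ G (r, ω))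
    (hVs : Integrable (fun ω => V (Z s ω)) P) (hVt : Integrable (fun ω => V (Z t ω)) P) :
    ∫ ω, V (Z t ω) ∂P ≤ ∫ ω, V (Z s ω) ∂P +
      ∫ q, G q ∂((volume.restrict (Set.Ioc s t)).prod P) := by
  have hm : Measurable (fun q : ℝ × Ω => V (Z q.1 q.2)) := hV.continuous.measurable.comp h.measJ
  have lim : ∀ r, Integrable (fun ω => V (Z r ω)) P →
      Tendsto (fun k : ℕ => ∫ ω, thR ((k : ℝ) + 1) (V (Z r ω)) ∂P) atTop
        (𝓝 (∫ ω, V (Z r ω) ∂P)) := by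
    intro r hr
    refine tendsto_integral_of_dominated_convergence (fun ω => V (Z r ω)) (fun k => ?_) hr
      (fun k => Eventually.of_forall fun ω => ?_) (Eventually.of_forall fun ω => thR_tendsto _)
    · exact (((thR_continuous _).comp hV.continuous).measurable.comp
        (h.measZ' r)).aestronglyMeasurable
    · have b := thR_bounds (show (0 : ℝ) < (k : ℝ) + 1 by positivity) (V0 (Z r ω))
      rw [Real.norm_eq_abs, abs_of_nonneg b.1]; exact b.2.1
  have bd : ∀ (k : ℕ) (q : ℝ × Ω), ‖thR' ((k : ℝ) + 1) (V (Z q.1 q.2)) * G q‖ ≤ ‖G q‖ := by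
    intro k q
    rw [norm_mul]
    have b1 := thR'_le_one (show (0 : ℝ) < (k : ℝ) + 1 by positivity) (V0 (Z q.1 q.2))
    have b0 := thR'_nonneg ((k : ℝ) + 1) (V (Z q.1 q.2))
    rw [Real.norm_eq_abs (thR' _ _), abs_of_nonneg b0]
    exact mul_le_of_le_one_left (norm_nonneg _) b1
  have ms : ∀ k : ℕ, AEStronglyMeasurable (fun q : ℝ × Ω =>
      thR' ((k : ℝ) + 1) (V (Z q.1 q.2)) * G q) ((volume.restrict (Set.Ioc s t)).prod P) :=
    fun k => (((thR'_continuous _).measurable.comp hm).aestronglyMeasurable).mul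
      Gi.aestronglyMeasurable
  have lim2 : Tendsto (fun k : ℕ => ∫ q, thR' ((k : ℝ) + 1) (V (Z q.1 q.2)) * G q
      ∂((volume.restrict (Set.Ioc s t)).prod P)) atTop
      (𝓝 (∫ q, G q ∂((volume.restrict (Set.Ioc s t)).prod P))) := by
    refine tendsto_integral_of_dominated_convergence (fun q => ‖G q‖) ms Gi.norm
      (fun k => Eventually.of_forall (bd k)) (Eventually.of_forall fun q => ?_)
    simpa using (thR'_tendsto (V (Z q.1 q.2))).mul_const (G q)
  refine le_of_tendsto_of_tendsto' (lim t hVt) ((lim s hVs).add lim2) fun k => ?_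
  have T := h.trunc hV V0 hδ hp (show (0 : ℝ) < (k : ℝ) + 1 by positivity) hs hst hβ
    (A := Set.univ) MeasurableSet.univ
    (H := fun q => thR' ((k : ℝ) + 1) (V (Z q.1 q.2)) * G q)
    (fun r hr ω => mul_le_mul_of_nonneg_left (hL r hr ω) (thR'_nonneg _ _))
    (by rw [Measure.restrict_univ]; exact Gi.norm.mono' (ms k) (Eventually.of_forall (bd k)))
  simpa only [Measure.restrict_univ] using T

/-- A proper function controlling the process on `[0, T1]`. -/
structure UC (P : Measure Ω) (Z : ℝ → Ω → E) (B : ℝ → E → E) (S : ι → ℝ → E → E) (β : ℝ → ℝ)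
    (U : E → ℝ) (CU T1 : ℝ) : Prop where
  smooth : ContDiff ℝ 2 U
  le : ∀ z, ‖z‖ ≤ U z
  CU0 : 0 ≤ CU
  gen : ∀ s z, Lop B S U s z ≤ CU * U z + β s
  int : ∀ r ∈ Set.Icc 0 T1, Integrable (fun ω => U (Z r ω)) P
  intp : Integrable (fun q : ℝ × Ω => U (Z q.1 q.2)) ((volume.restrict (Set.Ioc 0 T1)).prod P)
  intβ : IntegrableOn β (Set.Ioc 0 T1)

lemma prod_le_prod {s t T1 : ℝ} (hs : 0 ≤ s) (htT : t ≤ T1) (A : Set Ω) :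
    (volume.restrict (Set.Ioc s t)).prod (P.restrict A) ≤
      (volume.restrict (Set.Ioc 0 T1)).prod P :=
  Measure.prod_mono (Measure.restrict_mono (Set.Ioc_subset_Ioc hs htT) le_rfl)
    Measure.restrict_le_self

lemma MP.lemA' (h : MP P ℱ Z B S β Λ) {U : E → ℝ} {CU T1 : ℝ} (hU : UC P Z B S β U CU T1)
    {V : E → ℝ} (hV : ContDiff ℝ 2 V) (V0 : ∀ z, 0 ≤ V z)
    {s t : ℝ} (hs : 0 ≤ s) (hst : s ≤ t) (htT : t ≤ T1)
    {A : Set Ω} (hA : MeasurableSet[ℱ s] A) {N : ℝ} {κ2 : ℝ → ℝ} (hN : 0 < N)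
    (hκm : Measurable κ2)
    (hκ0 : ∀ s, 0 ≤ κ2 s) (hκ : IntegrableOn κ2 (Set.Ioc s t))
    (hκ4 : ∫ r in Set.Ioc s t, κ2 r ≤ 1 / 4) {F : ℝ × Ω → ℝ} (F0 : ∀ q, 0 ≤ F q)
    (Fi : Integrable F ((volume.restrict (Set.Ioc s t)).prod (P.restrict A)))
    (hL : ∀ r ∈ Set.Ioc s t, ∀ ω, Lop B S V r (Z r ω) ≤ (N + κ2 r) * V (Z r ω) + F (r, ω))
    (hVs : Integrable (fun ω => V (Z s ω)) (P.restrict A)) :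
    Integrable (fun ω => V (Z t ω)) (P.restrict A) ∧
    ∫ ω in A, V (Z t ω) ∂P ≤ 2 * (∫ ω in A, V (Z s ω) ∂P +
      ∫ q, F q ∂((volume.restrict (Set.Ioc s t)).prod (P.restrict A))) *
        Real.exp (4 * N * (t - s)) := by
  have U0 : ∀ z, 0 ≤ U z := fun z => (norm_nonneg z).trans (hU.le z)
  have Us : Integrable (fun ω => U (Z s ω)) (P.restrict A) :=
    (hU.int s ⟨hs, hst.trans htT⟩).restrict
  have hle := prod_le_prod (P := P) hs htT A
  have Ui := hU.intp.mono_measure hle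
  have βi : Integrable (fun q : ℝ × Ω => β q.1)
      ((volume.restrict (Set.Ioc s t)).prod (P.restrict A)) := by
    have : Integrable β (volume.restrict (Set.Ioc s t)) :=
      hU.intβ.mono_set (Set.Ioc_subset_Ioc hs htT)
    exact this.comp_fst _
  set F1 : ℝ × Ω → ℝ := fun q => CU * U (Z q.1 q.2) + β q.1 with hF1
  have F1i : Integrable F1 ((volume.restrict (Set.Ioc s t)).prod (P.restrict A)) :=
    (Ui.const_mul CU).add βi
  have F10 : ∀ q, 0 ≤ F1 q := fun q =>
    add_nonneg (mul_nonneg hU.CU0 (U0 _)) (h.βnn _)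
  have key : ∀ δ : ℝ, 0 < δ → Integrable (fun ω => V (Z t ω) + δ * U (Z t ω)) (P.restrict A) ∧
      ∫ ω in A, (V (Z t ω) + δ * U (Z t ω)) ∂P ≤ 2 * ((∫ ω in A, V (Z s ω) ∂P +
        δ * ∫ ω in A, U (Z s ω) ∂P) +
      (∫ q, F q ∂((volume.restrict (Set.Ioc s t)).prod (P.restrict A)) +
       δ * ∫ q, F1 q ∂((volume.restrict (Set.Ioc s t)).prod (P.restrict A)))) *
        Real.exp (4 * N * (t - s)) := by
    intro δ hδ
    have := h.lemA (V := fun z => V z + δ * U z) (hV.add (contDiff_const.mul hU.smooth))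
      (fun z => add_nonneg (V0 z) (mul_nonneg hδ.le (U0 z))) hδ
      (fun z => by have := mul_le_mul_of_nonneg_left (hU.le z) hδ.le; have := V0 z; linarith)
      hs hst (hU.intβ.mono_set (Set.Ioc_subset_Ioc_right htT)) hA hN hκm hκ0 hκ hκ4
      (F := fun q => F q + δ * F1 q)
      (fun q => add_nonneg (F0 q) (mul_nonneg hδ.le (F10 q))) (Fi.add (F1i.const_mul δ))
      (fun r hr ω => ?_) (hVs.add (Us.const_mul δ))
    · rw [integral_add hVs (Us.const_mul δ), integral_add Fi (F1i.const_mul δ),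
        integral_const_mul, integral_const_mul] at this
      exact this
    · rw [Lop_add B S hV hU.smooth]
      have l1 := hL r hr ω
      have l2 := mul_le_mul_of_nonneg_left (hU.gen r (Z r ω)) hδ.le
      have l3 : 0 ≤ (N + κ2 r) * (δ * U (Z r ω)) :=
        mul_nonneg (add_nonneg hN.le (hκ0 r)) (mul_nonneg hδ.le (U0 _))
      simp only [hF1]
      nlinarith
  have hVm : AEStronglyMeasurable (fun ω => V (Z t ω)) (P.restrict A) :=
    (hV.continuous.measurable.comp (h.measZ' t)).aestronglyMeasurable
  have hVt : Integrable (fun ω => V (Z t ω)) (P.restrict A) := by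
    refine (key 1 one_pos).1.mono' hVm (Eventually.of_forall fun ω => ?_)
    rw [Real.norm_eq_abs, abs_of_nonneg (V0 _)]
    have := U0 (Z t ω)
    linarith
  refine ⟨hVt, ?_⟩
  have hlim : Tendsto (fun δ : ℝ => 2 * ((∫ ω in A, V (Z s ω) ∂P +
        δ * ∫ ω in A, U (Z s ω) ∂P) +
      (∫ q, F q ∂((volume.restrict (Set.Ioc s t)).prod (P.restrict A)) +
       δ * ∫ q, F1 q ∂((volume.restrict (Set.Ioc s t)).prod (P.restrict A)))) *
        Real.exp (4 * N * (t - s))) (𝓝[>] 0) (𝓝 (2 * ((∫ ω in A, V (Z s ω) ∂P +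
        0 * ∫ ω in A, U (Z s ω) ∂P) +
      (∫ q, F q ∂((volume.restrict (Set.Ioc s t)).prod (P.restrict A)) +
       0 * ∫ q, F1 q ∂((volume.restrict (Set.Ioc s t)).prod (P.restrict A)))) *
        Real.exp (4 * N * (t - s)))) := by
    refine Tendsto.mono_left ?_ nhdsWithin_le_nhds
    refine Continuous.tendsto ?_ 0
    fun_prop
  simp only [zero_mul, add_zero] at hlim
  refine ge_of_tendsto hlim ?_
  filter_upwards [self_mem_nhdsWithin] with δ hδ
  have hδ' : 0 < δ := hδ
  refine le_trans ?_ (key δ hδ').2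
  refine integral_mono hVt (key δ hδ').1 fun ω => ?_
  have := mul_nonneg hδ'.le (U0 (Z t ω))
  simp only; linarith

lemma MP.lemB' (h : MP P ℱ Z B S β Λ) {U : E → ℝ} {CU T1 : ℝ} (hU : UC P Z B S β U CU T1)
    {V : E → ℝ} (hV : ContDiff ℝ 2 V) (V0 : ∀ z, 0 ≤ V z)
    {s t : ℝ} (hs : 0 ≤ s) (hst : s ≤ t) (htT : t ≤ T1)
    {G : ℝ × Ω → ℝ}
    (Gi : Integrable G ((volume.restrict (Set.Ioc s t)).prod P))
    (hL : ∀ r ∈ Set.Ioc s t, ∀ ω, Lop B S V r (Z r ω) ≤ G (r, ω))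
    (hVs : Integrable (fun ω => V (Z s ω)) P) (hVt : Integrable (fun ω => V (Z t ω)) P) :
    ∫ ω, V (Z t ω) ∂P ≤ ∫ ω, V (Z s ω) ∂P +
      ∫ q, G q ∂((volume.restrict (Set.Ioc s t)).prod P) := by
  have U0 : ∀ z, 0 ≤ U z := fun z => (norm_nonneg z).trans (hU.le z)
  have Us := hU.int s ⟨hs, hst.trans htT⟩
  have Ut := hU.int t ⟨hs.trans hst, htT⟩
  have hle := prod_le_prod (P := P) hs htT Set.univ
  rw [Measure.restrict_univ] at hle
  have Ui := hU.intp.mono_measure hle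
  have βi : Integrable (fun q : ℝ × Ω => β q.1)
      ((volume.restrict (Set.Ioc s t)).prod P) := by
    have : Integrable β (volume.restrict (Set.Ioc s t)) :=
      hU.intβ.mono_set (Set.Ioc_subset_Ioc hs htT)
    exact this.comp_fst _
  set F1 : ℝ × Ω → ℝ := fun q => CU * U (Z q.1 q.2) + β q.1 with hF1
  have F1i : Integrable F1 ((volume.restrict (Set.Ioc s t)).prod P) :=
    (Ui.const_mul CU).add βi
  have key : ∀ δ : ℝ, 0 < δ → ∫ ω, V (Z t ω) ∂P + δ * ∫ ω, U (Z t ω) ∂P ≤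
      (∫ ω, V (Z s ω) ∂P + δ * ∫ ω, U (Z s ω) ∂P) +
      (∫ q, G q ∂((volume.restrict (Set.Ioc s t)).prod P) +
       δ * ∫ q, F1 q ∂((volume.restrict (Set.Ioc s t)).prod P)) := by
    intro δ hδ
    have := h.lemB (V := fun z => V z + δ * U z) (hV.add (contDiff_const.mul hU.smooth))
      (fun z => add_nonneg (V0 z) (mul_nonneg hδ.le (U0 z))) hδ
      (fun z => by have := mul_le_mul_of_nonneg_left (hU.le z) hδ.le; have := V0 z; linarith)
      hs hst (hU.intβ.mono_set (Set.Ioc_subset_Ioc_right htT))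
      (G := fun q => G q + δ * F1 q) (Gi.add (F1i.const_mul δ))
      (fun r hr ω => ?_) (hVs.add (Us.const_mul δ)) (hVt.add (Ut.const_mul δ))
    · rw [integral_add hVs (Us.const_mul δ), integral_add hVt (Ut.const_mul δ),
        integral_add Gi (F1i.const_mul δ),
        integral_const_mul, integral_const_mul, integral_const_mul] at this
      exact this
    · rw [Lop_add B S hV hU.smooth]
      exact add_le_add (hL r hr ω) (mul_le_mul_of_nonneg_left (hU.gen r (Z r ω)) hδ.le)
  have hlim : ∀ a b : ℝ, Tendsto (fun δ : ℝ => a + δ * b) (𝓝[>] 0) (𝓝 a) := by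
    intro a b
    refine Tendsto.mono_left ?_ nhdsWithin_le_nhds
    have : Continuous fun δ : ℝ => a + δ * b := by fun_prop
    simpa using this.tendsto 0
  refine le_of_tendsto_of_tendsto (hlim _ (∫ ω, U (Z t ω) ∂P))
    ((hlim _ (∫ ω, U (Z s ω) ∂P)).add
      (hlim _ (∫ q, F1 q ∂((volume.restrict (Set.Ioc s t)).prod P)))) ?_
  filter_upwards [self_mem_nhdsWithin] with δ hδ
  exact key δ hδ

end Abs


lemma last_time {u : ℝ → ℝ} {T' Mb lam c D : ℝ} (hlam : 0 < lam) (hc : 0 < c) (hD : 0 ≤ D)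
    (u0 : ∀ t ∈ Set.Icc 0 T', 0 ≤ u t) (uM : ∀ t ∈ Set.Icc 0 T', u t ≤ Mb)
    (ui : IntegrableOn u (Set.Ioc 0 T'))
    (h : ∀ s t, 0 ≤ s → s ≤ t → t ≤ T' →
      u t ≤ u s + ∫ r in Set.Ioc s t, ((-lam + c) * u r + D)) :
    ∀ t ∈ Set.Icc 0 T', u t ≤ 2 * (u 0 + D / lam) * Real.exp (4 * c * t) := by
  intro t ht
  set M0 := u 0 + D / lam with hM0
  have u00 := u0 0 ⟨le_rfl, ht.1.trans ht.2⟩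
  have hDl : 0 ≤ D / lam := by positivity
  have hM00 : 0 ≤ M0 := by positivity
  set G : Set ℝ := {s | 0 ≤ s ∧ s ≤ t ∧ u s ≤ M0} with hG
  have G0 : (0 : ℝ) ∈ G := ⟨le_rfl, ht.1, by linarith⟩
  have Gb : BddAbove G := ⟨t, fun s hs => hs.2.1⟩
  set a := sSup G with ha
  have a0 : 0 ≤ a := le_csSup Gb G0
  have at' : a ≤ t := csSup_le ⟨0, G0⟩ fun s hs => hs.2.1
  have MbN : 0 ≤ Mb := u00.trans (uM 0 ⟨le_rfl, ht.1.trans ht.2⟩)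
  have step : ∀ r ∈ Set.Icc a t, u r ≤ M0 + ∫ q in Set.Ioc a r, (c + (fun _ => (0 : ℝ)) q) * u q := by
    intro r hr
    refine le_of_forall_pos_le_add fun η hη => ?_
    have hK : 0 < c * Mb + D + 1 := by positivity
    obtain ⟨s, hsG, hs⟩ := exists_lt_of_lt_csSup ⟨0, G0⟩
      (show a - η / (c * Mb + D + 1) < a by linarith [div_pos hη hK])
    have hsa : s ≤ a := le_csSup Gb hsG
    have H := h s r hsG.1 (hsa.trans hr.1) (hr.2.trans ht.2)
    have i0 : ∀ x y, 0 ≤ x → y ≤ T' → IntegrableOn u (Set.Ioc x y) := fun x y hx hy =>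
      ui.mono_set (Set.Ioc_subset_Ioc hx hy)
    have i1 : ∀ x y, 0 ≤ x → y ≤ T' →
        IntegrableOn (fun r => (-lam + c) * u r + D) (Set.Ioc x y) := fun x y hx hy =>
      ((i0 x y hx hy).const_mul _).add (integrable_const D)
    have haT : a ≤ T' := at'.trans ht.2
    have hrT : r ≤ T' := hr.2.trans ht.2
    rw [← Set.Ioc_union_Ioc_eq_Ioc hsa hr.1, setIntegral_union
      (Set.Ioc_disjoint_Ioc_of_le le_rfl) measurableSet_Ioc (i1 _ _ hsG.1 haT)
      (i1 _ _ a0 hrT)] at H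
    have J1 : ∫ r in Set.Ioc s a, ((-lam + c) * u r + D) ≤ ∫ r in Set.Ioc s a, (c * Mb + D) := by
      refine setIntegral_mono_on (i1 _ _ hsG.1 haT) (integrable_const _) measurableSet_Ioc
        fun q hq => ?_
      have q0 := u0 q ⟨hsG.1.trans hq.1.le, hq.2.trans haT⟩
      have q1 := uM q ⟨hsG.1.trans hq.1.le, hq.2.trans haT⟩
      nlinarith
    have J1' : ∫ r in Set.Ioc s a, (c * Mb + D) ≤ η := by
      rw [setIntegral_const, smul_eq_mul, Measure.real, Real.volume_Ioc,
        ENNReal.toReal_ofReal (by linarith)]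
      have : a - s ≤ η / (c * Mb + D + 1) := by linarith
      rw [le_div_iff₀ hK] at this
      nlinarith
    have J2 : ∫ r in Set.Ioc a r, ((-lam + c) * u r + D) ≤
        ∫ q in Set.Ioc a r, (c + (fun _ => (0 : ℝ)) q) * u q := by
      refine setIntegral_mono_on (i1 _ _ a0 hrT) ?_ measurableSet_Ioc fun q hq => ?_
      · simp only [add_zero]; exact (i0 _ _ a0 hrT).const_mul c
      · have : M0 < u q := by
          by_contra hcon
          push Not at hcon
          have : q ∈ G := ⟨a0.trans hq.1.le, hq.2.trans hr.2, hcon⟩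
          exact absurd (le_csSup Gb this) (not_le.2 hq.1)
        have h2 : D / lam ≤ u q := by linarith
        rw [div_le_iff₀ hlam] at h2
        simp only [add_zero]
        nlinarith
    have := hsG.2.2
    linarith
  have := gron (a := a) (b := t) (κ2 := fun _ => 0) (Mb := Mb) hc hM00
    (fun r hr => u0 r ⟨a0.trans hr.1, hr.2.trans ht.2⟩)
    (fun r hr => uM r ⟨a0.trans hr.1, hr.2.trans ht.2⟩) (fun _ => le_rfl)
    (integrable_zero _ _ _) (by simp) step t ⟨at', le_rfl⟩
  refine this.trans ?_
  gcongr
  linarith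

lemma integrableOn_of_bdd {u : ℝ → ℝ} (hu : Measurable u) {a b Mb : ℝ}
    (hb : ∀ t ∈ Set.Ioc a b, |u t| ≤ Mb) : IntegrableOn u (Set.Ioc a b) := by
  refine Measure.integrableOn_of_bounded (M := Mb) (by simp) hu.aestronglyMeasurable ?_
  filter_upwards [ae_restrict_mem measurableSet_Ioc] with t ht
  exact hb t ht

section Path
variable {E ι : Type*} [NormedAddCommGroup E] [NormedSpace ℝ E] [FiniteDimensional ℝ E] [HasContDiffBump E]
  [MeasurableSpace E] [BorelSpace E] [SecondCountableTopology E]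
  [Fintype ι] {Ω : Type} [mΩ : MeasurableSpace Ω] {P : Measure Ω} [IsProbabilityMeasure P]
  {ℱ : Filtration ℝ mΩ}
  {Z : ℝ → Ω → E} {B : ℝ → E → E} {S : ι → ℝ → E → E} {β : ℝ → ℝ} {Λ : ℝ}

/-- Non-integrable drift in direction `w`: the linear functional `l` is frozen after `t0`. -/
lemma MP.path (h : MP P ℱ Z B S β Λ) (l : E →L[ℝ] ℝ) {bl : ℝ → ℝ}
    (hB : ∃ c : ℝ, ∀ s z, |l (B s z) - bl s| ≤ c * (1 + ‖z‖))
    {t0 : ℝ} (ht0 : 0 ≤ t0) (hbl : Measurable bl)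
    (hbad : ∀ t, t0 < t → ¬ IntegrableOn bl (Set.Ioc t0 t))
    (hi0 : Integrable (fun ω => (l (Z t0 ω)) ^ 2) P) {t : ℝ} (ht : t0 < t) :
    Integrable (fun ω => (l (Z t ω)) ^ 2) P ∧
      ∫ ω, (l (Z t ω)) ^ 2 ∂P ≤ ∫ ω, (l (Z t0 ω)) ^ 2 ∂P := by
  obtain ⟨cB, hcB⟩ := hB
  have cB0 : 0 ≤ cB := by
    have := (abs_nonneg _).trans (hcB 0 0)
    simpa using this
  have hΛ := h.Λnn
  -- the main identity
  have main : ∀ R : ℝ, 0 < R → ∃ χ : E → ℝ, (∀ z, 0 ≤ χ z ∧ χ z ≤ 1) ∧ Continuous χ ∧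
      HasCompactSupport χ ∧ (∀ z, ‖z‖ ≤ R → χ z = 1) ∧
      ∫ ω in {ω | ‖Z t0 ω‖ < R}, (l (Z t ω)) ^ 2 * χ (Z t ω) ∂P =
        ∫ ω in {ω | ‖Z t0 ω‖ < R}, (l (Z t0 ω)) ^ 2 * χ (Z t0 ω) ∂P := by
    intro R hR
    let f : ContDiffBump (0 : E) := ⟨R, R + 1, hR, by linarith⟩
    set A : Set Ω := {ω | ‖Z t0 ω‖ < R} with hA
    have hAm : MeasurableSet[ℱ t0] A := by
      have := h.measZ t0
      have h2 : MeasurableSet {z : E | ‖z‖ < R} := (isOpen_lt continuous_norm continuous_const).measurableSet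
      exact this h2
    have fc : HasCompactSupport (f : E → ℝ) := f.hasCompactSupport
    have key : ∀ c : ℝ, ‖l‖ * R + 1 ≤ c →
        ∫ ω in A, ((l (Z t ω)) ^ 2 + 2 * c * l (Z t ω)) * f (Z t ω) ∂P =
        ∫ ω in A, ((l (Z t0 ω)) ^ 2 + 2 * c * l (Z t0 ω)) * f (Z t0 ω) ∂P := by
      intro c hc
      set φ : E → ℝ := fun z => ((l z) ^ 2 + 2 * c * l z) * f z with hφd
      have hφ : ContDiff ℝ 2 φ := by
        refine ContDiff.mul ?_ f.contDiff
        fun_prop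
      have hφc : HasCompactSupport φ := fc.mul_left
      -- formula for the generator inside the ball
      have hφin : ∀ z, ‖z‖ < R → fderiv ℝ φ z = (2 * (l z + c)) • l := by
        intro z hz
        have e : φ =ᶠ[𝓝 z] fun z => (l z) ^ 2 + 2 * c * l z := by
          have : Metric.ball (0 : E) R ∈ 𝓝 z := Metric.isOpen_ball.mem_nhds (by simpa using hz)
          filter_upwards [this] with y hy
          have : f y = 1 := f.one_of_mem_closedBall (Metric.ball_subset_closedBall hy)
          simp [hφd, this]
        rw [e.fderiv_eq]
        have hl : HasFDerivAt (fun z => l z) l z := l.hasFDerivAt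
        have := (hl.pow 2).add (hl.const_mul (2 * c))
        refine this.fderiv.trans ?_
        ext w
        simp
        ring
      have c2 : Continuous (fderiv ℝ (fderiv ℝ φ)) :=
        (hφ.fderiv_right (m := 1) (by norm_num)).continuous_fderiv (by norm_num)
      obtain ⟨M2, M2nn, hM2⟩ := cs_bound c2 ((hφc.fderiv ℝ).fderiv ℝ) 2
      have hmeas : Measurable (fun q : ℝ × Ω => Lop B S φ q.1 (Z q.1 q.2)) :=
        h.measG (G := fun q => Lop B S φ q.1 q.2) (Lop_meas h.measB h.measS hφ)
      -- zero Bochner integrals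
      have zero : ∀ ω ∈ A, ∀ u, t0 < u →
          ∫ r in Set.Ioc (0 : ℝ) u, Lop B S φ r (Z r ω) = 0 := by
        intro ω hω u hu
        apply integral_undef
        intro hIntg
        have hlt : ∀ᶠ r in 𝓝 t0, ‖Z r ω‖ < R :=
          ((h.cont ω).norm.tendsto t0).eventually (gt_mem_nhds hω)
        obtain ⟨η, hη, hη2⟩ := Metric.eventually_nhds_iff.1 hlt
        set u' := min u (t0 + η / 2) with hu'
        have hu1 : t0 < u' := lt_min hu (by linarith)
        have hin : ∀ r ∈ Set.Ioc t0 u', ‖Z r ω‖ < R := by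
          intro r hr
          apply hη2
          have : r ≤ t0 + η / 2 := hr.2.trans (min_le_right _ _)
          rw [Real.dist_eq, abs_of_pos (by linarith [hr.1])]
          linarith
        have hIntg' : IntegrableOn (fun r => Lop B S φ r (Z r ω)) (Set.Ioc t0 u') :=
          IntegrableOn.mono_set hIntg (Set.Ioc_subset_Ioc ht0 (min_le_left _ _))
        apply hbad u' hu1
        set Cb : ℝ := 2 * (‖l‖ * R + |c|) * (cB * (1 + R)) +
          (1 / 2) * (Fintype.card ι * (M2 * Λ ^ 2)) with hCb
        refine Integrable.mono' (hIntg'.norm.add (integrable_const Cb)) hbl.aestronglyMeasurable ?_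
        filter_upwards [ae_restrict_mem measurableSet_Ioc] with r hr
        have hz := hin r hr
        rw [Real.norm_eq_abs, Pi.add_apply]
        show |bl r| ≤ ‖Lop B S φ r (Z r ω)‖ + Cb
        rw [Real.norm_eq_abs]
        have e1 : Lop B S φ r (Z r ω) = 2 * (l (Z r ω) + c) * l (B r (Z r ω)) +
            (1 / 2) * ∑ k, fderiv ℝ (fderiv ℝ φ) (Z r ω) (S k r (Z r ω)) (S k r (Z r ω)) := by
          unfold Lop
          rw [hφin _ hz]
          simp
        have lz : |l (Z r ω)| ≤ ‖l‖ * R := by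
          have := l.le_opNorm (Z r ω)
          rw [Real.norm_eq_abs] at this
          exact this.trans (by gcongr)
        have b3 : |∑ k, fderiv ℝ (fderiv ℝ φ) (Z r ω) (S k r (Z r ω)) (S k r (Z r ω))| ≤
            Fintype.card ι * (M2 * Λ ^ 2) := by
          have l2 : ∀ k, |fderiv ℝ (fderiv ℝ φ) (Z r ω) (S k r (Z r ω)) (S k r (Z r ω))| ≤
              ‖fderiv ℝ (fderiv ℝ φ) (Z r ω)‖ * ‖S k r (Z r ω)‖ * ‖S k r (Z r ω)‖ := fun k => by
            rw [← Real.norm_eq_abs]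
            exact (fderiv ℝ (fderiv ℝ φ) (Z r ω)).le_opNorm₂ _ _
          have e2 := hM2 (Z r ω)
          have N2 : 0 ≤ ‖fderiv ℝ (fderiv ℝ φ) (Z r ω)‖ := norm_nonneg _
          have N3 : 0 ≤ ‖Z r ω‖ := norm_nonneg _
          have a2 : ∀ k, |fderiv ℝ (fderiv ℝ φ) (Z r ω) (S k r (Z r ω)) (S k r (Z r ω))| ≤
              M2 * Λ ^ 2 := fun k => by
            refine (l2 k).trans ?_
            have b2k := h.boundS k r (Z r ω)
            have N4k : 0 ≤ ‖S k r (Z r ω)‖ := norm_nonneg _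
            generalize ‖S k r (Z r ω)‖ = sk at *
            generalize ‖fderiv ℝ (fderiv ℝ φ) (Z r ω)‖ = D2 at *
            generalize ‖Z r ω‖ = nz at *
            calc D2 * sk * sk
                ≤ D2 * (Λ * (1 + nz)) * (Λ * (1 + nz)) := by gcongr
              _ = ((1 + nz) ^ 2 * D2) * Λ ^ 2 := by ring
              _ ≤ _ := by gcongr
          refine (Finset.abs_sum_le_sum_abs _ _).trans ?_
          refine (Finset.sum_le_sum fun k _ => a2 k).trans ?_
          simp
        generalize (∑ k, fderiv ℝ (fderiv ℝ φ) (Z r ω) (S k r (Z r ω)) (S k r (Z r ω))) = Q at *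
        have b4 := hcB r (Z r ω)
        have b5 : |l (B r (Z r ω)) - bl r| ≤ cB * (1 + R) := b4.trans (by gcongr)
        have b6 : 1 ≤ 2 * (l (Z r ω) + c) := by
          have := (abs_le.1 lz).1; linarith
        have b7 : |2 * (l (Z r ω) + c)| ≤ 2 * (‖l‖ * R + |c|) := by
          rw [abs_mul, abs_two]
          have := abs_add_le (l (Z r ω)) c
          linarith
        set g2 := 2 * (l (Z r ω) + c) with hg2
        set lb := l (B r (Z r ω)) with hlb
        have b8 : g2 * bl r = Lop B S φ r (Z r ω) - g2 * (lb - bl r) - (1 / 2) * Q := by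
          rw [e1]; ring
        have b9 : |g2 * bl r| ≤ |Lop B S φ r (Z r ω)| + Cb := by
          rw [b8]
          have x1 := abs_sub (Lop B S φ r (Z r ω) - g2 * (lb - bl r)) ((1 / 2) * Q)
          have x2 := abs_sub (Lop B S φ r (Z r ω)) (g2 * (lb - bl r))
          have x3 : |g2 * (lb - bl r)| ≤ 2 * (‖l‖ * R + |c|) * (cB * (1 + R)) := by
            rw [abs_mul]
            exact mul_le_mul b7 b5 (abs_nonneg _) (by positivity)
          have x4 : |(1 / 2) * Q| ≤ (1 / 2) * (Fintype.card ι * (M2 * Λ ^ 2)) := by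
            rw [abs_mul, abs_of_pos (show (0:ℝ) < 1 / 2 by norm_num)]
            gcongr
          rw [hCb]
          linarith
        refine le_trans ?_ b9
        rw [abs_mul]
        exact le_mul_of_one_le_left (abs_nonneg _) (b6.trans (le_abs_self _))
      -- constant expectations after t0
      have const : ∀ s, t0 < s → s ≤ t → ∫ ω in A, φ (Z t ω) ∂P = ∫ ω in A, φ (Z s ω) ∂P := by
        intro s hs hst
        have h1 := h.mart_set hφ hφc (ht0.trans hs.le) hst (ℱ.mono hs.le _ hAm)
        have hAm' := ℱ.le t0 _ hAm
        have e1 : ∀ u, t0 < u → ∫ ω in A, (φ (Z u ω) - ∫ r in Set.Ioc (0 : ℝ) u,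
            Lop B S φ r (Z r ω)) ∂P = ∫ ω in A, φ (Z u ω) ∂P := fun u hu =>
          setIntegral_congr_fun hAm' fun ω hω => by rw [zero ω hω u hu, sub_zero]
        rwa [e1 t ht, e1 s hs] at h1
      obtain ⟨Cφ, hCφ⟩ := hφc.exists_bound_of_continuous hφ.continuous
      have hcont : Tendsto (fun s => ∫ ω in A, φ (Z s ω) ∂P) (𝓝[>] t0)
          (𝓝 (∫ ω in A, φ (Z t0 ω) ∂P)) := by
        refine tendsto_integral_filter_of_dominated_convergence (fun _ => Cφ)
          (Eventually.of_forall fun s =>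
            (hφ.continuous.measurable.comp (h.measZ' s)).aestronglyMeasurable)
          (Eventually.of_forall fun s => Eventually.of_forall fun ω => hCφ _)
          (integrable_const _) (Eventually.of_forall fun ω => ?_)
        exact (((hφ.continuous.comp (h.cont ω)).tendsto t0)).mono_left nhdsWithin_le_nhds
      have hev : (fun s => ∫ ω in A, φ (Z s ω) ∂P) =ᶠ[𝓝[>] t0]
          fun _ => ∫ ω in A, φ (Z t ω) ∂P := by
        filter_upwards [Ioc_mem_nhdsGT ht] with s hs
        exact (const s hs.1 hs.2).symm
      exact tendsto_nhds_unique (tendsto_const_nhds.congr' hev.symm) hcont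
    refine ⟨f, fun z => ⟨f.nonneg, f.le_one⟩, f.continuous, fc, fun z hz =>
      f.one_of_mem_closedBall (by simpa using hz), ?_⟩
    have k1 := key (‖l‖ * R + 1) le_rfl
    have k2 := key (‖l‖ * R + 2) (by linarith)
    have bdi : ∀ ψ : E → ℝ, Continuous ψ → ∀ u,
        Integrable (fun ω => ψ (Z u ω) * f (Z u ω)) (P.restrict A) := by
      intro ψ hψ u
      have hcs : HasCompactSupport fun z => ψ z * f z := fc.mul_left
      obtain ⟨C, hC⟩ := hcs.exists_bound_of_continuous (hψ.mul f.continuous)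
      exact Integrable.of_bound (((hψ.mul f.continuous).measurable.comp
        (h.measZ' u)).aestronglyMeasurable) C (Eventually.of_forall fun ω => hC _)
    have e : ∀ u c, ∫ ω in A, ((l (Z u ω)) ^ 2 + 2 * c * l (Z u ω)) * f (Z u ω) ∂P =
        ∫ ω in A, (l (Z u ω)) ^ 2 * f (Z u ω) ∂P + 2 * c * ∫ ω in A, l (Z u ω) * f (Z u ω) ∂P := by
      intro u c
      rw [← integral_const_mul, ← integral_add (bdi (fun z => (l z) ^ 2) (by fun_prop) u)
        ((bdi (fun z => l z) (by fun_prop) u).const_mul _)]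
      congr 1; funext ω; ring
    rw [e, e] at k1 k2
    linear_combination k1 - (‖l‖ * R + 1) * (k2 - k1)
  choose! χ χ01 χc χcs χ1 χeq using main
  have := fatou_real (μ := P)
    (f := fun (k : ℕ) ω => Set.indicator {ω | ‖Z t0 ω‖ < (k : ℝ) + 1}
      (fun ω => (l (Z t ω)) ^ 2 * χ ((k : ℝ) + 1) (Z t ω)) ω) (g := fun ω => (l (Z t ω)) ^ 2)
    (c := ∫ ω, (l (Z t0 ω)) ^ 2 ∂P) (fun k ω => ?_) (fun k => ?_) (fun k => ?_) ?_ (fun ω => ?_)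
  · exact this
  · exact Set.indicator_nonneg (fun ω _ => mul_nonneg (sq_nonneg _)
      (χ01 _ (by positivity) _).1) _
  · have hcs := χcs ((k : ℝ) + 1) (by positivity)
    have hcc := χc ((k : ℝ) + 1) (by positivity)
    have hcs2 : HasCompactSupport fun z => (l z) ^ 2 * χ ((k : ℝ) + 1) z := hcs.mul_left
    have hcc2 : Continuous fun z => (l z) ^ 2 * χ ((k : ℝ) + 1) z := by fun_prop
    obtain ⟨C, hC⟩ := hcs2.exists_bound_of_continuous hcc2
    refine Integrable.indicator ?_ (measurableSet_lt (h.measZ' t0).norm measurable_const)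
    exact Integrable.of_bound ((hcc2.measurable.comp
        (h.measZ' t)).aestronglyMeasurable) C (Eventually.of_forall fun ω => hC _)
  · rw [integral_indicator (measurableSet_lt (h.measZ' t0).norm measurable_const),
      χeq _ (by positivity)]
    refine le_trans ?_ (setIntegral_le_integral
      (s := {ω | ‖Z t0 ω‖ < (k : ℝ) + 1}) hi0 (Eventually.of_forall fun ω => sq_nonneg _))
    refine integral_mono_of_nonneg (Eventually.of_forall fun ω => mul_nonneg (sq_nonneg _)
      (χ01 _ (by positivity) _).1) hi0.restrict (Eventually.of_forall fun ω => ?_)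
    exact mul_le_of_le_one_right (sq_nonneg _) (χ01 _ (by positivity) _).2
  · have : Continuous fun z => (l z) ^ 2 := by fun_prop
    exact (this.measurable.comp (h.measZ' t)).aestronglyMeasurable
  · apply tendsto_const_nhds.congr'
    obtain ⟨k0, hk0⟩ := exists_nat_ge (max ‖Z t0 ω‖ ‖Z t ω‖)
    filter_upwards [eventually_ge_atTop k0] with k hk
    have hk' : (k0 : ℝ) ≤ k := by exact_mod_cast hk
    have m1 := le_max_left ‖Z t0 ω‖ ‖Z t ω‖
    have m2 := le_max_right ‖Z t0 ω‖ ‖Z t ω‖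
    rw [Set.indicator_of_mem (show ω ∈ {ω | ‖Z t0 ω‖ < (k : ℝ) + 1} from by
      simp only [Set.mem_setOf_eq]; linarith), χ1 _ (by positivity) _ (by linarith), mul_one]

end Path


section Lyap
variable {H1 H2 ι : Type*} [NormedAddCommGroup H1] [InnerProductSpace ℝ H1]
  [NormedAddCommGroup H2] [InnerProductSpace ℝ H2] [Fintype ι]

/-- Quadratic function. -/
def QQ (c0 α γ : ℝ) (a : H1) (z : H1 × H2) : ℝ := c0 + (α * ‖z.1 - a‖ ^ 2 + γ * ‖z.2‖ ^ 2)

lemma QQ_smooth (c0 α γ : ℝ) (a : H1) : ContDiff ℝ 2 (QQ c0 α γ a : H1 × H2 → ℝ) := by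
  unfold QQ
  refine contDiff_const.add ((contDiff_const.mul ?_).add (contDiff_const.mul ?_))
  · exact (contDiff_fst.sub contDiff_const).norm_sq ℝ
  · exact contDiff_snd.norm_sq ℝ

lemma QQ_fderiv (c0 α γ : ℝ) (a : H1) :
    fderiv ℝ (QQ c0 α γ a : H1 × H2 → ℝ) = fun z =>
      (2 * α) • (innerSL ℝ (z.1 - a)).comp (ContinuousLinearMap.fst ℝ H1 H2) +
      (2 * γ) • (innerSL ℝ z.2).comp (ContinuousLinearMap.snd ℝ H1 H2) := by
  funext z
  have h1 : HasFDerivAt (fun z : H1 × H2 => z.1 - a) (ContinuousLinearMap.fst ℝ H1 H2) z :=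
    hasFDerivAt_fst.sub_const a
  have h2 : HasFDerivAt (fun z : H1 × H2 => z.2) (ContinuousLinearMap.snd ℝ H1 H2) z :=
    hasFDerivAt_snd
  have h3 := ((h1.norm_sq.const_mul α).add (h2.norm_sq.const_mul γ)).const_add c0
  refine h3.fderiv.trans ?_
  ext w <;> simp <;> ring

lemma QQ_fderiv2 (c0 α γ : ℝ) (a : H1) (z v w : H1 × H2) :
    fderiv ℝ (fderiv ℝ (QQ c0 α γ a : H1 × H2 → ℝ)) z v w =
      2 * α * ⟪v.1, w.1⟫ + 2 * γ * ⟪v.2, w.2⟫ := by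
  have hd : DifferentiableAt ℝ (fderiv ℝ (QQ c0 α γ a : H1 × H2 → ℝ)) z :=
    ((QQ_smooth c0 α γ a).fderiv_right (m := 1) (by norm_num)).differentiable (by norm_num) z
  have e : fderiv ℝ (fderiv ℝ (QQ c0 α γ a : H1 × H2 → ℝ)) z v w =
      fderiv ℝ (fun z => fderiv ℝ (QQ c0 α γ a : H1 × H2 → ℝ) z w) z v := by
    rw [fderiv_clm_apply hd (differentiableAt_const w)]
    simp
  rw [e, QQ_fderiv]
  have h1 : HasFDerivAt (fun z : H1 × H2 => z.1 - a) (ContinuousLinearMap.fst ℝ H1 H2) z :=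
    hasFDerivAt_fst.sub_const a
  have h2 : HasFDerivAt (fun z : H1 × H2 => z.2) (ContinuousLinearMap.snd ℝ H1 H2) z :=
    hasFDerivAt_snd
  have h3 := ((h1.inner ℝ (hasFDerivAt_const w.1 z)).const_mul (2 * α)).add
    ((h2.inner ℝ (hasFDerivAt_const w.2 z)).const_mul (2 * γ))
  have h4 := DFunLike.congr_fun h3.fderiv v
  refine Eq.trans ?_ (h4.trans ?_)
  · congr 1
  · simp

lemma Lop_QQ (B : ℝ → H1 × H2 → H1 × H2) (S : ι → ℝ → H1 × H2 → H1 × H2)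
    (c0 α γ : ℝ) (a : H1) (s : ℝ) (z : H1 × H2) :
    Lop B S (QQ c0 α γ a) s z = 2 * α * ⟪z.1 - a, (B s z).1⟫ + 2 * γ * ⟪z.2, (B s z).2⟫ +
      ∑ k, (α * ‖(S k s z).1‖ ^ 2 + γ * ‖(S k s z).2‖ ^ 2) := by
  unfold Lop
  simp only [QQ_fderiv2]
  rw [QQ_fderiv, Finset.mul_sum]
  have e1 : ((2 * α) • (innerSL ℝ (z.1 - a)).comp (ContinuousLinearMap.fst ℝ H1 H2) +
      (2 * γ) • (innerSL ℝ z.2).comp (ContinuousLinearMap.snd ℝ H1 H2)) (B s z) =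
      2 * α * ⟪z.1 - a, (B s z).1⟫ + 2 * γ * ⟪z.2, (B s z).2⟫ := by
    simp [mul_assoc, inner_sub_left]
  have e2 : ∑ k, (1 / 2) * (2 * α * ⟪(S k s z).1, (S k s z).1⟫ +
      2 * γ * ⟪(S k s z).2, (S k s z).2⟫) =
      ∑ k, (α * ‖(S k s z).1‖ ^ 2 + γ * ‖(S k s z).2‖ ^ 2) := by
    refine Finset.sum_congr rfl fun k _ => ?_
    rw [real_inner_self_eq_norm_sq, real_inner_self_eq_norm_sq]; ring
  rw [← e2, ← e1]

lemma QQ_pos {c0 α γ : ℝ} (hc : 0 < c0) (hα : 0 ≤ α) (hγ : 0 ≤ γ) (a : H1) (z : H1 × H2) :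
    0 < QQ c0 α γ a z := by unfold QQ; positivity

lemma QQr_smooth {c0 α γ : ℝ} (hc : 0 < c0) (hα : 0 ≤ α) (hγ : 0 ≤ γ) (a : H1) (r : ℝ) :
    ContDiff ℝ 2 (fun z : H1 × H2 => QQ c0 α γ a z ^ r) := by
  refine contDiff_iff_contDiffAt.2 fun z => ?_
  exact (QQ_smooth c0 α γ a).contDiffAt.rpow_const_of_ne (QQ_pos hc hα hγ a z).ne'

lemma Lop_QQr (B : ℝ → H1 × H2 → H1 × H2) (S : ι → ℝ → H1 × H2 → H1 × H2)
    {c0 α γ : ℝ} (hc : 0 < c0) (hα : 0 ≤ α) (hγ : 0 ≤ γ) (a : H1) {r : ℝ} (hr : 0 ≤ r)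
    (s : ℝ) (z : H1 × H2) :
    Lop B S (fun z => QQ c0 α γ a z ^ r) s z ≤
      r * QQ c0 α γ a z ^ (r - 1) * (2 * α * ⟪z.1 - a, (B s z).1⟫ + 2 * γ * ⟪z.2, (B s z).2⟫) +
      r * (1 + 2 * |r - 1|) * QQ c0 α γ a z ^ (r - 1) *
        ∑ k, (α * ‖(S k s z).1‖ ^ 2 + γ * ‖(S k s z).2‖ ^ 2) := by
  have hd1 : ∀ z : H1 × H2, HasDerivAt (fun u : ℝ => u ^ r)
      ((fun u : ℝ => r * u ^ (r - 1)) (QQ c0 α γ a z)) (QQ c0 α γ a z) := fun z =>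
    Real.hasDerivAt_rpow_const (Or.inl (QQ_pos hc hα hγ a z).ne')
  have hd2 : ∀ z : H1 × H2, HasDerivAt (fun u : ℝ => r * u ^ (r - 1))
      ((fun u : ℝ => r * ((r - 1) * u ^ (r - 1 - 1))) (QQ c0 α γ a z)) (QQ c0 α γ a z) := fun z =>
    (Real.hasDerivAt_rpow_const (Or.inl (QQ_pos hc hα hγ a z).ne')).const_mul r
  have hL := Lop_comp B S (QQ_smooth c0 α γ a) (θ' := fun u : ℝ => r * u ^ (r - 1))
    (θ'' := fun u : ℝ => r * ((r - 1) * u ^ (r - 1 - 1))) hd1 hd2 s z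
  rw [hL, Lop_QQ]
  have hQ := QQ_pos hc hα hγ a z
  have hQp : QQ c0 α γ a z ^ (r - 1) = QQ c0 α γ a z ^ (r - 1 - 1) * QQ c0 α γ a z := by
    rw [← Real.rpow_add_one hQ.ne']; congr 1; ring
  have hcs : ∑ k, (fderiv ℝ (QQ c0 α γ a) z (S k s z)) ^ 2 ≤
      4 * QQ c0 α γ a z * ∑ k, (α * ‖(S k s z).1‖ ^ 2 + γ * ‖(S k s z).2‖ ^ 2) := by
    rw [Finset.mul_sum]
    refine Finset.sum_le_sum fun k _ => ?_
    rw [QQ_fderiv]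
    simp only [ContinuousLinearMap.add_apply, ContinuousLinearMap.smul_apply,
      ContinuousLinearMap.comp_apply, ContinuousLinearMap.coe_fst', ContinuousLinearMap.coe_snd',
      innerSL_apply_apply, smul_eq_mul]
    have i1 := abs_real_inner_le_norm (z.1 - a) (S k s z).1
    have i2 := abs_real_inner_le_norm z.2 (S k s z).2
    unfold QQ
    have n1 := norm_nonneg (z.1 - a)
    have n2 := norm_nonneg z.2
    have n3 := norm_nonneg (S k s z).1
    have n4 := norm_nonneg (S k s z).2
    generalize ‖z.1 - a‖ = p at *
    generalize ‖z.2‖ = q at *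
    generalize ‖(S k s z).1‖ = u at *
    generalize ‖(S k s z).2‖ = v at *
    generalize ⟪z.1 - a, (S k s z).1⟫ = x at *
    generalize ⟪z.2, (S k s z).2⟫ = y at *
    have e1 : (2 * α * x + 2 * γ * y) ^ 2 ≤ (2 * α * (p * u) + 2 * γ * (q * v)) ^ 2 := by
      rw [sq_le_sq]
      calc |2 * α * x + 2 * γ * y| ≤ |2 * α * x| + |2 * γ * y| := abs_add_le _ _
        _ = 2 * α * |x| + 2 * γ * |y| := by
            rw [abs_mul (2 * α) x, abs_mul (2 * γ) y, abs_of_nonneg (by positivity : 0 ≤ 2 * α),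
              abs_of_nonneg (by positivity : 0 ≤ 2 * γ)]
        _ ≤ 2 * α * (p * u) + 2 * γ * (q * v) := by gcongr
        _ ≤ _ := le_abs_self _
    refine e1.trans ?_
    have e2 : 0 ≤ α * γ * (p * v - q * u) ^ 2 := by positivity
    have e3 : 0 ≤ c0 * (α * u ^ 2 + γ * v ^ 2) := by positivity
    nlinarith
  set sg := ∑ k, (α * ‖(S k s z).1‖ ^ 2 + γ * ‖(S k s z).2‖ ^ 2) with hsg
  set Dr := 2 * α * ⟪z.1 - a, (B s z).1⟫ + 2 * γ * ⟪z.2, (B s z).2⟫ with hDr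
  set Q := QQ c0 α γ a z with hQdef
  set G := ∑ k, (fderiv ℝ (QQ c0 α γ a) z (S k s z)) ^ 2 with hG
  have G0 : 0 ≤ G := Finset.sum_nonneg fun k _ => sq_nonneg _
  have q2 : 0 ≤ Q ^ (r - 1 - 1) := Real.rpow_nonneg hQ.le _
  have fin : (1 / 2) * (r * ((r - 1) * Q ^ (r - 1 - 1))) * G ≤
      r * (2 * |r - 1|) * Q ^ (r - 1) * sg := by
    rw [hQp]
    calc (1 / 2) * (r * ((r - 1) * Q ^ (r - 1 - 1))) * G
        ≤ (1 / 2) * (r * (|r - 1| * Q ^ (r - 1 - 1))) * G := by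
          gcongr; exact le_abs_self _
      _ ≤ (1 / 2) * (r * (|r - 1| * Q ^ (r - 1 - 1))) * (4 * Q * sg) := by
          gcongr
      _ = _ := by ring
  have : r * Q ^ (r - 1) * (Dr + sg) = r * Q ^ (r - 1) * Dr + r * Q ^ (r - 1) * sg := by ring
  simp only at *
  nlinarith

end Lyap


section Gen

lemma young1 {p h q A : ℝ} (hp : 1 ≤ p) (hh : 0 < h) (hq : 0 < q) (hA : 0 ≤ A) :
    q ^ (p - 1) * A ≤ q ^ p / h + h ^ (p - 1) * A ^ p := by
  have e1 : q ^ p = q ^ (p - 1) * q := by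
    rw [← Real.rpow_add_one hq.ne']; congr 1; ring
  by_cases hc : h * A ≤ q
  · have : q ^ (p - 1) * A ≤ q ^ p / h := by
      rw [e1, le_div_iff₀ hh]
      calc q ^ (p - 1) * A * h = q ^ (p - 1) * (h * A) := by ring
        _ ≤ _ := by gcongr
    have : 0 ≤ h ^ (p - 1) * A ^ p := by positivity
    linarith
  · have hA' : 0 < A := by
      rcases hA.lt_or_eq with h1 | h1
      · exact h1
      · exfalso; apply hc; rw [← h1]; simpa using hq.le
    have : q ^ (p - 1) * A ≤ h ^ (p - 1) * A ^ p := by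
      have e2 : A ^ p = A ^ (p - 1) * A := by
        rw [← Real.rpow_add_one hA'.ne']; congr 1; ring
      rw [e2, ← mul_assoc, ← Real.mul_rpow hh.le hA]
      gcongr
      · linarith
    have : 0 ≤ q ^ p / h := by positivity
    linarith

lemma young2 {p h q s : ℝ} (hp : 2 ≤ p) (hh : 0 < h) (hq : 0 < q) (hs : 0 ≤ s) :
    q ^ (p - 2) * s ^ 2 ≤ q ^ p / h + h ^ (p / 2 - 1) * s ^ p := by
  have := young1 (p := p / 2) (h := h) (q := q ^ 2) (A := s ^ 2) (by linarith) hh (by positivity)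
    (by positivity)
  have e : ∀ x : ℝ, 0 ≤ x → ∀ a : ℝ, (x ^ 2) ^ a = x ^ (2 * a) := by
    intro x hx a
    rw [Real.rpow_mul hx]; norm_cast
  rw [e q hq.le, e q hq.le, e s hs] at this
  have e1 : 2 * (p / 2 - 1) = p - 2 := by ring
  have e2 : 2 * (p / 2) = p := by ring
  rw [e1, e2] at this
  exact this

lemma sublin {a b η : ℝ} (hab : a < b) (hη : 0 < η) :
    ∃ C : ℝ, 0 ≤ C ∧ ∀ Q : ℝ, 1 ≤ Q → Q ^ a ≤ η * Q ^ b + C := by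
  set R := (1 / η) ^ (1 / (b - a)) with hR
  have hba : 0 < b - a := by linarith
  have R0 : 0 < R := by positivity
  refine ⟨(max 1 R) ^ |a|, by positivity, fun Q hQ => ?_⟩
  have Q0 : 0 < Q := by linarith
  by_cases hc : R ≤ Q
  · have h1 : 1 / η ≤ Q ^ (b - a) := by
      calc 1 / η = R ^ (b - a) := by
            rw [hR, ← Real.rpow_mul (by positivity)]
            rw [one_div_mul_cancel hba.ne', Real.rpow_one]
        _ ≤ _ := by gcongr
    have h2 : Q ^ b = Q ^ (b - a) * Q ^ a := by
      rw [← Real.rpow_add Q0]; congr 1; ring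
    have h3 : 0 < Q ^ a := by positivity
    have h4 : 1 ≤ η * Q ^ (b - a) := by
      rw [div_le_iff₀ hη] at h1; linarith
    have : 0 ≤ (max 1 R) ^ |a| := by positivity
    rw [h2]; nlinarith
  · have h1 : Q ≤ max 1 R := le_max_of_le_right (not_le.1 hc).le
    have : Q ^ a ≤ (max 1 R) ^ |a| :=
      (Real.rpow_le_rpow_of_exponent_le hQ (le_abs_self a)).trans
        (Real.rpow_le_rpow Q0.le h1 (abs_nonneg a))
    have : 0 ≤ η * Q ^ b := by positivity
    linarith

variable {H1 H2 ι : Type*} [NormedAddCommGroup H1] [InnerProductSpace ℝ H1]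
  [NormedAddCommGroup H2] [InnerProductSpace ℝ H2] [Fintype ι]

/-- Structural bounds on the coefficients. -/
structure Bd (B : ℝ → H1 × H2 → H1 × H2) (S : ι → ℝ → H1 × H2 → H1 × H2) (βv : ℝ → H1)
    (L γ ς e : ℝ) : Prop where
  he : 1 ≤ e
  hL : 1 ≤ L
  hγ : 0 < γ
  hς0 : 0 < ς
  hς1 : ς < 1
  d1 : ∀ s z, ‖(B s z).1 - βv s‖ ≤ L * (‖z.1‖ + ‖z.2‖) + e * (L * (1 + ‖z.2‖))
  d2 : ∀ s z, ⟪z.2, (B s z).2⟫ ≤ e ^ 2 * (-(γ / 2) * ‖z.2‖ ^ 2 + L * ‖z.2‖) +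
    e * (L * (1 + ‖z.2‖) * ‖z.2‖)
  s1 : ∀ k s z, ‖(S k s z).1‖ ≤ L * (1 + ‖z.2‖)
  s2 : ∀ k s z, ‖(S k s z).2‖ ≤ e * (L * (1 + ‖z.2‖ ^ ς))

lemma Bd.in1 {B : ℝ → H1 × H2 → H1 × H2} {S : ι → ℝ → H1 × H2 → H1 × H2} {βv : ℝ → H1}
    {L γ ς e : ℝ} (h : Bd B S βv L γ ς e) (a : H1) (s : ℝ) (z : H1 × H2) :
    ⟪z.1 - a, (B s z).1⟫ ≤ ‖z.1 - a‖ * (‖βv s‖ + L * ‖z.1‖ + 2 * e * L * (1 + ‖z.2‖)) := by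
  have h1 := real_inner_le_norm (z.1 - a) (B s z).1
  have h2 : ‖(B s z).1‖ ≤ ‖(B s z).1 - βv s‖ + ‖βv s‖ := by
    simpa using norm_add_le ((B s z).1 - βv s) (βv s)
  have h3 := h.d1 s z
  have := h.he
  have := h.hL
  refine h1.trans ?_
  gcongr
  have n2 := norm_nonneg z.2
  have : L * ‖z.2‖ ≤ e * (L * (1 + ‖z.2‖)) := by
    calc L * ‖z.2‖ ≤ L * (1 + ‖z.2‖) := by gcongr; linarith
      _ ≤ _ := le_mul_of_one_le_left (by positivity) h.he
  nlinarith

lemma Bd.genU {B : ℝ → H1 × H2 → H1 × H2} {S : ι → ℝ → H1 × H2 → H1 × H2} {βv : ℝ → H1}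
    {L γ ς e : ℝ} (h : Bd B S βv L γ ς e) : ∃ CU : ℝ, 0 ≤ CU ∧ ∀ s z,
    Lop B S (fun z => QQ 1 1 1 (0 : H1) z ^ (1 / 2 : ℝ)) s z ≤
      CU * QQ 1 1 1 (0 : H1) z ^ (1 / 2 : ℝ) + ‖βv s‖ := by
  have he := h.he
  have hL := h.hL
  have hγ := h.hγ
  refine ⟨5 * e * L + 3 * e ^ 2 * L + Fintype.card ι * ((2 * L) ^ 2 + (2 * e * L) ^ 2),
    by positivity, fun s z => ?_⟩
  refine (Lop_QQr B S one_pos zero_le_one zero_le_one (0 : H1) (by norm_num) s z).trans ?_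
  have hQ := QQ_pos (c0 := 1) one_pos zero_le_one zero_le_one (0 : H1) z
  set Q := QQ 1 1 1 (0 : H1) z with hQd
  set q := Q ^ (1 / 2 : ℝ) with hq
  have q0 : 0 < q := by positivity
  have e1 : Q ^ (1 / 2 - 1 : ℝ) = q⁻¹ := by
    rw [hq, ← Real.rpow_neg hQ.le]; norm_num
  have q2 : q ^ 2 = Q := by rw [hq, ← Real.sqrt_eq_rpow, Real.sq_sqrt hQ.le]
  have hQe : Q = 1 + (‖z.1‖ ^ 2 + ‖z.2‖ ^ 2) := by rw [hQd, QQ]; simp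
  have n1 := norm_nonneg z.1
  have n2 := norm_nonneg z.2
  have q1 : 1 ≤ q := by nlinarith
  have xq : ‖z.1‖ ≤ q := abs_le_of_sq_le_sq' (by nlinarith) q0.le |>.2
  have yq : ‖z.2‖ ≤ q := abs_le_of_sq_le_sq' (by nlinarith) q0.le |>.2
  have yς : ‖z.2‖ ^ ς ≤ q := by
    calc ‖z.2‖ ^ ς ≤ q ^ ς := Real.rpow_le_rpow n2 yq h.hς0.le
      _ ≤ q ^ (1 : ℝ) := Real.rpow_le_rpow_of_exponent_le q1 h.hς1.le
      _ = q := Real.rpow_one q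
  have i1 := h.in1 0 s z
  rw [sub_zero] at i1 ⊢
  have i2 := h.d2 s z
  have j1 : ⟪z.1, (B s z).1⟫ ≤ q * ‖βv s‖ + 5 * e * L * q ^ 2 := by
    refine i1.trans ?_
    have : ‖βv s‖ + L * ‖z.1‖ + 2 * e * L * (1 + ‖z.2‖) ≤ ‖βv s‖ + 5 * e * L * q := by
      have a1 : L * ‖z.1‖ ≤ e * L * q := by
        calc L * ‖z.1‖ ≤ L * q := by gcongr
          _ ≤ e * (L * q) := le_mul_of_one_le_left (by positivity) he
          _ = _ := by ring
      have a2 : 2 * e * L * (1 + ‖z.2‖) ≤ 2 * e * L * (2 * q) := by gcongr; linarith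
      linarith
    calc _ ≤ q * (‖βv s‖ + 5 * e * L * q) := by gcongr
      _ = _ := by ring
  have j2 : ⟪z.2, (B s z).2⟫ ≤ 3 * e ^ 2 * L * q ^ 2 := by
    refine i2.trans ?_
    have b1 : 0 ≤ e ^ 2 * (γ / 2 * ‖z.2‖ ^ 2) := by positivity
    have b2 : e ^ 2 * (L * ‖z.2‖) ≤ e ^ 2 * (L * q ^ 2) := by gcongr; nlinarith
    have b3 : e * (L * (1 + ‖z.2‖) * ‖z.2‖) ≤ e ^ 2 * (L * (2 * q) * q) := by
      gcongr
      · nlinarith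
      · linarith
    nlinarith
  have j3 : ∑ k, (1 * ‖(S k s z).1‖ ^ 2 + 1 * ‖(S k s z).2‖ ^ 2) ≤
      Fintype.card ι * ((2 * L) ^ 2 + (2 * e * L) ^ 2) * q ^ 2 := by
    have : ∀ k ∈ Finset.univ, 1 * ‖(S k s z).1‖ ^ 2 + 1 * ‖(S k s z).2‖ ^ 2 ≤
        ((2 * L) ^ 2 + (2 * e * L) ^ 2) * q ^ 2 := by
      intro k _
      have c1 : ‖(S k s z).1‖ ≤ 2 * L * q := (h.s1 k s z).trans (by nlinarith)
      have c2 : ‖(S k s z).2‖ ≤ 2 * e * L * q := (h.s2 k s z).trans (by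
        calc e * (L * (1 + ‖z.2‖ ^ ς)) ≤ e * (L * (2 * q)) := by gcongr; linarith
          _ = _ := by ring)
      calc _ = ‖(S k s z).1‖ ^ 2 + ‖(S k s z).2‖ ^ 2 := by ring
        _ ≤ (2 * L * q) ^ 2 + (2 * e * L * q) ^ 2 := by gcongr
        _ = _ := by ring
    refine (Finset.sum_le_card_nsmul _ _ _ this).trans (le_of_eq ?_)
    rw [nsmul_eq_mul, Finset.card_univ]; ring
  rw [e1]
  have qi : 0 < q⁻¹ := by positivity
  have ab : |(1 / 2 - 1 : ℝ)| = 1 / 2 := by norm_num [abs_of_neg]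
  rw [ab]
  set Sg := ∑ k, (1 * ‖(S k s z).1‖ ^ 2 + 1 * ‖(S k s z).2‖ ^ 2) with hSg
  calc _ = q⁻¹ * (⟪z.1, (B s z).1⟫ + ⟪z.2, (B s z).2⟫ + Sg) := by ring
    _ ≤ q⁻¹ * (q * ‖βv s‖ + 5 * e * L * q ^ 2 + 3 * e ^ 2 * L * q ^ 2 +
        Fintype.card ι * ((2 * L) ^ 2 + (2 * e * L) ^ 2) * q ^ 2) := by gcongr
    _ = _ := by field_simp; ring

/-- Bound on the fast moment generator. -/
lemma genWY (L γ ς p : ℝ) (dd : ℕ) (hL : 1 ≤ L) (hγ : 0 < γ) (hς1 : ς < 1) (hp : 2 ≤ p) :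
    ∃ lam c D : ℝ, 0 < lam ∧ 0 < c ∧ 0 ≤ D ∧
    ∀ (B : ℝ → H1 × H2 → H1 × H2) (S : ι → ℝ → H1 × H2 → H1 × H2) (βv : ℝ → H1) (e : ℝ),
      Fintype.card ι ≤ dd → Bd B S βv L γ ς e → ∀ s z,
      Lop B S (fun z => QQ 1 0 1 (0 : H1) z ^ (p / 2)) s z ≤
        e ^ 2 * (-lam * QQ 1 0 1 (0 : H1) z ^ (p / 2) + D) +
          c * QQ 1 0 1 (0 : H1) z ^ (p / 2) := by
  set c1 : ℝ := p / 2 * (1 + 2 * |p / 2 - 1|) * (dd * L ^ 2 * 4) with hc1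
  have p0 : 0 < p := by linarith
  have c10 : 0 ≤ c1 := by positivity
  set η : ℝ := γ / 8 with hη
  have η0 : 0 < η := by positivity
  obtain ⟨C1, C10, hC1⟩ := sublin (a := p / 2 - 1) (b := p / 2) (η := 1 / 4) (by linarith)
    (by norm_num)
  obtain ⟨C2, C20, hC2⟩ := sublin (a := p / 2 - 1 / 2) (b := p / 2) (η := γ / (16 * L))
    (by linarith) (by positivity)
  obtain ⟨C3, C30, hC3⟩ := sublin (a := p / 2 - 1 + ς) (b := p / 2) (η := p * γ / (16 * (c1 + 1)))
    (by linarith) (by positivity)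
  refine ⟨p * γ / 8, p * (L ^ 2 / η), p * (γ / 2) * C1 + p * L * C2 + c1 * C3, by positivity,
    by positivity, by positivity, fun B S βv e hcard h s z => ?_⟩
  have he := h.he
  refine (Lop_QQr B S one_pos le_rfl zero_le_one (0 : H1) (by linarith) s z).trans ?_
  have hQ := QQ_pos (c0 := 1) one_pos le_rfl zero_le_one (0 : H1) z
  set Q := QQ 1 0 1 (0 : H1) z with hQd
  have n2 := norm_nonneg z.2
  have hQe : Q = 1 + ‖z.2‖ ^ 2 := by rw [hQd, QQ]; simp
  have Q1 : 1 ≤ Q := by nlinarith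
  have yς : 1 + ‖z.2‖ ^ ς ≤ 2 * Q ^ (ς / 2) := by
    have a1 : 1 ≤ Q ^ (ς / 2) := Real.one_le_rpow Q1 (by linarith [h.hς0])
    have a2 : ‖z.2‖ ^ ς ≤ Q ^ (ς / 2) := by
      have : ‖z.2‖ ^ ς = (‖z.2‖ ^ 2) ^ (ς / 2) := by
        rw [← Real.rpow_natCast, ← Real.rpow_mul n2]; congr 1; push_cast; ring
      rw [this]
      exact Real.rpow_le_rpow (by positivity) (by linarith) (by linarith [h.hς0])
    linarith
  have j3 : ∑ k, (0 * ‖(S k s z).1‖ ^ 2 + 1 * ‖(S k s z).2‖ ^ 2) ≤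
      dd * L ^ 2 * 4 * (e ^ 2 * Q ^ ς) := by
    have : ∀ k ∈ Finset.univ, 0 * ‖(S k s z).1‖ ^ 2 + 1 * ‖(S k s z).2‖ ^ 2 ≤
        L ^ 2 * 4 * (e ^ 2 * Q ^ ς) := by
      intro k _
      have c2 : ‖(S k s z).2‖ ≤ e * (L * (2 * Q ^ (ς / 2))) := (h.s2 k s z).trans (by gcongr)
      have c3 : Q ^ ς = (Q ^ (ς / 2)) ^ 2 := by
        rw [← Real.rpow_natCast, ← Real.rpow_mul hQ.le]; congr 1; push_cast; ring
      calc _ = ‖(S k s z).2‖ ^ 2 := by ring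
        _ ≤ (e * (L * (2 * Q ^ (ς / 2)))) ^ 2 := by gcongr
        _ = _ := by rw [c3]; ring
    refine (Finset.sum_le_card_nsmul _ _ _ this).trans ?_
    rw [nsmul_eq_mul, Finset.card_univ]
    calc (Fintype.card ι : ℝ) * (L ^ 2 * 4 * (e ^ 2 * Q ^ ς)) ≤
        dd * (L ^ 2 * 4 * (e ^ 2 * Q ^ ς)) := by gcongr
      _ = _ := by ring
  have sq : ‖z.2‖ ≤ Q ^ (1 / 2 : ℝ) := by
    rw [← Real.sqrt_eq_rpow]; exact Real.le_sqrt_of_sq_le (by linarith)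
  have i2 : ⟪z.2, (B s z).2⟫ ≤ e ^ 2 * (-(γ / 2) * Q + γ / 2 + L * Q ^ (1 / 2 : ℝ) + η * Q) +
      L ^ 2 / η * Q := by
    refine (h.d2 s z).trans ?_
    have a1 : e * (L * (1 + ‖z.2‖) * ‖z.2‖) ≤ 2 * e * L * Q := by
      have : (1 + ‖z.2‖) * ‖z.2‖ ≤ 2 * Q := by nlinarith [sq_nonneg (‖z.2‖ - 1)]
      calc _ = e * L * ((1 + ‖z.2‖) * ‖z.2‖) := by ring
        _ ≤ e * L * (2 * Q) := by gcongr
        _ = _ := by ring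
    have a2 : 2 * e * L ≤ η * e ^ 2 + L ^ 2 / η := by
      have : 0 ≤ (η * e - L) ^ 2 / η := by positivity
      have e' : (η * e - L) ^ 2 / η = η * e ^ 2 + L ^ 2 / η - 2 * e * L := by field_simp; ring
      linarith
    have a3 : 2 * e * L * Q ≤ (η * e ^ 2 + L ^ 2 / η) * Q := by gcongr
    have a4 : e ^ 2 * (L * ‖z.2‖) ≤ e ^ 2 * (L * Q ^ (1 / 2 : ℝ)) := by gcongr
    have a5 : ‖z.2‖ ^ 2 = Q - 1 := by linarith
    rw [a5]
    nlinarith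
  have k1 : Q ^ (p / 2 - 1) * Q = Q ^ (p / 2) := by
    rw [← Real.rpow_add_one hQ.ne']; congr 1; ring
  have k2 : Q ^ (p / 2 - 1) * Q ^ (1 / 2 : ℝ) = Q ^ (p / 2 - 1 / 2) := by
    rw [← Real.rpow_add hQ]; congr 1; ring
  have k3 : Q ^ (p / 2 - 1) * Q ^ ς = Q ^ (p / 2 - 1 + ς) := by
    rw [← Real.rpow_add hQ]
  have g1 := hC1 Q Q1
  have g2 := hC2 Q Q1
  have g3 := hC3 Q Q1
  set Sg := ∑ k, (0 * ‖(S k s z).1‖ ^ 2 + 1 * ‖(S k s z).2‖ ^ 2) with hSg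
  have w0 : 0 < Q ^ (p / 2) := by positivity
  set w := Q ^ (p / 2) with hw
  set v := Q ^ (p / 2 - 1) with hv
  have v0 : 0 < v := by positivity
  have m2 : L * Q ^ (p / 2 - 1 / 2) ≤ γ / 16 * w + L * C2 := by
    calc L * Q ^ (p / 2 - 1 / 2) ≤ L * (γ / (16 * L) * w + C2) := by gcongr
      _ = _ := by field_simp
  have m3 : c1 * Q ^ (p / 2 - 1 + ς) ≤ p * γ / 16 * w + c1 * C3 := by
    calc c1 * Q ^ (p / 2 - 1 + ς) ≤ c1 * (p * γ / (16 * (c1 + 1)) * w + C3) := by gcongr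
      _ = (c1 / (c1 + 1)) * (p * γ / 16 * w) + c1 * C3 := by field_simp
      _ ≤ 1 * (p * γ / 16 * w) + c1 * C3 := by
          gcongr
          rw [div_le_one (by positivity)]; linarith
      _ = _ := by ring
  calc p / 2 * v * (2 * 0 * ⟪z.1 - 0, (B s z).1⟫ + 2 * 1 * ⟪z.2, (B s z).2⟫) +
        p / 2 * (1 + 2 * |p / 2 - 1|) * v * Sg
      = p * v * ⟪z.2, (B s z).2⟫ + p / 2 * (1 + 2 * |p / 2 - 1|) * v * Sg := by ring
    _ ≤ p * v * (e ^ 2 * (-(γ / 2) * Q + γ / 2 + L * Q ^ (1 / 2 : ℝ) + η * Q) +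
      L ^ 2 / η * Q) + p / 2 * (1 + 2 * |p / 2 - 1|) * v * (dd * L ^ 2 * 4 * (e ^ 2 * Q ^ ς)) := by
        gcongr
    _ = e ^ 2 * (p * (-(γ / 2) + η) * (v * Q) + p * (γ / 2) * v +
        p * (L * (v * Q ^ (1 / 2 : ℝ))) + c1 * (v * Q ^ ς)) + p * (L ^ 2 / η) * (v * Q) := by
        rw [hc1]; ring
    _ = e ^ 2 * (p * (-(γ / 2) + η) * w + p * (γ / 2) * v +
        p * (L * Q ^ (p / 2 - 1 / 2)) + c1 * Q ^ (p / 2 - 1 + ς)) + p * (L ^ 2 / η) * w := by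
        rw [k1, k2, k3]
    _ ≤ e ^ 2 * (p * (-(γ / 2) + η) * w + p * (γ / 2) * (1 / 4 * w + C1) +
        p * (γ / 16 * w + L * C2) + (p * γ / 16 * w + c1 * C3)) + p * (L ^ 2 / η) * w := by
        gcongr
    _ = _ := by rw [hη]; ring

end Gen


section Gen2
variable {H1 H2 ι : Type*} [NormedAddCommGroup H1] [InnerProductSpace ℝ H1]
  [NormedAddCommGroup H2] [InnerProductSpace ℝ H2] [Fintype ι]

lemma rpow_add_le2 {a b p : ℝ} (ha : 0 ≤ a) (hb : 0 ≤ b) (hp : 1 ≤ p) :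
    (a + b) ^ p ≤ 2 ^ p * (a ^ p + b ^ p) := by
  have h1 : a + b ≤ 2 * max a b := by
    have := le_max_left a b; have := le_max_right a b; linarith
  calc (a + b) ^ p ≤ (2 * max a b) ^ p := by gcongr
    _ = 2 ^ p * (max a b) ^ p := by rw [Real.mul_rpow (by norm_num) (le_max_of_le_left ha)]
    _ ≤ _ := by
      gcongr
      rcases le_total a b with h | h
      · rw [max_eq_right h]; have : 0 ≤ a ^ p := by positivity
        linarith
      · rw [max_eq_left h]; have : 0 ≤ b ^ p := by positivity
        linarith

lemma one_add_rpow {y p : ℝ} (hy : 0 ≤ y) (hp : 2 ≤ p) :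
    (1 + y) ^ p ≤ 2 ^ p * (1 + y ^ 2) ^ (p / 2) := by
  have h1 : 1 + y ≤ 2 * (1 + y ^ 2) ^ (1 / 2 : ℝ) := by
    rw [← Real.sqrt_eq_rpow]
    have := Real.le_sqrt_of_sq_le (show y ^ 2 ≤ 1 + y ^ 2 by linarith)
    have := Real.le_sqrt_of_sq_le (show 1 ^ 2 ≤ 1 + y ^ 2 by nlinarith)
    linarith
  calc (1 + y) ^ p ≤ (2 * (1 + y ^ 2) ^ (1 / 2 : ℝ)) ^ p := by gcongr
    _ = _ := by
      rw [Real.mul_rpow (by norm_num) (by positivity), ← Real.rpow_mul (by positivity)]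
      congr 2; ring

/-- The remainder term. -/
def Rem (p e h : ℝ) (z : H1 × H2) : ℝ :=
  h ^ (p - 1) * (‖z.1‖ ^ p + e ^ p * QQ 1 0 1 (0 : H1) z ^ (p / 2)) +
    h ^ (p / 2 - 1) * QQ 1 0 1 (0 : H1) z ^ (p / 2)

set_option maxHeartbeats 1000000 in
lemma genX (L γ ς p : ℝ) (dd : ℕ) (hL : 1 ≤ L) (hp : 2 ≤ p) :
    ∃ c : ℝ, 0 < c ∧
    ∀ (B : ℝ → H1 × H2 → H1 × H2) (S : ι → ℝ → H1 × H2 → H1 × H2) (βv : ℝ → H1) (e : ℝ),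
      Fintype.card ι ≤ dd → Bd B S βv L γ ς e → ∀ (δ h : ℝ), 0 < δ → 0 < h → ∀ (a : H1) s z,
      (1 ≤ δ → Lop B S (fun z => QQ (δ ^ 2) 1 0 a z ^ (p / 2)) s z ≤
        (c / h + p * ‖βv s‖) * QQ (δ ^ 2) 1 0 a z ^ (p / 2) + c * Rem p e h z) ∧
      Lop B S (fun z => QQ (δ ^ 2) 1 0 a z ^ (p / 2)) s z ≤
        (c / h) * QQ (δ ^ 2) 1 0 a z ^ (p / 2) +
          c * (Rem p e h z + h ^ (p - 1) * ‖βv s‖ ^ p) := by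
  have p0 : 0 < p := by linarith
  set c1 : ℝ := p / 2 * (1 + 2 * |p / 2 - 1|) * (dd * L ^ 2) with hc1
  have c10 : 0 ≤ c1 := by positivity
  set c3 : ℝ := p * L ^ p + p * ((2 * L) ^ p * 2 ^ p) + c1 * 2 ^ p with hc3
  have c30 : 0 ≤ c3 := by positivity
  refine ⟨3 * p + c1 + c3, by positivity,
    fun B S βv e hcard hb δ h hδ hh a s z => ?_⟩
  have he := hb.he
  have hmain := Lop_QQr B S (c0 := δ ^ 2) (by positivity) zero_le_one le_rfl a (r := p / 2)
    (by linarith) s z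
  have hQ := QQ_pos (c0 := δ ^ 2) (by positivity) zero_le_one le_rfl a z
  set Q := QQ (δ ^ 2) 1 0 a z with hQd
  set q := Q ^ (1 / 2 : ℝ) with hq
  have q0 : 0 < q := by positivity
  have hQe : Q = δ ^ 2 + ‖z.1 - a‖ ^ 2 := by rw [hQd, QQ]; simp
  have q2 : q ^ 2 = Q := by rw [hq, ← Real.sqrt_eq_rpow, Real.sq_sqrt hQ.le]
  have n1 := norm_nonneg z.1
  have n2 := norm_nonneg z.2
  have n3 := norm_nonneg (z.1 - a)
  have xq : ‖z.1 - a‖ ≤ q := abs_le_of_sq_le_sq' (by nlinarith) q0.le |>.2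
  have dq : δ ≤ q := abs_le_of_sq_le_sq' (by nlinarith) q0.le |>.2
  have k1 : Q ^ (p / 2) = q ^ p := by
    rw [hq, ← Real.rpow_mul hQ.le]; congr 1; ring
  have k2 : Q ^ (p / 2 - 1) = q ^ (p - 2) := by
    rw [hq, ← Real.rpow_mul hQ.le]; congr 1; ring
  have k3 : q ^ (p - 2) * q = q ^ (p - 1) := by
    rw [← Real.rpow_add_one q0.ne']; congr 1; ring
  have k4 : q ^ (p - 1) * q = q ^ p := by
    rw [← Real.rpow_add_one q0.ne']; congr 1; ring
  rw [k2] at hmain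
  rw [k1]
  have hQY : QQ 1 0 1 (0 : H1) z = 1 + ‖z.2‖ ^ 2 := by rw [QQ]; simp
  have hY := one_add_rpow n2 hp
  unfold Rem
  rw [hQY]
  have w0 : 0 ≤ (1 + ‖z.2‖ ^ 2) ^ (p / 2) := by positivity
  set w := (1 + ‖z.2‖ ^ 2) ^ (p / 2) with hw
  have j3 : ∑ k, (1 * ‖(S k s z).1‖ ^ 2 + 0 * ‖(S k s z).2‖ ^ 2) ≤
      dd * L ^ 2 * (1 + ‖z.2‖) ^ 2 := by
    have : ∀ k ∈ Finset.univ, 1 * ‖(S k s z).1‖ ^ 2 + 0 * ‖(S k s z).2‖ ^ 2 ≤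
        L ^ 2 * (1 + ‖z.2‖) ^ 2 := by
      intro k _
      have c2 := hb.s1 k s z
      calc _ = ‖(S k s z).1‖ ^ 2 := by ring
        _ ≤ (L * (1 + ‖z.2‖)) ^ 2 := by gcongr
        _ = _ := by ring
    refine (Finset.sum_le_card_nsmul _ _ _ this).trans ?_
    rw [nsmul_eq_mul, Finset.card_univ]
    calc (Fintype.card ι : ℝ) * (L ^ 2 * (1 + ‖z.2‖) ^ 2) ≤
        dd * (L ^ 2 * (1 + ‖z.2‖) ^ 2) := by gcongr
      _ = _ := by ring
  have i1 := hb.in1 a s z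
  set Sg := ∑ k, (1 * ‖(S k s z).1‖ ^ 2 + 0 * ‖(S k s z).2‖ ^ 2) with hSg
  have y1 := young1 (p := p) (h := h) (q := q) (A := L * ‖z.1‖) (by linarith) hh q0 (by positivity)
  have y2 := young1 (p := p) (h := h) (q := q) (A := 2 * e * L * (1 + ‖z.2‖)) (by linarith) hh q0
    (by positivity)
  have y3 := young1 (p := p) (h := h) (q := q) (A := ‖βv s‖) (by linarith) hh q0 (by positivity)
  have y4 := young2 (p := p) (h := h) (q := q) (s := 1 + ‖z.2‖) hp hh q0 (by positivity)
  have r1 : (L * ‖z.1‖) ^ p = L ^ p * ‖z.1‖ ^ p := Real.mul_rpow (by linarith) n1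
  have r2 : (2 * e * L * (1 + ‖z.2‖)) ^ p ≤ (2 * L) ^ p * 2 ^ p * (e ^ p * w) := by
    have : 2 * e * L * (1 + ‖z.2‖) = (2 * L) * (e * (1 + ‖z.2‖)) := by ring
    rw [this, Real.mul_rpow (by positivity) (by positivity),
      Real.mul_rpow (x := e) (y := 1 + ‖z.2‖) (by positivity) (by positivity)]
    calc (2 * L) ^ p * (e ^ p * (1 + ‖z.2‖) ^ p) ≤ (2 * L) ^ p * (e ^ p * (2 ^ p * w)) := by gcongr
      _ = _ := by ring
  have qp : 0 < q ^ p := by positivity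
  have hqd : 0 ≤ q ^ p / h := by positivity
  have hh1 : 0 < h ^ (p - 1) := by positivity
  have hh2 : 0 < h ^ (p / 2 - 1) := by positivity
  have ep : 0 < e ^ p := by positivity
  have xp : 0 ≤ ‖z.1‖ ^ p := by positivity
  have base : Lop B S (fun z => QQ (δ ^ 2) 1 0 a z ^ (p / 2)) s z ≤
      p * (q ^ (p - 1) * ‖βv s‖) + ((2 * p + c1) * (q ^ p / h) +
        c3 * (h ^ (p - 1) * (‖z.1‖ ^ p + e ^ p * w) + h ^ (p / 2 - 1) * w)) := by
    refine hmain.trans ?_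
    calc p / 2 * q ^ (p - 2) * (2 * 1 * ⟪z.1 - a, (B s z).1⟫ + 2 * 0 * ⟪z.2, (B s z).2⟫) +
          p / 2 * (1 + 2 * |p / 2 - 1|) * q ^ (p - 2) * Sg
        = p * q ^ (p - 2) * ⟪z.1 - a, (B s z).1⟫ +
          p / 2 * (1 + 2 * |p / 2 - 1|) * q ^ (p - 2) * Sg := by ring
      _ ≤ p * q ^ (p - 2) * (q * (‖βv s‖ + L * ‖z.1‖ + 2 * e * L * (1 + ‖z.2‖))) +
          p / 2 * (1 + 2 * |p / 2 - 1|) * q ^ (p - 2) * (dd * L ^ 2 * (1 + ‖z.2‖) ^ 2) := by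
          gcongr
          exact i1.trans (by gcongr)
      _ = p * (q ^ (p - 1) * ‖βv s‖) + (p * (q ^ (p - 1) * (L * ‖z.1‖)) +
          p * (q ^ (p - 1) * (2 * e * L * (1 + ‖z.2‖))) +
          c1 * (q ^ (p - 2) * (1 + ‖z.2‖) ^ 2)) := by
          rw [← k3, hc1]; ring
      _ ≤ p * (q ^ (p - 1) * ‖βv s‖) + (p * (q ^ p / h + h ^ (p - 1) * (L ^ p * ‖z.1‖ ^ p)) +
          p * (q ^ p / h + h ^ (p - 1) * ((2 * L) ^ p * 2 ^ p * (e ^ p * w))) +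
          c1 * (q ^ p / h + h ^ (p / 2 - 1) * (2 ^ p * w))) := by
          rw [← r1]
          gcongr
          · exact y2.trans (by gcongr)
          · exact y4.trans (by gcongr)
      _ = p * (q ^ (p - 1) * ‖βv s‖) + ((2 * p + c1) * (q ^ p / h) +
          (p * L ^ p * (h ^ (p - 1) * ‖z.1‖ ^ p) +
            p * ((2 * L) ^ p * 2 ^ p) * (h ^ (p - 1) * (e ^ p * w)) +
            c1 * 2 ^ p * (h ^ (p / 2 - 1) * w))) := by ring
      _ ≤ _ := by
          have A1 : 0 ≤ h ^ (p - 1) * ‖z.1‖ ^ p := by positivity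
          have A2 : 0 ≤ h ^ (p - 1) * (e ^ p * w) := by positivity
          have A3 : 0 ≤ h ^ (p / 2 - 1) * w := by positivity
          have B1 : 0 ≤ p * L ^ p := by positivity
          have B2 : 0 ≤ p * ((2 * L) ^ p * 2 ^ p) := by positivity
          have B3 : 0 ≤ c1 * 2 ^ p := by positivity
          have D1 : p * L ^ p * (h ^ (p - 1) * ‖z.1‖ ^ p) ≤ c3 * (h ^ (p - 1) * ‖z.1‖ ^ p) := by
            gcongr; linarith
          have D2 : p * ((2 * L) ^ p * 2 ^ p) * (h ^ (p - 1) * (e ^ p * w)) ≤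
              c3 * (h ^ (p - 1) * (e ^ p * w)) := by gcongr; linarith
          have D3 : c1 * 2 ^ p * (h ^ (p / 2 - 1) * w) ≤ c3 * (h ^ (p / 2 - 1) * w) := by
            gcongr; linarith
          have : c3 * (h ^ (p - 1) * (‖z.1‖ ^ p + e ^ p * w) + h ^ (p / 2 - 1) * w) =
            c3 * (h ^ (p - 1) * ‖z.1‖ ^ p) + c3 * (h ^ (p - 1) * (e ^ p * w)) +
              c3 * (h ^ (p / 2 - 1) * w) := by ring
          linarith
  set R := h ^ (p - 1) * (‖z.1‖ ^ p + e ^ p * w) + h ^ (p / 2 - 1) * w with hR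
  have R0 : 0 ≤ R := by positivity
  have e1 : (3 * p + c1 + c3) / h * q ^ p = (3 * p + c1 + c3) * (q ^ p / h) := by ring
  have f1 : c3 * R ≤ (3 * p + c1 + c3) * R := by gcongr; linarith
  refine ⟨fun hd1 => ?_, ?_⟩
  · have q1 : 1 ≤ q := hd1.trans dq
    have f2 : p * (q ^ (p - 1) * ‖βv s‖) ≤ p * ‖βv s‖ * q ^ p := by
      rw [← k4]
      have : 0 ≤ p * ‖βv s‖ * q ^ (p - 1) := by positivity
      nlinarith
    have f3 : (2 * p + c1) * (q ^ p / h) ≤ (3 * p + c1 + c3) * (q ^ p / h) :=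
      mul_le_mul_of_nonneg_right (by linarith) hqd
    rw [add_mul, e1]
    linarith
  · have f2 : p * (q ^ (p - 1) * ‖βv s‖) ≤ p * (q ^ p / h) + p * (h ^ (p - 1) * ‖βv s‖ ^ p) := by
      rw [← mul_add]; exact mul_le_mul_of_nonneg_left y3 p0.le
    have f4 : p * (h ^ (p - 1) * ‖βv s‖ ^ p) ≤
      (3 * p + c1 + c3) * (h ^ (p - 1) * ‖βv s‖ ^ p) := by gcongr; linarith
    have f3 : (3 * p + c1) * (q ^ p / h) ≤ (3 * p + c1 + c3) * (q ^ p / h) :=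
      mul_le_mul_of_nonneg_right (by linarith) hqd
    rw [e1, mul_add]
    linarith

end Gen2


section Steps

section general
variable {E ι : Type*} [NormedAddCommGroup E] [NormedSpace ℝ E] [FiniteDimensional ℝ E]
  [MeasurableSpace E] [BorelSpace E] [SecondCountableTopology E]
  [Fintype ι] {Ω : Type} [mΩ : MeasurableSpace Ω] {P : Measure Ω} [IsProbabilityMeasure P]
  {ℱ : Filtration ℝ mΩ}
  {Z : ℝ → Ω → E} {B : ℝ → E → E} {S : ι → ℝ → E → E} {β : ℝ → ℝ} {Λ : ℝ}

lemma MP.measV (h : MP P ℱ Z B S β Λ) {V : E → ℝ} (hV : Continuous V) :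
    Measurable (fun q : ℝ × Ω => V (Z q.1 q.2)) := hV.measurable.comp h.measJ

lemma MP.measInt (h : MP P ℱ Z B S β Λ) {V : E → ℝ} (hV : Continuous V) :
    Measurable (fun r => ∫ ω, V (Z r ω) ∂P) :=
  ((h.measV hV).stronglyMeasurable.integral_prod_right).measurable

lemma MP.intp_of_bdd (h : MP P ℱ Z B S β Λ) {V : E → ℝ} (hV : Continuous V) (V0 : ∀ z, 0 ≤ V z)
    {a b M : ℝ} (hi : ∀ r ∈ Set.Ioc a b, Integrable (fun ω => V (Z r ω)) P)
    (hM : ∀ r ∈ Set.Ioc a b, ∫ ω, V (Z r ω) ∂P ≤ M) :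
    Integrable (fun q : ℝ × Ω => V (Z q.1 q.2)) ((volume.restrict (Set.Ioc a b)).prod P) := by
  refine (integrable_prod_iff (h.measV hV).aestronglyMeasurable).2 ⟨?_, ?_⟩
  · exact (ae_restrict_iff' measurableSet_Ioc).2 (Eventually.of_forall hi)
  · have e : (fun r => ∫ ω, ‖V (Z r ω)‖ ∂P) = fun r => ∫ ω, V (Z r ω) ∂P := by
      funext r; congr 1; funext ω; exact Real.norm_of_nonneg (V0 _)
    simp only [e]
    refine integrableOn_of_bdd (Mb := M) (h.measInt hV) fun t ht => ?_
    rw [abs_of_nonneg (integral_nonneg fun _ => V0 _)]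
    exact hM t ht

lemma prod_mono_r {a b c d : ℝ} (h1 : a ≤ c) (h2 : d ≤ b) :
    (volume.restrict (Set.Ioc c d)).prod P ≤ (volume.restrict (Set.Ioc a b)).prod P :=
  Measure.prod_mono (Measure.restrict_mono (Set.Ioc_subset_Ioc h1 h2) le_rfl) le_rfl

end general

variable {H1 H2 ι : Type*} [NormedAddCommGroup H1] [InnerProductSpace ℝ H1] [FiniteDimensional ℝ H1]
  [MeasurableSpace H1] [BorelSpace H1] [SecondCountableTopology H1]
  [NormedAddCommGroup H2] [InnerProductSpace ℝ H2] [FiniteDimensional ℝ H2]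
  [MeasurableSpace H2] [BorelSpace H2] [SecondCountableTopology H2]
  [Fintype ι] {Ω : Type} [mΩ : MeasurableSpace Ω]

/-- Fast Lyapunov function. -/
def WY (p : ℝ) (z : H1 × H2) : ℝ := QQ 1 0 1 (0 : H1) z ^ (p / 2)

/-- Slow Lyapunov function. -/
def VX (p δ : ℝ) (a : H1) (z : H1 × H2) : ℝ := QQ (δ ^ 2) 1 0 a z ^ (p / 2)

/-- Global Lyapunov function. -/
def UU (z : H1 × H2) : ℝ := QQ 1 1 1 (0 : H1) z ^ (1 / 2 : ℝ)

lemma WY_smooth (p : ℝ) : ContDiff ℝ 2 (WY p : H1 × H2 → ℝ) :=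
  QQr_smooth one_pos le_rfl zero_le_one 0 _

lemma VX_smooth (p : ℝ) {δ : ℝ} (hδ : 0 < δ) (a : H1) : ContDiff ℝ 2 (VX p δ a : H1 × H2 → ℝ) :=
  QQr_smooth (by positivity) zero_le_one le_rfl a _

lemma UU_smooth : ContDiff ℝ 2 (UU : H1 × H2 → ℝ) :=
  QQr_smooth one_pos zero_le_one zero_le_one 0 _

lemma WY_nonneg (p : ℝ) (z : H1 × H2) : 0 ≤ WY p z :=
  Real.rpow_nonneg (QQ_pos one_pos le_rfl zero_le_one 0 z).le _

lemma VX_nonneg (p : ℝ) {δ : ℝ} (hδ : 0 < δ) (a : H1) (z : H1 × H2) : 0 ≤ VX p δ a z :=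
  Real.rpow_nonneg (QQ_pos (by positivity) zero_le_one le_rfl a z).le _

lemma WY_eq (p : ℝ) (z : H1 × H2) : WY p z = (1 + ‖z.2‖ ^ 2) ^ (p / 2) := by
  simp [WY, QQ]

lemma VX_eq (p δ : ℝ) (a : H1) (z : H1 × H2) : VX p δ a z = (δ ^ 2 + ‖z.1 - a‖ ^ 2) ^ (p / 2) := by
  simp [VX, QQ]

lemma norm_rpow_le {p x c : ℝ} (hp : 0 ≤ p) (hx : 0 ≤ x) (hc : 0 ≤ c) :
    x ^ p ≤ (c + x ^ 2) ^ (p / 2) := by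
  calc x ^ p = (x ^ 2) ^ (p / 2) := by
        rw [← Real.rpow_natCast, ← Real.rpow_mul hx]; congr 1; push_cast; ring
    _ ≤ _ := by gcongr; linarith

lemma UU_le (z : H1 × H2) : ‖z‖ ≤ UU z := by
  have e : UU z = Real.sqrt (1 + (‖z.1‖ ^ 2 + ‖z.2‖ ^ 2)) := by
    rw [UU, Real.sqrt_eq_rpow]; simp [QQ]
  rw [e]
  refine Real.le_sqrt_of_sq_le ?_
  rcases max_choice ‖z.1‖ ‖z.2‖ with h | h <;> rw [Prod.norm_def, h] <;> nlinarith [sq_nonneg ‖z.1‖, sq_nonneg ‖z.2‖]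

lemma UU_le' {p : ℝ} (hp : 2 ≤ p) (z : H1 × H2) : UU z ≤ VX p 1 0 z + WY p z := by
  rw [VX_eq, WY_eq]
  have e : UU z = (1 + (‖z.1‖ ^ 2 + ‖z.2‖ ^ 2)) ^ (1 / 2 : ℝ) := by
    rw [UU]; simp [QQ]
  have h1 : (1 + (‖z.1‖ ^ 2 + ‖z.2‖ ^ 2)) ^ (1 / 2 : ℝ) ≤ 1 + (‖z.1‖ ^ 2 + ‖z.2‖ ^ 2) := by
    conv_rhs => rw [← Real.rpow_one (1 + (‖z.1‖ ^ 2 + ‖z.2‖ ^ 2))]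
    exact Real.rpow_le_rpow_of_exponent_le (by nlinarith [sq_nonneg ‖z.1‖, sq_nonneg ‖z.2‖])
      (by norm_num)
  have h2 : ∀ x : ℝ, 0 ≤ x → 1 + x ≤ (1 + x) ^ (p / 2) := by
    intro x hx
    conv_lhs => rw [← Real.rpow_one (1 + x)]
    exact Real.rpow_le_rpow_of_exponent_le (by linarith) (by linarith)
  have h3 := h2 (‖z.1‖ ^ 2) (by positivity)
  have h4 := h2 (‖z.2‖ ^ 2) (by positivity)
  rw [sub_zero, e, one_pow]
  linarith

/-- Abstract slow-fast system with all generator inequalities. -/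
structure Sys (P : Measure Ω) (ℱ : Filtration ℝ mΩ)
    (Z : ℝ → Ω → H1 × H2) (B : ℝ → H1 × H2 → H1 × H2) (S : ι → ℝ → H1 × H2 → H1 × H2)
    (βv : ℝ → H1) (Λ CU p L c lam D e : ℝ) : Prop where
  mp : MP P ℱ Z B S (fun s => ‖βv s‖) Λ
  mβ : Measurable βv
  hp : 2 ≤ p
  hL : 1 ≤ L
  hc : 0 < c
  hlam : 0 < lam
  hD : 0 ≤ D
  he : 1 ≤ e
  hCU : 0 ≤ CU
  genU : ∀ s z, Lop B S UU s z ≤ CU * UU z + ‖βv s‖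
  genY : ∀ s z, Lop B S (WY p) s z ≤ e ^ 2 * (-lam * WY p z + D) + c * WY p z
  genXa : ∀ s z, Lop B S (VX p 1 0) s z ≤
    (c + p * ‖βv s‖) * VX p 1 0 z + c * Rem p e 1 z
  genXb : ∀ δ h, 0 < δ → 0 < h → ∀ (a : H1) s z, Lop B S (VX p δ a) s z ≤
    (c / h) * VX p δ a z + c * (Rem p e h z + h ^ (p - 1) * ‖βv s‖ ^ p)
  m2 : ∀ s, 0 ≤ s → Integrable (fun ω => ‖(Z s ω).1‖ ^ 2) P
  hβ : ∀ s, 0 ≤ s → ‖βv s‖ ≤ L * (1 + Real.sqrt (∫ ω, ‖(Z s ω).1‖ ^ 2 ∂P))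
  d1 : ∃ cB : ℝ, ∀ s z, ‖(B s z).1 - βv s‖ ≤ cB * (1 + ‖z‖)
  ix : Integrable (fun ω => VX p 1 0 (Z 0 ω)) P
  iy : Integrable (fun ω => WY p (Z 0 ω)) P

variable {P : Measure Ω} [IsProbabilityMeasure P] {ℱ : Filtration ℝ mΩ}
  {Z : ℝ → Ω → H1 × H2} {B : ℝ → H1 × H2 → H1 × H2} {S : ι → ℝ → H1 × H2 → H1 × H2}
  {βv : ℝ → H1} {Λ CU p L c lam D e : ℝ}

lemma Sys.uc (h : Sys P ℱ Z B S βv Λ CU p L c lam D e) {T1 : ℝ}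
    (hβ : IntegrableOn (fun s => ‖βv s‖) (Set.Ioc 0 T1)) :
    UC P Z B S (fun s => ‖βv s‖) UU CU T1 := by
  have U0 : ∀ z : H1 × H2, 0 ≤ UU z := fun z => (norm_nonneg z).trans (UU_le z)
  have i0 : Integrable (fun ω => UU (Z 0 ω)) P := by
    refine (h.ix.add h.iy).mono'
      ((UU_smooth.continuous.measurable.comp (h.mp.measZ' 0)).aestronglyMeasurable)
      (Eventually.of_forall fun ω => ?_)
    rw [Real.norm_of_nonneg (U0 _)]
    exact UU_le' h.hp _
  have hCU := h.hCU
  have key : ∀ r ∈ Set.Icc 0 T1, Integrable (fun ω => UU (Z r ω)) P ∧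
      ∫ ω, UU (Z r ω) ∂P ≤ 2 * (∫ ω, UU (Z 0 ω) ∂P + ∫ s in Set.Ioc 0 T1, ‖βv s‖) *
        Real.exp (4 * (CU + 1) * T1) := by
    intro r hr
    have hβr : IntegrableOn (fun s => ‖βv s‖) (Set.Ioc 0 r) :=
      hβ.mono_set (Set.Ioc_subset_Ioc le_rfl hr.2)
    have := h.mp.lemA (V := UU) UU_smooth U0 one_pos (by simpa using UU_le) (s := 0) (t := r)
      le_rfl hr.1 hβr (A := Set.univ) MeasurableSet.univ (N := CU + 1)
      (κ2 := fun _ => 0) (by linarith) measurable_const (fun _ => le_rfl) (by simp) (by simp)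
      (F := fun q => ‖βv q.1‖) (fun q => norm_nonneg _)
      (by rw [Measure.restrict_univ]; exact Integrable.comp_fst hβr P)
      (fun s hs ω => by
        have := h.genU s (Z s ω)
        have := U0 (Z s ω)
        simp only
        linarith)
      (by rw [Measure.restrict_univ]; exact i0)
    rw [Measure.restrict_univ] at this
    refine ⟨this.1, this.2.trans ?_⟩
    have e1 : ∫ q, ‖βv q.1‖ ∂((volume.restrict (Set.Ioc 0 r)).prod P) =
        ∫ s in Set.Ioc 0 r, ‖βv s‖ := by
      rw [integral_fun_fst (μ := volume.restrict (Set.Ioc 0 r)) (ν := P) (fun s => ‖βv s‖)]; simp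
    rw [e1]
    have e2 : ∫ s in Set.Ioc 0 r, ‖βv s‖ ≤ ∫ s in Set.Ioc 0 T1, ‖βv s‖ :=
      setIntegral_mono_set hβ (Eventually.of_forall fun _ => norm_nonneg _)
        (Set.Ioc_subset_Ioc le_rfl hr.2).eventuallyLE
    have e3 : 0 ≤ ∫ ω, UU (Z 0 ω) ∂P := integral_nonneg fun _ => U0 _
    have e4 : 0 ≤ ∫ s in Set.Ioc 0 r, ‖βv s‖ := integral_nonneg fun _ => norm_nonneg _
    have e5 : r - 0 ≤ T1 := by linarith [hr.2]
    gcongr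
  exact ⟨UU_smooth, UU_le, hCU, h.genU, fun r hr => (key r hr).1,
    h.mp.intp_of_bdd UU_smooth.continuous U0 (fun r hr => (key r ⟨hr.1.le, hr.2⟩).1)
      (fun r hr => (key r ⟨hr.1.le, hr.2⟩).2), hβ⟩

lemma Sys.stepY (h : Sys P ℱ Z B S βv Λ CU p L c lam D e) {T1 : ℝ}
    (hβ : IntegrableOn (fun s => ‖βv s‖) (Set.Ioc 0 T1)) :
    ∀ t ∈ Set.Icc 0 T1, Integrable (fun ω => WY p (Z t ω)) P ∧
      ∫ ω, WY p (Z t ω) ∂P ≤ 2 * (∫ ω, WY p (Z 0 ω) ∂P + D / lam) * Real.exp (4 * c * T1) := by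
  have hU := h.uc hβ
  have W0 : ∀ z : H1 × H2, 0 ≤ WY p z := WY_nonneg p
  have hc := h.hc
  have hD := h.hD
  have hlam := h.hlam
  have he := h.he
  have Ws : ContDiff ℝ 2 (WY p : H1 × H2 → ℝ) := WY_smooth p
  have w00 : 0 ≤ ∫ ω, WY p (Z 0 ω) ∂P := integral_nonneg fun _ => W0 _
  have key : ∀ r ∈ Set.Icc 0 T1, Integrable (fun ω => WY p (Z r ω)) P ∧
      ∫ ω, WY p (Z r ω) ∂P ≤ 2 * (∫ ω, WY p (Z 0 ω) ∂P + T1 * (e ^ 2 * D)) *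
        Real.exp (4 * c * T1) := by
    intro r hr
    have := h.mp.lemA' hU (V := WY p) Ws W0 (s := 0) (t := r)
      le_rfl hr.1 hr.2 (A := Set.univ) MeasurableSet.univ (N := c)
      (κ2 := fun _ => 0) hc measurable_const (fun _ => le_rfl) (by simp) (by simp)
      (F := fun q => e ^ 2 * D) (fun q => by positivity)
      (by rw [Measure.restrict_univ]; exact integrable_const _)
      (fun s hs ω => by
        have h1 := h.genY s (Z s ω)
        have h2 : 0 ≤ e ^ 2 * (lam * WY p (Z s ω)) := by
          have := W0 (Z s ω)
          positivity
        linarith)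
      (by rw [Measure.restrict_univ]; exact h.iy)
    rw [Measure.restrict_univ] at this
    refine ⟨this.1, this.2.trans ?_⟩
    have e1 : ∫ q, e ^ 2 * D ∂((volume.restrict (Set.Ioc 0 r)).prod P) = r * (e ^ 2 * D) := by
      rw [integral_const, Measure.real, ← Set.univ_prod_univ, Measure.prod_prod]
      simp [hr.1]
    rw [e1]
    have e5 : r - 0 ≤ T1 := by linarith [hr.2]
    have := hr.1
    have := hr.2
    have T10 : 0 ≤ T1 := hr.1.trans hr.2
    gcongr
  intro t ht
  refine ⟨(key t ht).1, ?_⟩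
  have lt := last_time (u := fun r => ∫ ω, WY p (Z r ω) ∂P) (T' := T1)
    (Mb := 2 * (∫ ω, WY p (Z 0 ω) ∂P + T1 * (e ^ 2 * D)) * Real.exp (4 * c * T1))
    (lam := e ^ 2 * lam) (c := c) (D := e ^ 2 * D) (by positivity) hc (by positivity)
    (fun t ht => integral_nonneg fun _ => W0 _) (fun t ht => (key t ht).2)
    (integrableOn_of_bdd (Mb := 2 * (∫ ω, WY p (Z 0 ω) ∂P + T1 * (e ^ 2 * D)) *
      Real.exp (4 * c * T1)) (h.mp.measInt Ws.continuous) fun t ht => by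
        rw [abs_of_nonneg (integral_nonneg fun _ => W0 _)]; exact (key t ⟨ht.1.le, ht.2⟩).2)
    (fun s t hs hst htT => by
      have Wi := h.mp.intp_of_bdd (a := s) (b := t) Ws.continuous W0
        (fun r hr => (key r ⟨hs.trans hr.1.le, hr.2.trans htT⟩).1)
        (fun r hr => (key r ⟨hs.trans hr.1.le, hr.2.trans htT⟩).2)
      have Gi : Integrable (fun q : ℝ × Ω => (-(e ^ 2 * lam) + c) * WY p (Z q.1 q.2) + e ^ 2 * D)
          ((volume.restrict (Set.Ioc s t)).prod P) := (Wi.const_mul _).add (integrable_const _)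
      have := h.mp.lemB' hU (V := WY p) Ws W0 hs hst htT Gi
        (fun r hr ω => by
          have h1 := h.genY r (Z r ω)
          simp only
          linarith) (key s ⟨hs, hst.trans htT⟩).1 (key t ⟨hs.trans hst, htT⟩).1
      rw [integral_prod _ Gi] at this
      refine this.trans (le_of_eq ?_)
      congr 1
      refine setIntegral_congr_fun measurableSet_Ioc fun r hr => ?_
      simp only
      rw [integral_add (((key r ⟨hs.trans hr.1.le, hr.2.trans htT⟩).1).const_mul _)
        (integrable_const _), integral_const_mul]
      simp) t ht
  refine lt.trans ?_
  have e1 : e ^ 2 * D / (e ^ 2 * lam) = D / lam := by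
    have : e ^ 2 ≠ 0 := by positivity
    field_simp
  rw [e1]
  have := ht.2
  gcongr

end Steps


section Steps2
variable {H1 H2 ι : Type*} [NormedAddCommGroup H1] [InnerProductSpace ℝ H1] [FiniteDimensional ℝ H1]
  [MeasurableSpace H1] [BorelSpace H1] [SecondCountableTopology H1]
  [NormedAddCommGroup H2] [InnerProductSpace ℝ H2] [FiniteDimensional ℝ H2]
  [MeasurableSpace H2] [BorelSpace H2] [SecondCountableTopology H2]
  [Fintype ι] {Ω : Type} [mΩ : MeasurableSpace Ω]
variable {P : Measure Ω} [IsProbabilityMeasure P] {ℱ : Filtration ℝ mΩ}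
  {Z : ℝ → Ω → H1 × H2} {B : ℝ → H1 × H2 → H1 × H2} {S : ι → ℝ → H1 × H2 → H1 × H2}
  {βv : ℝ → H1} {Λ CU p L c lam D e : ℝ}

lemma Rem_one (z : H1 × H2) (hp : 2 ≤ p) : Rem p e 1 z ≤ VX p 1 0 z + (e ^ p + 1) * WY p z := by
  have h1 := norm_rpow_le (p := p) (x := ‖z.1‖) (c := 1) (by linarith) (norm_nonneg _) zero_le_one
  rw [VX_eq, sub_zero, one_pow]
  unfold Rem
  rw [Real.one_rpow, Real.one_rpow]
  have : QQ 1 0 1 (0 : H1) z ^ (p / 2) = WY p z := rfl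
  rw [this]
  linarith

lemma Sys.beta_p (h : Sys P ℱ Z B S βv Λ CU p L c lam D e) {s : ℝ} (hs : 0 ≤ s)
    (hi : Integrable (fun ω => VX p 1 0 (Z s ω)) P) :
    ‖βv s‖ ^ p ≤ (2 * L) ^ p * ∫ ω, VX p 1 0 (Z s ω) ∂P := by
  have hp := h.hp
  have hL := h.hL
  set a := ∫ ω, ‖(Z s ω).1‖ ^ 2 ∂P with ha
  have a0 : 0 ≤ a := integral_nonneg fun _ => by positivity
  have h1 : 1 + Real.sqrt a ≤ 2 * (1 + a) ^ (1 / 2 : ℝ) := by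
    rw [← Real.sqrt_eq_rpow]
    have h1 := Real.sqrt_le_sqrt (show a ≤ 1 + a by linarith)
    have h2 := Real.sqrt_le_sqrt (show 1 ≤ 1 + a by linarith)
    rw [Real.sqrt_one] at h2
    linarith
  have h2 : ‖βv s‖ ≤ 2 * L * (1 + a) ^ (1 / 2 : ℝ) :=
    (h.hβ s hs).trans (by
      calc L * (1 + Real.sqrt a) ≤ L * (2 * (1 + a) ^ (1 / 2 : ℝ)) := by gcongr
        _ = _ := by ring)
  have i1 : Integrable (fun ω => 1 + ‖(Z s ω).1‖ ^ 2) P := (integrable_const _).add (h.m2 s hs)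
  have jens : (∫ ω, (1 + ‖(Z s ω).1‖ ^ 2) ∂P) ^ (p / 2) ≤
      ∫ ω, (1 + ‖(Z s ω).1‖ ^ 2) ^ (p / 2) ∂P := by
    refine (convexOn_rpow (p := p / 2) (by linarith)).map_integral_le
      ((Real.continuous_rpow_const (by linarith : 0 ≤ p / 2)).continuousOn) isClosed_Ici
      (Eventually.of_forall fun ω => ?_) i1 ?_
    · show (0 : ℝ) ≤ _
      positivity
    · refine hi.congr (Eventually.of_forall fun ω => ?_)
      simp [VX_eq]
  have e1 : ∫ ω, (1 + ‖(Z s ω).1‖ ^ 2) ∂P = 1 + a := by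
    rw [integral_add (integrable_const _) (h.m2 s hs)]; simp [ha]
  have e2 : ∫ ω, (1 + ‖(Z s ω).1‖ ^ 2) ^ (p / 2) ∂P = ∫ ω, VX p 1 0 (Z s ω) ∂P := by
    congr 1; funext ω; simp [VX_eq]
  rw [e1, e2] at jens
  calc ‖βv s‖ ^ p ≤ (2 * L * (1 + a) ^ (1 / 2 : ℝ)) ^ p := by gcongr
    _ = (2 * L) ^ p * (1 + a) ^ (p / 2) := by
      rw [Real.mul_rpow (by positivity) (by positivity), ← Real.rpow_mul (by positivity)]
      congr 2; ring
    _ ≤ _ := by gcongr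

lemma Sys.stepX (h : Sys P ℱ Z B S βv Λ CU p L c lam D e) {T1 yb : ℝ} (hyb : 0 ≤ yb)
    (hβ : IntegrableOn (fun s => ‖βv s‖) (Set.Ioc 0 T1))
    (hY : ∀ t ∈ Set.Icc 0 T1, Integrable (fun ω => WY p (Z t ω)) P ∧
      ∫ ω, WY p (Z t ω) ∂P ≤ yb) :
    ∀ t ∈ Set.Icc 0 T1, Integrable (fun ω => VX p 1 0 (Z t ω)) P ∧
      ∫ ω, VX p 1 0 (Z t ω) ∂P ≤ 2 * (∫ ω, VX p 1 0 (Z 0 ω) ∂P + T1 * (c * (e ^ p + 1) * yb)) *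
        Real.exp (4 * (2 * c + c * (2 * L) ^ p) * T1) := by
  have hU := h.uc hβ
  have W0 : ∀ z : H1 × H2, 0 ≤ WY p z := WY_nonneg p
  have V0 : ∀ z : H1 × H2, 0 ≤ VX p 1 0 z := VX_nonneg p one_pos 0
  have Ws : ContDiff ℝ 2 (WY p : H1 × H2 → ℝ) := WY_smooth p
  have Vs : ContDiff ℝ 2 (VX p 1 0 : H1 × H2 → ℝ) := VX_smooth p one_pos 0
  have hc := h.hc
  have he := h.he
  have hp := h.hp
  have hL := h.hL
  have e0 : 0 < e := by linarith
  have ep : 0 ≤ e ^ p := by positivity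
  have v00 : 0 ≤ ∫ ω, VX p 1 0 (Z 0 ω) ∂P := integral_nonneg fun _ => V0 _
  have pβ : IntegrableOn (fun s => p * ‖βv s‖) (Set.Ioc 0 T1) := hβ.const_mul p
  have Wi : Integrable (fun q : ℝ × Ω => WY p (Z q.1 q.2))
      ((volume.restrict (Set.Ioc 0 T1)).prod P) :=
    h.mp.intp_of_bdd Ws.continuous W0 (fun r hr => (hY r ⟨hr.1.le, hr.2⟩).1)
      (fun r hr => (hY r ⟨hr.1.le, hr.2⟩).2)
  obtain ⟨N, κ2, hN, κm, κ0, κi, κ4, hκ⟩ := split_kappa (h.mβ.norm.const_mul p) pβ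
  set F : ℝ × Ω → ℝ := fun q => c * (e ^ p + 1) * WY p (Z q.1 q.2) with hF
  have F0 : ∀ q, 0 ≤ F q := fun q => by
    have := W0 (Z q.1 q.2)
    simp only [hF]; positivity
  have Fi : Integrable F ((volume.restrict (Set.Ioc 0 T1)).prod P) := Wi.const_mul _
  -- first pass
  have key : ∀ r ∈ Set.Icc 0 T1, Integrable (fun ω => VX p 1 0 (Z r ω)) P ∧
      ∫ ω, VX p 1 0 (Z r ω) ∂P ≤ 2 * (∫ ω, VX p 1 0 (Z 0 ω) ∂P +
        ∫ q, F q ∂((volume.restrict (Set.Ioc 0 T1)).prod P)) *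
        Real.exp (4 * (2 * c + N) * T1) := by
    intro r hr
    have hle : (volume.restrict (Set.Ioc 0 r)).prod P ≤ (volume.restrict (Set.Ioc 0 T1)).prod P :=
      prod_mono_r le_rfl hr.2
    have hsub : Set.Ioc 0 r ⊆ Set.Ioc 0 T1 := Set.Ioc_subset_Ioc le_rfl hr.2
    have := h.mp.lemA' hU (V := VX p 1 0) Vs V0 (s := 0) (t := r)
      le_rfl hr.1 hr.2 (A := Set.univ) MeasurableSet.univ (N := 2 * c + N)
      (κ2 := κ2) (by positivity) κm κ0 (κi.mono_set hsub)
      ((setIntegral_mono_set κi (Eventually.of_forall κ0) hsub.eventuallyLE).trans κ4)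
      (F := F) F0 (by rw [Measure.restrict_univ]; exact Fi.mono_measure hle)
      (fun s hs ω => by
        have h1 := h.genXa s (Z s ω)
        have h2 := Rem_one (e := e) (Z s ω) hp
        have h3 := V0 (Z s ω)
        have h4 := hκ s
        have h5 : c * Rem p e 1 (Z s ω) ≤ c * (VX p 1 0 (Z s ω) + (e ^ p + 1) * WY p (Z s ω)) := by
          gcongr
        have h6 : (c + p * ‖βv s‖) * VX p 1 0 (Z s ω) ≤
            (c + (N + κ2 s)) * VX p 1 0 (Z s ω) := by gcongr
        simp only [hF]
        linarith)
      (by rw [Measure.restrict_univ]; exact h.ix)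
    rw [Measure.restrict_univ] at this
    refine ⟨this.1, this.2.trans ?_⟩
    have e1 : ∫ q, F q ∂((volume.restrict (Set.Ioc 0 r)).prod P) ≤
        ∫ q, F q ∂((volume.restrict (Set.Ioc 0 T1)).prod P) :=
      integral_mono_measure hle (Eventually.of_forall F0) Fi
    have e2 : 0 ≤ ∫ q, F q ∂((volume.restrict (Set.Ioc 0 r)).prod P) := integral_nonneg F0
    have e2' : 0 ≤ ∫ q, F q ∂((volume.restrict (Set.Ioc 0 T1)).prod P) := integral_nonneg F0
    have e5 : r - 0 ≤ T1 := by linarith [hr.2]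
    gcongr
  set Mb := 2 * (∫ ω, VX p 1 0 (Z 0 ω) ∂P +
        ∫ q, F q ∂((volume.restrict (Set.Ioc 0 T1)).prod P)) *
        Real.exp (4 * (2 * c + N) * T1) with hMb
  intro t ht
  refine ⟨(key t ht).1, ?_⟩
  have T10 : 0 ≤ T1 := ht.1.trans ht.2
  have L2 : 0 ≤ (2 * L) ^ p := by positivity
  have g := gron (a := 0) (b := T1) (N := 2 * c + c * (2 * L) ^ p)
    (A0 := ∫ ω, VX p 1 0 (Z 0 ω) ∂P + T1 * (c * (e ^ p + 1) * yb)) (Mb := Mb)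
    (v := fun r => ∫ ω, VX p 1 0 (Z r ω) ∂P) (κ2 := fun _ => 0) (by positivity) (by positivity)
    (fun r _ => integral_nonneg fun _ => V0 _) (fun r hr => (key r hr).2) (fun _ => le_rfl)
    (by simp) (by simp) (fun r hr => by
      have hsub : Set.Ioc 0 r ⊆ Set.Ioc 0 T1 := Set.Ioc_subset_Ioc le_rfl hr.2
      have hle : (volume.restrict (Set.Ioc 0 r)).prod P ≤
        (volume.restrict (Set.Ioc 0 T1)).prod P := prod_mono_r le_rfl hr.2
      have Vi : Integrable (fun q : ℝ × Ω => VX p 1 0 (Z q.1 q.2))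
          ((volume.restrict (Set.Ioc 0 r)).prod P) :=
        h.mp.intp_of_bdd (M := Mb) Vs.continuous V0
          (fun r' hr' => (key r' ⟨hr'.1.le, (hsub hr').2⟩).1)
          (fun r' hr' => (key r' ⟨hr'.1.le, (hsub hr').2⟩).2)
      have ui : IntegrableOn (fun r => ∫ ω, VX p 1 0 (Z r ω) ∂P) (Set.Ioc 0 r) :=
        integrableOn_of_bdd (Mb := Mb) (h.mp.measInt Vs.continuous) fun t ht => by
          rw [abs_of_nonneg (integral_nonneg fun _ => V0 _)]
          exact (key t ⟨ht.1.le, (hsub ht).2⟩).2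
      have Gi : Integrable (fun q : ℝ × Ω => 2 * c * VX p 1 0 (Z q.1 q.2) + F q +
          c * (2 * L) ^ p * ∫ ω, VX p 1 0 (Z q.1 ω) ∂P)
          ((volume.restrict (Set.Ioc 0 r)).prod P) :=
        ((Vi.const_mul _).add (Fi.mono_measure hle)).add
          (Integrable.comp_fst (ui.const_mul (c * (2 * L) ^ p)) P)
      have B' := h.mp.lemB' hU (V := VX p 1 0) Vs V0 le_rfl hr.1 hr.2 Gi
        (fun r' hr' ω => by
          have h1 := h.genXb 1 1 one_pos one_pos 0 r' (Z r' ω)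
          have h2 := Rem_one (e := e) (Z r' ω) hp
          have h4 := h.beta_p hr'.1.le (key r' ⟨hr'.1.le, (hsub hr').2⟩).1
          have h5 : c * (Rem p e 1 (Z r' ω) + 1 ^ (p - 1) * ‖βv r'‖ ^ p) ≤
              c * ((VX p 1 0 (Z r' ω) + (e ^ p + 1) * WY p (Z r' ω)) + 
                1 ^ (p - 1) * ((2 * L) ^ p * ∫ ω, VX p 1 0 (Z r' ω) ∂P)) := by
            gcongr
          rw [Real.one_rpow] at h5 h1
          simp only [hF]
          rw [div_one] at h1
          linarith) h.ix (key r hr).1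
      refine B'.trans ?_
      rw [integral_prod _ Gi]
      have e1 : ∀ r' ∈ Set.Ioc 0 r, ∫ ω, (2 * c * VX p 1 0 (Z r' ω) + F (r', ω) +
          c * (2 * L) ^ p * ∫ ω, VX p 1 0 (Z r' ω) ∂P) ∂P ≤ 
          (2 * c + c * (2 * L) ^ p + 0) * ∫ ω, VX p 1 0 (Z r' ω) ∂P +
            (c * (e ^ p + 1) * yb) := by
        intro r' hr'
        have k1 := (key r' ⟨hr'.1.le, (hsub hr').2⟩).1
        have k2 := hY r' ⟨hr'.1.le, (hsub hr').2⟩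
        have k3 : Integrable (fun ω => 2 * c * VX p 1 0 (Z r' ω) +
            c * (e ^ p + 1) * WY p (Z r' ω)) P := (k1.const_mul _).add (k2.1.const_mul _)
        simp only [hF]
        rw [integral_add k3 (integrable_const _),
          integral_add (k1.const_mul _) (k2.1.const_mul _), integral_const_mul,
          integral_const_mul, integral_const]
        simp only [probReal_univ, one_smul]
        have : c * (e ^ p + 1) * ∫ ω, WY p (Z r' ω) ∂P ≤ c * (e ^ p + 1) * yb := by
          have := k2.2
          gcongr
        linarith
      have i1 : IntegrableOn (fun r' => (2 * c + c * (2 * L) ^ p + 0) * 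
          ∫ ω, VX p 1 0 (Z r' ω) ∂P) (Set.Ioc 0 r) := ui.const_mul _
      have e2 := setIntegral_mono_on (μ := volume) (s := Set.Ioc 0 r)
        (f := fun r' => ∫ ω, (2 * c * VX p 1 0 (Z r' ω) + F (r', ω) +
          c * (2 * L) ^ p * ∫ ω, VX p 1 0 (Z r' ω) ∂P) ∂P)
        (g := fun r' => (2 * c + c * (2 * L) ^ p + 0) * ∫ ω, VX p 1 0 (Z r' ω) ∂P +
            (c * (e ^ p + 1) * yb)) Gi.integral_prod_left (i1.add (integrable_const _))
            measurableSet_Ioc e1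
      rw [integral_add i1 (integrable_const _)] at e2
      have e3 : ∫ _ in Set.Ioc 0 r, c * (e ^ p + 1) * yb ≤ T1 * (c * (e ^ p + 1) * yb) := by
        rw [setIntegral_const]
        simp only [Measure.real, Real.volume_Ioc, sub_zero, smul_eq_mul]
        rw [ENNReal.toReal_ofReal hr.1]
        have := hr.2
        gcongr
      linarith) t ht
  refine g.trans ?_
  have := ht.2
  rw [sub_zero]
  gcongr

end Steps2


section Steps2
variable {H1 H2 ι : Type*} [NormedAddCommGroup H1] [InnerProductSpace ℝ H1] [FiniteDimensional ℝ H1]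
  [MeasurableSpace H1] [BorelSpace H1] [SecondCountableTopology H1]
  [NormedAddCommGroup H2] [InnerProductSpace ℝ H2] [FiniteDimensional ℝ H2]
  [MeasurableSpace H2] [BorelSpace H2] [SecondCountableTopology H2]
  [Fintype ι] {Ω : Type} [mΩ : MeasurableSpace Ω]
variable {P : Measure Ω} [IsProbabilityMeasure P] {ℱ : Filtration ℝ mΩ}
  {Z : ℝ → Ω → H1 × H2} {B : ℝ → H1 × H2 → H1 × H2} {S : ι → ℝ → H1 × H2 → H1 × H2}
  {βv : ℝ → H1} {Λ CU p L c lam D e : ℝ}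


lemma Sys.local_good (h : Sys P ℱ Z B S βv Λ CU p L c lam D e) {t0 : ℝ} (ht0 : 0 ≤ t0)
    (hbad : ∀ t, t0 < t → ¬ IntegrableOn (fun s => ‖βv s‖) (Set.Ioc t0 t)) : False := by
  set v := stdOrthonormalBasis ℝ H1 with hv
  set a := ∫ ω, ‖(Z t0 ω).1‖ ^ 2 ∂P with ha
  have ev : ∀ w : H1, (¬ ∀ t, t0 < t → ¬ IntegrableOn (fun s => ⟪w, βv s⟫) (Set.Ioc t0 t)) →
      ∀ᶠ t in 𝓝[>] t0, IntegrableOn (fun s => ⟪w, βv s⟫) (Set.Ioc t0 t) := by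
    intro w hw
    push Not at hw
    obtain ⟨t1, h1, h2⟩ := hw
    filter_upwards [Ioc_mem_nhdsGT h1] with t ht
    exact h2.mono_set (Set.Ioc_subset_Ioc le_rfl ht.2)
  have exbad : ∃ i, ∀ t, t0 < t → ¬ IntegrableOn (fun s => ⟪v i, βv s⟫) (Set.Ioc t0 t) := by
    by_contra hcon
    rw [not_exists] at hcon
    have h1 : ∀ᶠ t in 𝓝[>] t0, ∀ i, IntegrableOn (fun s => ⟪v i, βv s⟫) (Set.Ioc t0 t) :=
      eventually_all.2 fun i => ev _ (hcon i)
    obtain ⟨t, h2, h3⟩ := (h1.and self_mem_nhdsWithin).exists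
    refine hbad t h3 ?_
    have h4 : IntegrableOn (fun s => ∑ i, ⟪v i, βv s⟫ • v i) (Set.Ioc t0 t) :=
      integrable_finset_sum _ fun i _ => (h2 i).smul_const _
    have h5 : (fun s => ∑ i, ⟪v i, βv s⟫ • v i) = βv := by
      funext s; exact v.sum_repr' (βv s)
    rw [h5] at h4
    exact h4.norm
  obtain ⟨i0, hi0⟩ := exbad
  have path : ∀ w : H1, (∀ t, t0 < t → ¬ IntegrableOn (fun s => ⟪w, βv s⟫) (Set.Ioc t0 t)) →
      ∀ t, t0 < t → Integrable (fun ω => ⟪w, (Z t ω).1⟫ ^ 2) P ∧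
        ∫ ω, ⟪w, (Z t ω).1⟫ ^ 2 ∂P ≤ ‖w‖ ^ 2 * a := by
    intro w hw t ht
    obtain ⟨cB, hcB⟩ := h.d1
    have bnd : ∀ ω, ⟪w, (Z t0 ω).1⟫ ^ 2 ≤ ‖w‖ ^ 2 * ‖(Z t0 ω).1‖ ^ 2 := fun ω => by
      rw [← mul_pow, sq_le_sq, abs_of_nonneg (by positivity : 0 ≤ ‖w‖ * ‖(Z t0 ω).1‖)]
      exact abs_real_inner_le_norm _ _
    have i1 : Integrable (fun ω => ⟪w, (Z t0 ω).1⟫ ^ 2) P := by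
      refine ((h.m2 t0 ht0).const_mul (‖w‖ ^ 2)).mono' ?_ (Eventually.of_forall fun ω => ?_)
      · have : Continuous (fun z : H1 × H2 => ⟪w, z.1⟫ ^ 2) := by fun_prop
        exact (this.measurable.comp (h.mp.measZ' t0)).aestronglyMeasurable
      · rw [Real.norm_of_nonneg (by positivity)]; exact bnd ω
    have := h.mp.path ((innerSL ℝ w).comp (ContinuousLinearMap.fst ℝ H1 H2))
      (bl := fun s => ⟪w, βv s⟫) ⟨‖w‖ * cB, fun s z => by
        have : ((innerSL ℝ w).comp (ContinuousLinearMap.fst ℝ H1 H2)) (B s z) - ⟪w, βv s⟫ =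
            ⟪w, (B s z).1 - βv s⟫ := by
          rw [inner_sub_right]; rfl
        rw [this, mul_assoc]
        exact (abs_real_inner_le_norm _ _).trans
          (mul_le_mul_of_nonneg_left (hcB s z) (norm_nonneg _))⟩ ht0
      (measurable_const.inner h.mβ) hw i1 ht
    refine ⟨this.1, this.2.trans ?_⟩
    rw [ha, ← integral_const_mul]
    exact integral_mono i1 ((h.m2 t0 ht0).const_mul (‖w‖ ^ 2)) bnd
  have a0 : 0 ≤ a := integral_nonneg fun _ => by positivity
  have comp : ∀ i, ∀ t, t0 < t → Integrable (fun ω => ⟪v i, (Z t ω).1⟫ ^ 2) P ∧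
      ∫ ω, ⟪v i, (Z t ω).1⟫ ^ 2 ∂P ≤ 10 * a := by
    intro i t ht
    by_cases hw : ∀ t, t0 < t → ¬ IntegrableOn (fun s => ⟪v i, βv s⟫) (Set.Ioc t0 t)
    · have := path _ hw t ht
      rw [v.orthonormal.1 i] at this
      exact ⟨this.1, by linarith [this.2]⟩
    · have hw2 : ∀ t, t0 < t → ¬ IntegrableOn (fun s => ⟪v i + v i0, βv s⟫) (Set.Ioc t0 t) := by
        by_contra hcon
        obtain ⟨t', ⟨h2, h3⟩, h4⟩ := (((ev _ hw).and (ev _ hcon)).and self_mem_nhdsWithin).exists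
        refine hi0 t' h4 ?_
        have := h3.sub h2
        refine this.congr (Eventually.of_forall fun s => ?_)
        simp [inner_add_left]
      have p1 := path _ hw2 t ht
      have p2 := path _ hi0 t ht
      rw [v.orthonormal.1 i0] at p2
      have n1 : ‖v i + v i0‖ ^ 2 ≤ 4 := by
        have := norm_add_le (v i) (v i0)
        rw [v.orthonormal.1 i0, v.orthonormal.1 i] at this
        nlinarith [norm_nonneg (v i + v i0)]
      have bnd : ∀ ω, ⟪v i, (Z t ω).1⟫ ^ 2 ≤
          2 * ⟪v i + v i0, (Z t ω).1⟫ ^ 2 + 2 * ⟪v i0, (Z t ω).1⟫ ^ 2 := fun ω => by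
        rw [inner_add_left]
        nlinarith [sq_nonneg (⟪v i, (Z t ω).1⟫ + 2 * ⟪v i0, (Z t ω).1⟫)]
      have i2 : Integrable (fun ω => 2 * ⟪v i + v i0, (Z t ω).1⟫ ^ 2 +
          2 * ⟪v i0, (Z t ω).1⟫ ^ 2) P := (p1.1.const_mul 2).add (p2.1.const_mul 2)
      have i1 : Integrable (fun ω => ⟪v i, (Z t ω).1⟫ ^ 2) P := by
        refine i2.mono' ?_ (Eventually.of_forall fun ω => ?_)
        · have : Continuous (fun z : H1 × H2 => ⟪v i, z.1⟫ ^ 2) := by fun_prop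
          exact (this.measurable.comp (h.mp.measZ' t)).aestronglyMeasurable
        · rw [Real.norm_of_nonneg (by positivity)]; exact bnd ω
      refine ⟨i1, (integral_mono i1 i2 bnd).trans ?_⟩
      rw [integral_add (p1.1.const_mul 2) (p2.1.const_mul 2), integral_const_mul,
        integral_const_mul]
      have := mul_le_mul_of_nonneg_right n1 a0
      linarith [p1.2, p2.2]
  refine hbad (t0 + 1) (by linarith) ?_
  set M := (Fintype.card (Fin (Module.finrank ℝ H1)) : ℝ) * (10 * a) with hM
  refine integrableOn_of_bdd (Mb := L * (1 + Real.sqrt M)) h.mβ.norm fun t ht => ?_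
  rw [abs_of_nonneg (norm_nonneg _)]
  refine (h.hβ t (by linarith [ht.1])).trans ?_
  have hL := h.hL
  have : ∫ ω, ‖(Z t ω).1‖ ^ 2 ∂P ≤ M := by
    have e1 : ∀ ω, ‖(Z t ω).1‖ ^ 2 = ∑ i, ⟪v i, (Z t ω).1⟫ ^ 2 := fun ω =>
      (v.sum_sq_inner_right ((Z t ω).1)).symm
    simp only [e1]
    rw [integral_finset_sum _ fun i _ => (comp i t ht.1).1]
    refine (Finset.sum_le_sum fun i _ => (comp i t ht.1).2).trans ?_
    simp [hM]
  gcongr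

lemma le_one_add_rpow {x q : ℝ} (hx : 0 ≤ x) (hq : 1 ≤ q) : x ≤ 1 + x ^ q := by
  rcases le_total x 1 with h | h
  · have := Real.rpow_nonneg hx q; linarith
  · have := Real.rpow_le_rpow_of_exponent_le h hq
    rw [Real.rpow_one] at this; linarith

lemma Sys.betaInt (h : Sys P ℱ Z B S βv Λ CU p L c lam D e) {T : ℝ} (hT : 0 ≤ T) :
    IntegrableOn (fun s => ‖βv s‖) (Set.Ioc 0 T) := by
  have hc := h.hc
  have he := h.he
  have hp := h.hp
  have hL := h.hL
  have hlam := h.hlam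
  have hD := h.hD
  have e0 : 0 < e := by linarith
  have w0 : 0 ≤ ∫ ω, WY p (Z 0 ω) ∂P := integral_nonneg fun _ => WY_nonneg p _
  have v0 : 0 ≤ ∫ ω, VX p 1 0 (Z 0 ω) ∂P := integral_nonneg fun _ => VX_nonneg p one_pos 0 _
  obtain ⟨M, hM⟩ : ∃ M : ℝ, ∀ t ∈ Set.Icc 0 T, IntegrableOn (fun s => ‖βv s‖) (Set.Ioc 0 t) →
      ∀ s ∈ Set.Icc 0 t, ‖βv s‖ ≤ M := by
    set yb := 2 * (∫ ω, WY p (Z 0 ω) ∂P + D / lam) * Real.exp (4 * c * T) with hyb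
    have yb0 : 0 ≤ yb := by positivity
    refine ⟨1 + (2 * L) ^ p * (2 * (∫ ω, VX p 1 0 (Z 0 ω) ∂P + T * (c * (e ^ p + 1) * yb)) *
        Real.exp (4 * (2 * c + c * (2 * L) ^ p) * T)), fun t ht hi s hs => ?_⟩
    have hY := h.stepY hi
    have htT := ht.2
    have ht0 := ht.1
    have hX := h.stepX yb0 hi (fun r hr => ⟨(hY r hr).1, (hY r hr).2.trans (by
      rw [hyb]; gcongr)⟩) s hs
    have hb := h.beta_p hs.1 hX.1
    refine (le_one_add_rpow (norm_nonneg _) (by linarith : 1 ≤ p)).trans ?_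
    have : ∫ ω, VX p 1 0 (Z s ω) ∂P ≤ 2 * (∫ ω, VX p 1 0 (Z 0 ω) ∂P + T * (c * (e ^ p + 1) * yb)) *
        Real.exp (4 * (2 * c + c * (2 * L) ^ p) * T) := by
      refine hX.2.trans ?_
      gcongr
    have := mul_le_mul_of_nonneg_left this (by positivity : 0 ≤ (2 * L) ^ p)
    linarith
  set G := {t | t ∈ Set.Icc 0 T ∧ IntegrableOn (fun s => ‖βv s‖) (Set.Ioc 0 t)} with hG
  have G0 : (0 : ℝ) ∈ G := ⟨⟨le_rfl, hT⟩, by simp⟩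
  have Gb : BddAbove G := ⟨T, fun t ht => ht.1.2⟩
  set t0 := sSup G with ht0
  have t00 : 0 ≤ t0 := le_csSup Gb G0
  have t0T : t0 ≤ T := csSup_le ⟨0, G0⟩ fun t ht => ht.1.2
  have good : IntegrableOn (fun s => ‖βv s‖) (Set.Ioc 0 t0) := by
    refine integrableOn_of_bdd (Mb := max M ‖βv t0‖) h.mβ.norm fun s hs => ?_
    rw [abs_of_nonneg (norm_nonneg _)]
    rcases hs.2.eq_or_lt with h1 | h1
    · rw [h1]; exact le_max_right _ _
    · obtain ⟨t, ht, hst⟩ := exists_lt_of_lt_csSup ⟨0, G0⟩ h1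
      exact (hM t ht.1 ht.2 s ⟨hs.1.le, hst.le⟩).trans (le_max_left _ _)
  rcases t0T.eq_or_lt with h1 | h1
  · rwa [h1] at good
  · exfalso
    refine h.local_good t00 fun t ht hi => ?_
    have hlt : t0 < min t T := lt_min ht h1
    have : min t T ∈ G := by
      refine ⟨⟨t00.trans hlt.le, min_le_right _ _⟩, ?_⟩
      rw [← Set.Ioc_union_Ioc_eq_Ioc t00 hlt.le]
      exact good.union (hi.mono_set (Set.Ioc_subset_Ioc le_rfl (min_le_left _ _)))
    exact absurd (le_csSup Gb this) (not_le.2 hlt)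

/-- Moment bounds on `[0,T]`. -/
lemma Sys.moments (h : Sys P ℱ Z B S βv Λ CU p L c lam D e) {T : ℝ} (hT : 0 ≤ T) {yb : ℝ}
    (hyb : yb = 2 * (∫ ω, WY p (Z 0 ω) ∂P + D / lam) * Real.exp (4 * c * T)) :
    ∀ t ∈ Set.Icc 0 T, (Integrable (fun ω => WY p (Z t ω)) P ∧ ∫ ω, WY p (Z t ω) ∂P ≤ yb) ∧
      Integrable (fun ω => VX p 1 0 (Z t ω)) P ∧
      ∫ ω, VX p 1 0 (Z t ω) ∂P ≤ 2 * (∫ ω, VX p 1 0 (Z 0 ω) ∂P + T * (c * (e ^ p + 1) * yb)) *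
        Real.exp (4 * (2 * c + c * (2 * L) ^ p) * T) := by
  have hb := h.betaInt hT
  have hc := h.hc
  have hlam := h.hlam
  have hD := h.hD
  have w0 : 0 ≤ ∫ ω, WY p (Z 0 ω) ∂P := integral_nonneg fun _ => WY_nonneg p _
  have hY := h.stepY hb
  rw [← hyb] at hY
  have hX := h.stepX (by rw [hyb]; positivity) hb hY
  exact fun t ht => ⟨hY t ht, hX t ht⟩

end Steps2


section Steps2
variable {H1 H2 ι : Type*} [NormedAddCommGroup H1] [InnerProductSpace ℝ H1] [FiniteDimensional ℝ H1]
  [MeasurableSpace H1] [BorelSpace H1] [SecondCountableTopology H1]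
  [NormedAddCommGroup H2] [InnerProductSpace ℝ H2] [FiniteDimensional ℝ H2]
  [MeasurableSpace H2] [BorelSpace H2] [SecondCountableTopology H2]
  [Fintype ι] {Ω : Type} [mΩ : MeasurableSpace Ω]
variable {P : Measure Ω} [IsProbabilityMeasure P] {ℱ : Filtration ℝ mΩ}
  {Z : ℝ → Ω → H1 × H2} {B : ℝ → H1 × H2 → H1 × H2} {S : ι → ℝ → H1 × H2 → H1 × H2}
  {βv : ℝ → H1} {Λ CU p L c lam D e : ℝ}


lemma Rem_le {h : ℝ} (hh : 0 < h) (he : 0 ≤ e) (z : H1 × H2) (hp : 2 ≤ p) :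
    Rem p e h z ≤ h ^ (p - 1) * (VX p 1 0 z + e ^ p * WY p z) + h ^ (p / 2 - 1) * WY p z := by
  have h1 := norm_rpow_le (p := p) (x := ‖z.1‖) (c := 1) (by linarith) (norm_nonneg _) zero_le_one
  rw [VX_eq, sub_zero, one_pow]
  unfold Rem
  have : QQ 1 0 1 (0 : H1) z ^ (p / 2) = WY p z := rfl
  rw [this]
  have := mul_le_mul_of_nonneg_left h1 (Real.rpow_nonneg hh.le (p - 1))
  linarith

lemma Rem_nonneg' {h : ℝ} (hh : 0 < h) (he : 0 ≤ e) (z : H1 × H2) : 0 ≤ Rem p e h z := by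
  unfold Rem
  have : QQ 1 0 1 (0 : H1) z ^ (p / 2) = WY p z := rfl
  rw [this]
  have := WY_nonneg p z
  positivity

lemma Rem_cont {h : ℝ} (hp : 2 ≤ p) : Continuous (Rem p e h : H1 × H2 → ℝ) := by
  have h1 : Continuous (fun z : H1 × H2 => ‖z.1‖ ^ p) :=
    (Real.continuous_rpow_const (by linarith)).comp (by fun_prop)
  have h2 : Continuous (WY p : H1 × H2 → ℝ) := (WY_smooth p).continuous
  have : (Rem p e h : H1 × H2 → ℝ) =
    fun z => h ^ (p - 1) * (‖z.1‖ ^ p + e ^ p * WY p z) + h ^ (p / 2 - 1) * WY p z := rfl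
  rw [this]
  fun_prop

lemma Sys.incr (hS : Sys P ℱ Z B S βv Λ CU p L c lam D e) {T xb yb t h : ℝ}
    (hm : ∀ t ∈ Set.Icc 0 T, (Integrable (fun ω => WY p (Z t ω)) P ∧ ∫ ω, WY p (Z t ω) ∂P ≤ yb) ∧
      Integrable (fun ω => VX p 1 0 (Z t ω)) P ∧ ∫ ω, VX p 1 0 (Z t ω) ∂P ≤ xb)
    (ht : 0 ≤ t) (hh : 0 < h) (htT : t + h ≤ T) :
    ∫ ω, ‖(Z (t + h) ω).1 - (Z t ω).1‖ ^ p ∂P ≤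
      2 ^ p * ((2 * h) ^ (p / 2) * (1 + 2 * Real.exp (4 * c)) + 2 * Real.exp (4 * c) *
        (c * (h ^ p * (xb * (1 + (2 * L) ^ p) + e ^ p * yb) + h ^ (p / 2) * yb))) := by
  have hc := hS.hc
  have he := hS.he
  have hp := hS.hp
  have hL := hS.hL
  have e0 : 0 < e := by linarith
  have W0 : ∀ z : H1 × H2, 0 ≤ WY p z := WY_nonneg p
  have V0 : ∀ z : H1 × H2, 0 ≤ VX p 1 0 z := VX_nonneg p one_pos 0
  have hT : 0 ≤ T := by linarith
  have hU := hS.uc (hS.betaInt hT)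
  have mem : ∀ r ∈ Set.Ioc t (t + h), r ∈ Set.Icc 0 T := fun r hr =>
    ⟨by linarith [hr.1], by linarith [hr.2]⟩
  -- the remainder
  have Ri : ∀ r ∈ Set.Icc 0 T, Integrable (fun ω => Rem p e h (Z r ω)) P ∧
      ∫ ω, Rem p e h (Z r ω) ∂P ≤ h ^ (p - 1) * (xb + e ^ p * yb) + h ^ (p / 2 - 1) * yb := by
    intro r hr
    obtain ⟨⟨y1, y2⟩, x1, x2⟩ := hm r hr
    have i1 : Integrable (fun ω => VX p 1 0 (Z r ω) + e ^ p * WY p (Z r ω)) P :=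
      x1.add (y1.const_mul _)
    have i2 : Integrable (fun ω => h ^ (p - 1) * (VX p 1 0 (Z r ω) + e ^ p * WY p (Z r ω)) +
        h ^ (p / 2 - 1) * WY p (Z r ω)) P := (i1.const_mul _).add (y1.const_mul _)
    have i3 : Integrable (fun ω => Rem p e h (Z r ω)) P := by
      refine i2.mono' ((Rem_cont hp).measurable.comp (hS.mp.measZ' r)).aestronglyMeasurable
        (Eventually.of_forall fun ω => ?_)
      rw [Real.norm_of_nonneg (Rem_nonneg' hh e0.le _)]
      exact Rem_le hh e0.le _ hp
    refine ⟨i3, (integral_mono i3 i2 fun ω => Rem_le hh e0.le _ hp).trans ?_⟩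
    rw [integral_add (i1.const_mul _) (y1.const_mul _), integral_const_mul, integral_const_mul,
      integral_add x1 (y1.const_mul _), integral_const_mul]
    gcongr
  have βb : ∀ r ∈ Set.Icc 0 T, ‖βv r‖ ^ p ≤ (2 * L) ^ p * xb := fun r hr =>
    (hS.beta_p hr.1 (hm r hr).2.1).trans (by
      have := (hm r hr).2.2
      gcongr)
  have βi : IntegrableOn (fun r => h ^ (p - 1) * ‖βv r‖ ^ p) (Set.Ioc t (t + h)) := by
    refine Integrable.const_mul (integrableOn_of_bdd (Mb := (2 * L) ^ p * xb)
      (hS.mβ.norm.pow_const p) fun r hr => ?_) _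
    rw [abs_of_nonneg (by positivity)]
    exact βb r (mem r hr)
  set F : ℝ × Ω → ℝ := fun q => c * (Rem p e h (Z q.1 q.2) + h ^ (p - 1) * ‖βv q.1‖ ^ p) with hF
  have F0 : ∀ q, 0 ≤ F q := fun q => by
    have := Rem_nonneg' (p := p) hh e0.le (Z q.1 q.2)
    simp only [hF]; positivity
  have Fi : Integrable F ((volume.restrict (Set.Ioc t (t + h))).prod P) := by
    refine Integrable.const_mul (Integrable.add ?_ ?_) _
    · exact hS.mp.intp_of_bdd (Rem_cont hp) (Rem_nonneg' hh e0.le)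
        (fun r hr => (Ri r (mem r hr)).1) (fun r hr => (Ri r (mem r hr)).2)
    · exact Integrable.comp_fst βi P
  set Φ : Ω → ℝ := fun ω => ∫ r in Set.Ioc t (t + h), F (r, ω) with hΦ
  have Φi : Integrable Φ P := Fi.integral_prod_right
  have Φint : ∫ ω, Φ ω ∂P ≤
      c * (h ^ p * (xb * (1 + (2 * L) ^ p) + e ^ p * yb) + h ^ (p / 2) * yb) := by
    have e1 : ∫ ω, Φ ω ∂P = ∫ r in Set.Ioc t (t + h), ∫ ω, F (r, ω) ∂P := by
      rw [← integral_prod _ Fi, integral_prod_symm _ Fi]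
    rw [e1]
    set M := c * ((h ^ (p - 1) * (xb + e ^ p * yb) + h ^ (p / 2 - 1) * yb) +
      h ^ (p - 1) * ((2 * L) ^ p * xb)) with hM
    have e2 : ∫ r in Set.Ioc t (t + h), ∫ ω, F (r, ω) ∂P ≤ ∫ r in Set.Ioc t (t + h), M := by
      refine setIntegral_mono_on Fi.integral_prod_left (integrable_const _) measurableSet_Ioc
        fun r hr => ?_
      have r1 := Ri r (mem r hr)
      have r2 := βb r (mem r hr)
      simp only [hF]
      rw [integral_const_mul, integral_add r1.1 (integrable_const _), integral_const]
      simp only [probReal_univ, one_smul]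
      rw [hM]
      have r3 := r1.2
      gcongr
    refine e2.trans (le_of_eq ?_)
    rw [setIntegral_const]
    simp only [Measure.real, Real.volume_Ioc, smul_eq_mul]
    rw [ENNReal.toReal_ofReal (by linarith), hM]
    have k1 : h * h ^ (p - 1) = h ^ p := by
      rw [Real.rpow_sub_one hh.ne']; field_simp
    have k2 : h * h ^ (p / 2 - 1) = h ^ (p / 2) := by
      rw [Real.rpow_sub_one hh.ne']; field_simp
    rw [← k1, ← k2]
    ring
  -- the cells
  set δ := Real.sqrt h with hδ
  have δ0 : 0 < δ := Real.sqrt_pos.2 hh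
  have δ2 : δ ^ 2 = h := Real.sq_sqrt hh.le
  set q := TopologicalSpace.denseSeq H1 with hq
  set Dk : ℕ → Set H1 := disjointed (fun k => Metric.ball (q k) δ) with hDk
  have Dm : ∀ k, MeasurableSet (Dk k) := fun k =>
    MeasurableSet.disjointed (fun k => measurableSet_ball) k
  have Dd : Pairwise (Function.onFun Disjoint Dk) := disjoint_disjointed _
  have Du : ⋃ k, Dk k = Set.univ := by
    rw [hDk, iUnion_disjointed]
    refine Set.eq_univ_of_forall fun x => ?_
    obtain ⟨k, hk⟩ := (TopologicalSpace.denseRange_denseSeq H1).exists_dist_lt x δ0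
    exact Set.mem_iUnion.2 ⟨k, hk⟩
  have Dsub : ∀ k, Dk k ⊆ Metric.ball (q k) δ := fun k => disjointed_subset _ k
  set A : ℕ → Set Ω := fun k => (fun ω => (Z t ω).1) ⁻¹' Dk k with hA
  have Amℱ : ∀ k, MeasurableSet[ℱ t] (A k) := fun k =>
    (measurable_fst.comp (hS.mp.measZ t)) (Dm k)
  have Am : ∀ k, MeasurableSet (A k) := fun k => ℱ.le t _ (Amℱ k)
  have Ad : Pairwise (Function.onFun Disjoint A) := fun i j hij =>
    Disjoint.preimage _ (Dd hij)
  have Au : ⋃ k, A k = Set.univ := by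
    rw [hA, ← Set.preimage_iUnion, Du, Set.preimage_univ]
  set G : Ω → ℝ := fun ω => ‖(Z (t + h) ω).1 - (Z t ω).1‖ ^ p with hG
  have m1 : Measurable (fun ω => (Z (t + h) ω).1) := measurable_fst.comp (hS.mp.measZ' _)
  have m0 : Measurable (fun ω => (Z t ω).1) := measurable_fst.comp (hS.mp.measZ' _)
  have Gm : Measurable G := (m1.sub m0).norm.pow_const p
  have G0 : ∀ ω, 0 ≤ G ω := fun ω => by simp only [hG]; positivity
  have Gle : ∀ (a : H1) (δ' : ℝ), ∀ ω, G ω ≤ 2 ^ p * (VX p δ' a (Z (t + h) ω) +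
      VX p δ' a (Z t ω)) := by
    intro a δ' ω
    have n1 : ‖(Z (t + h) ω).1 - (Z t ω).1‖ ≤ ‖(Z (t + h) ω).1 - a‖ + ‖(Z t ω).1 - a‖ := by
      have := norm_sub_le ((Z (t + h) ω).1 - a) ((Z t ω).1 - a)
      simpa using this
    have n2 := norm_rpow_le (p := p) (x := ‖(Z (t + h) ω).1 - a‖) (c := δ' ^ 2) (by linarith)
      (norm_nonneg _) (sq_nonneg _)
    have n3 := norm_rpow_le (p := p) (x := ‖(Z t ω).1 - a‖) (c := δ' ^ 2) (by linarith)
      (norm_nonneg _) (sq_nonneg _)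
    rw [VX_eq, VX_eq]
    calc G ω ≤ (‖(Z (t + h) ω).1 - a‖ + ‖(Z t ω).1 - a‖) ^ p := by
          simp only [hG]; gcongr
      _ ≤ 2 ^ p * (‖(Z (t + h) ω).1 - a‖ ^ p + ‖(Z t ω).1 - a‖ ^ p) :=
          rpow_add_le2 (norm_nonneg _) (norm_nonneg _) (by linarith)
      _ ≤ _ := by gcongr
  have Gi : Integrable G P := by
    have j1 := (hm (t + h) ⟨by linarith, htT⟩).2.1
    have j2 := (hm t ⟨ht, by linarith⟩).2.1
    refine ((j1.add j2).const_mul (2 ^ p)).mono' Gm.aestronglyMeasurable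
      (Eventually.of_forall fun ω => ?_)
    rw [Real.norm_of_nonneg (G0 ω)]
    exact Gle 0 1 ω
  set Ex := Real.exp (4 * c) with hEx
  have Ex0 : 0 < Ex := Real.exp_pos _
  set hb := (2 * h) ^ (p / 2) with hhb
  have hb0 : 0 ≤ hb := by positivity
  set Ψ : Ω → ℝ := fun ω => 2 ^ p * (hb * (1 + 2 * Ex) + 2 * Ex * Φ ω) with hΨ
  have Ψi : Integrable Ψ P := ((integrable_const _).add (Φi.const_mul _)).const_mul _
  have cell : ∀ k, ∫ ω in A k, G ω ∂P ≤ ∫ ω in A k, Ψ ω ∂P := by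
    intro k
    have Vt : ∀ ω ∈ A k, VX p δ (q k) (Z t ω) ≤ hb := by
      intro ω hω
      have : ‖(Z t ω).1 - q k‖ < δ := by
        have := Dsub k hω
        rwa [Metric.mem_ball, dist_eq_norm] at this
      rw [VX_eq, hhb]
      have := pow_le_pow_left₀ (norm_nonneg _) this.le 2
      rw [δ2] at this ⊢
      exact Real.rpow_le_rpow (by positivity) (by linarith) (by linarith)
    have Vs : ContDiff ℝ 2 (VX p δ (q k) : H1 × H2 → ℝ) := VX_smooth p δ0 _
    have Vn : ∀ z : H1 × H2, 0 ≤ VX p δ (q k) z := VX_nonneg p δ0 _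
    have hVs : Integrable (fun ω => VX p δ (q k) (Z t ω)) (P.restrict (A k)) := by
      refine Measure.integrableOn_of_bounded (M := hb) (measure_ne_top _ _)
        (Vs.continuous.measurable.comp (hS.mp.measZ' t)).aestronglyMeasurable ?_
      filter_upwards [ae_restrict_mem (Am k)] with ω hω
      rw [Real.norm_of_nonneg (Vn _)]
      exact Vt ω hω
    have Fik : Integrable F ((volume.restrict (Set.Ioc t (t + h))).prod (P.restrict (A k))) :=
      Fi.mono_measure (Measure.prod_mono le_rfl Measure.restrict_le_self)
    have L' := hS.mp.lemA' hU (V := VX p δ (q k)) Vs Vn ht (by linarith : t ≤ t + h) htT (Amℱ k)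
      (N := c / h) (κ2 := fun _ => 0) (by positivity) measurable_const (fun _ => le_rfl)
      (by simp) (by simp) (F := F) F0 Fik
      (fun r hr ω => by
        have := hS.genXb δ h δ0 hh (q k) r (Z r ω)
        simp only [hF, add_zero]
        exact this) hVs
    have ex : Real.exp (4 * (c / h) * (t + h - t)) = Ex := by
      rw [hEx]; congr 1; field_simp; ring
    rw [ex] at L'
    have fub : ∫ q, F q ∂((volume.restrict (Set.Ioc t (t + h))).prod (P.restrict (A k))) =
        ∫ ω in A k, Φ ω ∂P := integral_prod_symm _ Fik
    rw [fub] at L'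
    have b1 : ∫ ω in A k, VX p δ (q k) (Z t ω) ∂P ≤ ∫ ω in A k, hb ∂P :=
      setIntegral_mono_on hVs (integrable_const _) (Am k) Vt
    have b2 : ∫ ω in A k, G ω ∂P ≤ ∫ ω in A k, 2 ^ p * (VX p δ (q k) (Z (t + h) ω) +
        VX p δ (q k) (Z t ω)) ∂P :=
      integral_mono Gi.restrict ((L'.1.add hVs).const_mul _) (Gle (q k) δ)
    rw [integral_const_mul, integral_add L'.1 hVs] at b2
    have b3 : ∫ ω in A k, Ψ ω ∂P = 2 ^ p * ((∫ ω in A k, hb ∂P) * (1 + 2 * Ex) +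
        2 * Ex * ∫ ω in A k, Φ ω ∂P) := by
      simp only [hΨ]
      rw [integral_const_mul, integral_add (integrable_const _) (Φi.restrict.const_mul _)]
      simp only [integral_const_mul, integral_const, smul_eq_mul]
      ring
    rw [b3]
    refine b2.trans ?_
    refine mul_le_mul_of_nonneg_left ?_ (by positivity)
    have := mul_le_mul_of_nonneg_right b1 Ex0.le
    linarith [L'.2]
  have s1 := hasSum_integral_iUnion (μ := P) Am Ad (f := G) (by rw [Au]; exact Gi.integrableOn)
  have s2 := hasSum_integral_iUnion (μ := P) Am Ad (f := Ψ) (by rw [Au]; exact Ψi.integrableOn)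
  have tot := hasSum_le cell s1 s2
  rw [Au, setIntegral_univ, setIntegral_univ] at tot
  refine tot.trans ?_
  simp only [hΨ]
  rw [integral_const_mul, integral_add (integrable_const _) (Φi.const_mul _)]
  simp only [integral_const_mul, integral_const, probReal_univ, one_smul]
  gcongr

end Steps2


section Gen
open ContinuousLinearMap

lemma inner_toDual_symm {V : Type*} [NormedAddCommGroup V] [InnerProductSpace ℝ V] [CompleteSpace V]
    (l : V →L[ℝ] ℝ) (w : V) : ⟪w, (InnerProductSpace.toDual ℝ V).symm l⟫ = l w := by
  rw [real_inner_comm, InnerProductSpace.toDual_symm_apply]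

/-- Riesz map as a linear map over the reals. -/
def rieszL (W : Type*) [NormedAddCommGroup W] [InnerProductSpace ℝ W] [CompleteSpace W] :
    (W →L[ℝ] ℝ) →L[ℝ] W where
  toFun := (InnerProductSpace.toDual ℝ W).symm
  map_add' := map_add _
  map_smul' := by intro c l; simp
  cont := (InnerProductSpace.toDual ℝ W).symm.continuous

lemma inner_fderiv_toDual {U W E : Type*} [NormedAddCommGroup U] [NormedSpace ℝ U]
    [NormedAddCommGroup W] [InnerProductSpace ℝ W] [CompleteSpace W]
    [NormedAddCommGroup E] [NormedSpace ℝ E] {φ : E → ℝ} (hφ : ContDiff ℝ 2 φ)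
    {a : U → E} {i : U →L[ℝ] E} (j : W →L[ℝ] E) {x : U} (ha : HasFDerivAt a i x)
    {G : U → W} (hG : ∀ x', G x' = (InnerProductSpace.toDual ℝ W).symm ((fderiv ℝ φ (a x')).comp j))
    (v : U) (w : W) :
    ⟪w, fderiv ℝ G x v⟫ = fderiv ℝ (fderiv ℝ φ) (a x) (i v) (j w) := by
  have h2 : HasFDerivAt (fderiv ℝ φ) (fderiv ℝ (fderiv ℝ φ) (a x)) (a x) :=
    ((hφ.fderiv_right (m := 1) (by norm_num)).differentiable (by norm_num) _).hasFDerivAt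
  have h3 := h2.comp x ha
  have h4 := (((compL ℝ W E ℝ).flip j).hasFDerivAt).comp x h3
  have h5 := (rieszL W).hasFDerivAt.comp x h4
  have h6 : G = (rieszL W) ∘ ((compL ℝ W E ℝ).flip j) ∘ (fderiv ℝ φ) ∘ a := by
    funext x'; exact hG x'
  rw [h6, h5.fderiv]
  exact inner_toDual_symm _ _

lemma trCLM_comp {k l d : ℕ} (A : Mat k d) (A' : Mat l d) (H : Vec k →L[ℝ] Vec l) :
    trCLM ((A.comp (adj A')).comp H) = ∑ r : Fin d,
      ⟪A' (EuclideanSpace.single r (1 : ℝ)), H (A (EuclideanSpace.single r (1 : ℝ)))⟫ := by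
  have h1 : trCLM ((A.comp (adj A')).comp H) = LinearMap.trace ℝ (Vec d)
      (((adj A').toLinearMap ∘ₗ H.toLinearMap) ∘ₗ A.toLinearMap) := by
    rw [← LinearMap.trace_comp_comm']; rfl
  rw [h1, LinearMap.trace_eq_sum_inner _ (EuclideanSpace.basisFun (Fin d) ℝ)]
  refine Finset.sum_congr rfl fun r _ => ?_
  rw [EuclideanSpace.basisFun_apply]
  show ⟪_, (ContinuousLinearMap.adjoint A') _⟫ = _
  rw [ContinuousLinearMap.adjoint_inner_right]
  rfl

/-- Drift of the pair. -/
def BB {n m d : ℕ} (C : Coeffs n m d) (ε : ℝ) (μ : ℝ → Measure (Vec n)) (s : ℝ)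
    (z : Vec n × Vec m) : Vec n × Vec m :=
  (C.b z.1 (μ s) z.2 + (Real.sqrt ε)⁻¹ • C.K z.1 (μ s) z.2,
    ε⁻¹ • C.f z.1 (μ s) z.2 + (Real.sqrt ε)⁻¹ • C.h z.1 (μ s) z.2)

/-- Diffusion columns of the pair. -/
def SS {n m d : ℕ} (C : Coeffs n m d) (ε : ℝ) (μ : ℝ → Measure (Vec n)) (k : Fin d) (s : ℝ)
    (z : Vec n × Vec m) : Vec n × Vec m :=
  (C.σ z.1 (μ s) z.2 (EuclideanSpace.single k (1 : ℝ)),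
    (Real.sqrt ε)⁻¹ • C.g z.1 (μ s) z.2 (EuclideanSpace.single k (1 : ℝ)))

lemma genSF_eq {n m d : ℕ} (C : Coeffs n m d) {ε : ℝ} (hε : 0 < ε) (μ : ℝ → Measure (Vec n))
    {φ : Vec n × Vec m → ℝ} (hφ : ContDiff ℝ 2 φ) (s : ℝ) (z : Vec n × Vec m) :
    genSF C ε (μ s) (fun x y => φ (x, y)) z.1 z.2 = Lop (BB C ε μ) (SS C ε μ) φ s z := by
  obtain ⟨x, y⟩ := z
  have hd : ∀ q, HasFDerivAt φ (fderiv ℝ φ q) q := fun q =>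
    (hφ.differentiable (by norm_num) q).hasFDerivAt
  have ax : ∀ (x : Vec n) (y : Vec m), HasFDerivAt (fun x' : Vec n => (x', y))
    (inl ℝ (Vec n) (Vec m)) x := fun x y => hasFDerivAt_prodMk_left x y
  have ay : ∀ (x : Vec n) (y : Vec m), HasFDerivAt (fun y' : Vec m => (x, y'))
    (inr ℝ (Vec n) (Vec m)) y := fun x y => hasFDerivAt_prodMk_right x y
  have gx : ∀ x y, gradient (fun x' => φ (x', y)) x = (InnerProductSpace.toDual ℝ (Vec n)).symm
      ((fderiv ℝ φ (x, y)).comp (inl ℝ (Vec n) (Vec m))) := fun x y => by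
    unfold gradient
    have := ((hd (x, y)).comp x (ax x y)).fderiv
    simp only [Function.comp_def] at this
    rw [this]
  have gy : ∀ x y, gradient (fun y' => φ (x, y')) y = (InnerProductSpace.toDual ℝ (Vec m)).symm
      ((fderiv ℝ φ (x, y)).comp (inr ℝ (Vec n) (Vec m))) := fun x y => by
    unfold gradient
    have := ((hd (x, y)).comp y (ay x y)).fderiv
    simp only [Function.comp_def] at this
    rw [this]
  have hx : ∀ v w, ⟪w, hess (fun x' => φ (x', y)) x v⟫ =
      fderiv ℝ (fderiv ℝ φ) (x, y) (v, 0) (w, 0) := fun v w =>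
    inner_fderiv_toDual hφ (inl ℝ (Vec n) (Vec m)) (ax x y) (fun x' => gx x' y) v w
  have hy : ∀ v w, ⟪w, hess (fun y' => φ (x, y')) y v⟫ =
      fderiv ℝ (fderiv ℝ φ) (x, y) (0, v) (0, w) := fun v w =>
    inner_fderiv_toDual hφ (inr ℝ (Vec n) (Vec m)) (ay x y) (fun y' => gy x y') v w
  have hxy : ∀ v w, ⟪w, hessMixed (fun x y => φ (x, y)) x y v⟫ =
      fderiv ℝ (fderiv ℝ φ) (x, y) (v, 0) (0, w) := fun v w =>
    inner_fderiv_toDual hφ (inr ℝ (Vec n) (Vec m)) (ax x y) (fun x' => gy x' y) v w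
  unfold genSF Lop
  simp only [trCLM_comp, hx, hy, hxy]
  rw [gx, gy, inner_toDual_symm, inner_toDual_symm]
  simp only [coe_comp, Function.comp_apply, inl_apply, inr_apply]
  set a := C.b x (μ s) y + (Real.sqrt ε)⁻¹ • C.K x (μ s) y with ha
  set a' := ε⁻¹ • C.f x (μ s) y + (Real.sqrt ε)⁻¹ • C.h x (μ s) y with ha'
  have hB : BB C ε μ s (x, y) = (a, 0) + (0, a') := by simp [BB, ha, ha']
  rw [hB, map_add]
  set r := (Real.sqrt ε)⁻¹ with hr
  have r2 : r * r = ε⁻¹ := by rw [hr, ← mul_inv, Real.mul_self_sqrt hε.le]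
  have symm : ∀ v w, fderiv ℝ (fderiv ℝ φ) (x, y) v w = fderiv ℝ (fderiv ℝ φ) (x, y) w v :=
    fun v w => (hφ.contDiffAt.isSymmSndFDerivAt (by simp)) v w
  have hS : ∀ k, fderiv ℝ (fderiv ℝ φ) (x, y) (SS C ε μ k s (x, y)) (SS C ε μ k s (x, y)) =
      fderiv ℝ (fderiv ℝ φ) (x, y) (C.σ x (μ s) y (EuclideanSpace.single k (1 : ℝ)), 0)
        (C.σ x (μ s) y (EuclideanSpace.single k (1 : ℝ)), 0) +
      ε⁻¹ * fderiv ℝ (fderiv ℝ φ) (x, y) (0, C.g x (μ s) y (EuclideanSpace.single k (1 : ℝ)))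
        (0, C.g x (μ s) y (EuclideanSpace.single k (1 : ℝ))) +
      2 * r * fderiv ℝ (fderiv ℝ φ) (x, y) (C.σ x (μ s) y (EuclideanSpace.single k (1 : ℝ)), 0)
        (0, C.g x (μ s) y (EuclideanSpace.single k (1 : ℝ))) := by
    intro k
    set u := C.σ x (μ s) y (EuclideanSpace.single k (1 : ℝ))
    set w := C.g x (μ s) y (EuclideanSpace.single k (1 : ℝ))
    have e1 : SS C ε μ k s (x, y) = ((u, 0) : Vec n × Vec m) + r • ((0, w) : Vec n × Vec m) := by
      simp [SS, u, w, hr]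
    rw [e1]
    simp only [map_add, map_smul, add_apply, smul_apply, smul_eq_mul]
    rw [symm (0, w) (u, 0), ← r2]
    ring
  simp only [hS, Finset.sum_add_distrib, ← Finset.mul_sum]
  have e3 : 1 / (2 * ε) = 1 / 2 * ε⁻¹ := by field_simp
  rw [e3]
  ring

end Gen


section Wass
variable {n m : ℕ} {Ω : Type} [mΩ : MeasurableSpace Ω] {P : Measure Ω} [IsProbabilityMeasure P]

lemma W2_nonneg (μ ν : Measure (Vec n)) : 0 ≤ W2 μ ν := by
  refine Real.sInf_nonneg ?_
  rintro c ⟨π, _, rfl⟩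
  exact Real.sqrt_nonneg _

lemma W2_map_le {Z Z' : Ω → Vec n} (hZ : Measurable Z) (hZ' : Measurable Z') :
    W2 (P.map Z) (P.map Z') ≤ Real.sqrt (∫ ω, ‖Z ω - Z' ω‖ ^ 2 ∂P) := by
  refine csInf_le ⟨0, ?_⟩ ⟨P.map (fun ω => (Z ω, Z' ω)), ⟨?_, ?_⟩, ?_⟩
  · rintro c ⟨π, _, rfl⟩
    exact Real.sqrt_nonneg _
  · rw [Measure.map_map measurable_fst (hZ.prodMk hZ')]; rfl
  · rw [Measure.map_map measurable_snd (hZ.prodMk hZ')]; rfl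
  · rw [integral_map (hZ.prodMk hZ').aemeasurable]
    have : Continuous fun p : Vec n × Vec n => ‖p.1 - p.2‖ ^ 2 := by fun_prop
    exact this.aestronglyMeasurable

lemma W2_self (μ : Measure (Vec n)) [IsProbabilityMeasure μ] : W2 μ μ = 0 := by
  refine le_antisymm ?_ (W2_nonneg _ _)
  have := W2_map_le (P := μ) (Z := id) (Z' := id) measurable_id measurable_id
  simpa using this

lemma memP2_map {Z : Ω → Vec n} (hZ : Measurable Z) :
    memP2 (P.map Z) ↔ Integrable (fun ω => ‖Z ω‖ ^ 2) P := by
  have e : ∫⁻ x, (‖x‖₊ : ℝ≥0∞) ^ (2 : ℕ) ∂(P.map Z) = ∫⁻ ω, ‖(fun ω => ‖Z ω‖ ^ 2) ω‖ₑ ∂P := by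
    rw [lintegral_map (by fun_prop) hZ]
    congr 1; funext ω
    rw [enorm_pow, enorm_norm]; rfl
  unfold memP2
  rw [e]
  constructor
  · rintro ⟨_, h⟩
    exact ⟨(hZ.norm.pow_const 2).aestronglyMeasurable, h⟩
  · rintro h
    exact ⟨Measure.isProbabilityMeasure_map hZ.aemeasurable, h.2⟩

/-- Truncation. -/
def trunc (k : ℕ) (x : Vec n) : Vec n := (((k : ℝ) + 1) / (k + 1 + ‖x‖)) • x

lemma trunc_cont (k : ℕ) : Continuous (trunc k : Vec n → Vec n) := by
  unfold trunc
  have : ∀ x : Vec n, (k : ℝ) + 1 + ‖x‖ ≠ 0 := fun x => by positivity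
  fun_prop (disch := assumption)

lemma trunc_bd (k : ℕ) (x : Vec n) : ‖trunc k x‖ ≤ k + 1 := by
  unfold trunc
  rw [norm_smul, Real.norm_of_nonneg (by positivity), div_mul_eq_mul_div]
  rw [div_le_iff₀ (by positivity)]
  have := norm_nonneg x
  nlinarith [Nat.cast_nonneg (α := ℝ) k]

lemma trunc_sub (k : ℕ) (x : Vec n) : ‖trunc k x - x‖ ≤ ‖x‖ := by
  unfold trunc
  have h0 : 0 ≤ 1 - ((k : ℝ) + 1) / (k + 1 + ‖x‖) := by
    rw [sub_nonneg, div_le_one (by positivity)]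
    linarith [norm_nonneg x]
  have h1 : (((k : ℝ) + 1) / (k + 1 + ‖x‖)) • x - x =
      -((1 - ((k : ℝ) + 1) / (k + 1 + ‖x‖)) • x) := by
    rw [sub_smul, one_smul]; abel
  rw [h1, norm_neg, norm_smul, Real.norm_of_nonneg h0]
  have h2 : 0 ≤ ((k : ℝ) + 1) / (k + 1 + ‖x‖) := by positivity
  have := norm_nonneg x
  nlinarith

lemma trunc_tendsto (x : Vec n) : Tendsto (fun k => trunc k x) atTop (𝓝 x) := by
  have h1 : Tendsto (fun k : ℕ => ((k : ℝ) + 1) / (k + 1 + ‖x‖)) atTop (𝓝 1) := by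
    have h2 : Tendsto (fun k : ℕ => (k : ℝ) + 1 + ‖x‖) atTop atTop :=
      tendsto_atTop_add_const_right _ _ (tendsto_atTop_add_const_right _ _
        tendsto_natCast_atTop_atTop)
    have h3 : Tendsto (fun k : ℕ => 1 - ‖x‖ / ((k : ℝ) + 1 + ‖x‖)) atTop (𝓝 (1 - 0)) :=
      tendsto_const_nhds.sub (h2.const_div_atTop _)
    rw [sub_zero] at h3
    refine h3.congr fun k => ?_
    have : (k : ℝ) + 1 + ‖x‖ ≠ 0 := by positivity
    field_simp
    ring
  have := h1.smul_const x
  rwa [one_smul] at this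

lemma coeff_meas {G : Type*} [NormedAddCommGroup G] [MeasurableSpace G] [BorelSpace G]
    {F : Vec n → Measure (Vec n) → Vec m → G} {CL : ℝ} (hCL : 0 ≤ CL)
    (hF : ∀ x1 x2 μ1 μ2 y1 y2, memP2 μ1 → memP2 μ2 →
      ‖F x1 μ1 y1 - F x2 μ2 y2‖ ≤ CL * (‖x1 - x2‖ + ‖y1 - y2‖ + W2 μ1 μ2))
    {X : ℝ → Ω → Vec n} (hX : ∀ s, Measurable (X s)) (hc : ∀ ω, Continuous fun s => X s ω)
    (hi : ∀ s, Integrable (fun ω => ‖X s ω‖ ^ 2) P) :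
    Measurable (fun q : ℝ × (Vec n × Vec m) => F q.2.1 (P.map (X q.1)) q.2.2) := by
  have tm : ∀ k s, Measurable (fun ω => trunc k (X s ω)) := fun k s =>
    (trunc_cont k).measurable.comp (hX s)
  have tP : ∀ k s, memP2 (P.map (fun ω => trunc k (X s ω))) := fun k s => by
    rw [memP2_map (tm k s)]
    refine (integrable_const (((k : ℝ) + 1) ^ 2)).mono'
      ((tm k s).norm.pow_const 2).aestronglyMeasurable (Eventually.of_forall fun ω => ?_)
    rw [Real.norm_of_nonneg (by positivity)]
    exact pow_le_pow_left₀ (norm_nonneg _) (trunc_bd k _) 2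
  have XP : ∀ s, memP2 (P.map (X s)) := fun s => (memP2_map (hX s)).2 (hi s)
  refine measurable_of_tendsto_metrizable (f := fun k : ℕ => fun q : ℝ × (Vec n × Vec m) =>
    F q.2.1 (P.map (fun ω => trunc k (X q.1 ω))) q.2.2) (fun k => ?_) ?_
  · refine Continuous.measurable (continuous_iff_continuousAt.2 fun q0 => ?_)
    rw [ContinuousAt, tendsto_iff_norm_sub_tendsto_zero]
    have c1 : Continuous fun s => ∫ ω, ‖trunc k (X s ω) - trunc k (X q0.1 ω)‖ ^ 2 ∂P := by
      refine continuous_of_dominated (bound := fun _ => (2 * ((k : ℝ) + 1)) ^ 2)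
        (fun s => (((tm k s).sub (tm k q0.1)).norm.pow_const 2).aestronglyMeasurable)
        (fun s => Eventually.of_forall fun ω => ?_) (integrable_const _)
        (Eventually.of_forall fun ω => ?_)
      · rw [Real.norm_of_nonneg (by positivity)]
        refine pow_le_pow_left₀ (norm_nonneg _) ?_ 2
        have := norm_sub_le (trunc k (X s ω)) (trunc k (X q0.1 ω))
        have := trunc_bd k (X s ω)
        have := trunc_bd k (X q0.1 ω)
        linarith
      · have := (trunc_cont (n := n) k).comp (hc ω)
        exact ((this.sub continuous_const).norm).pow 2
    have c2 : Continuous fun q : ℝ × (Vec n × Vec m) => CL * (‖q.2.1 - q0.2.1‖ + ‖q.2.2 - q0.2.2‖ +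
        Real.sqrt (∫ ω, ‖trunc k (X q.1 ω) - trunc k (X q0.1 ω)‖ ^ 2 ∂P)) := by
      have := c1.comp (continuous_fst (X := ℝ) (Y := Vec n × Vec m))
      simp only [Function.comp_def] at this
      fun_prop
    have c3 := c2.tendsto q0
    simp only [sub_self, norm_zero, ne_eq, OfNat.ofNat_ne_zero, not_false_eq_true, zero_pow,
      integral_zero, Real.sqrt_zero, add_zero, mul_zero] at c3
    refine squeeze_zero (fun _ => norm_nonneg _) (fun q => ?_) c3
    refine (hF _ _ _ _ _ _ (tP k _) (tP k _)).trans ?_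
    have := W2_map_le (P := P) (tm k q.1) (tm k q0.1)
    gcongr
  · rw [tendsto_pi_nhds]
    intro q
    rw [tendsto_iff_norm_sub_tendsto_zero]
    have c1 : Tendsto (fun k : ℕ => ∫ ω, ‖trunc k (X q.1 ω) - X q.1 ω‖ ^ 2 ∂P) atTop
        (𝓝 (∫ ω, (0 : ℝ) ∂P)) := by
      refine tendsto_integral_of_dominated_convergence (fun ω => ‖X q.1 ω‖ ^ 2)
        (fun k => (((tm k q.1).sub (hX q.1)).norm.pow_const 2).aestronglyMeasurable)
        (hi q.1) (fun k => Eventually.of_forall fun ω => ?_) (Eventually.of_forall fun ω => ?_)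
      · rw [Real.norm_of_nonneg (by positivity)]
        exact pow_le_pow_left₀ (norm_nonneg _) (trunc_sub k _) 2
      · have := ((tendsto_iff_norm_sub_tendsto_zero.1 (trunc_tendsto (X q.1 ω))).pow 2)
        simpa using this
    rw [integral_zero] at c1
    have c2 := ((Real.continuous_sqrt.tendsto 0).comp c1).const_mul CL
    rw [Real.sqrt_zero, mul_zero] at c2
    refine squeeze_zero (fun _ => norm_nonneg _) (fun k => ?_) c2
    refine (hF _ _ _ _ _ _ (tP k _) (XP _)).trans ?_
    have := W2_map_le (P := P) (tm k q.1) (hX q.1)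
    simp only [sub_self, norm_zero, zero_add, Function.comp_apply]
    gcongr

end Wass


section Inst
variable {n m d : ℕ} {Ω : Type} [mΩ : MeasurableSpace Ω] {P : Measure Ω} [IsProbabilityMeasure P]

/-- The basic constant. -/
def LL (C : Coeffs n m d) (H : SA C) (P : Measure Ω) : ℝ :=
  1 + |H.CL| + |H.CG| + ‖C.b 0 (P.map (fun _ => (0 : Vec n))) 0‖

lemma norm_single_le (k : Fin d) : ‖(EuclideanSpace.single k (1 : ℝ) : Vec d)‖ ≤ 1 := by simp

lemma app_single_le {k : ℕ} (A : Mat k d) (j : Fin d) :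
    ‖A (EuclideanSpace.single j (1 : ℝ))‖ ≤ ‖A‖ := by
  have := A.le_opNorm_of_le (norm_single_le j)
  simpa using this

lemma rpow_le_one_add {x q : ℝ} (hx : 0 ≤ x) (h0 : 0 ≤ q) (h1 : q ≤ 1) : x ^ q ≤ 1 + x := by
  rcases le_total x 1 with h | h
  · have := Real.rpow_le_one hx h h0; linarith
  · have := Real.rpow_le_rpow_of_exponent_le h h1
    rw [Real.rpow_one] at this; linarith

lemma inst_Bd (C : Coeffs n m d) (H : SA C) {ε : ℝ} (hε : ε ∈ Set.Ioo (0 : ℝ) 1)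
    (μ : ℝ → Measure (Vec n)) (hμ : ∀ s, memP2 (μ s)) :
    Bd (BB C ε μ) (SS C ε μ) (fun s => C.b 0 (μ s) 0) (LL C H P) H.γ H.ς (Real.sqrt ε)⁻¹ := by
  have hs0 : 0 < Real.sqrt ε := Real.sqrt_pos.2 hε.1
  have hs1 : Real.sqrt ε ≤ 1 := by
    exact (Real.sqrt_le_sqrt hε.2.le).trans (by simp)
  have he : 1 ≤ (Real.sqrt ε)⁻¹ := (one_le_inv₀ hs0).2 hs1
  have e2 : ε⁻¹ = (Real.sqrt ε)⁻¹ ^ 2 := by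
    rw [inv_pow, Real.sq_sqrt hε.1.le]
  have L1 : |H.CL| ≤ LL C H P := by
    unfold LL; linarith [abs_nonneg H.CG, norm_nonneg (C.b 0 (P.map (fun _ => (0 : Vec n))) 0)]
  have L2 : |H.CG| ≤ LL C H P := by
    unfold LL; linarith [abs_nonneg H.CL, norm_nonneg (C.b 0 (P.map (fun _ => (0 : Vec n))) 0)]
  have L3 : 1 ≤ LL C H P := by
    unfold LL; linarith [abs_nonneg H.CL, abs_nonneg H.CG,
      norm_nonneg (C.b 0 (P.map (fun _ => (0 : Vec n))) 0)]
  have gr : ∀ x s y, ‖C.K x (μ s) y‖ + ‖C.f x (μ s) y‖ + ‖C.h x (μ s) y‖ + ‖C.σ x (μ s) y‖ ≤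
      LL C H P * (1 + ‖y‖) := fun x s y =>
    (H.growth x (μ s) y (hμ s)).trans
      (mul_le_mul_of_nonneg_right ((le_abs_self _).trans L2) (by positivity))
  set e := (Real.sqrt ε)⁻¹ with hee
  have e0 : 0 < e := by linarith
  refine ⟨he, L3, H.hγ, H.hς.1, H.hς.2, ?_, ?_, ?_, ?_⟩
  · intro s z
    have h1 : ‖C.b z.1 (μ s) z.2 - C.b 0 (μ s) 0‖ ≤ LL C H P * (‖z.1‖ + ‖z.2‖) := by
      have h2 := H.lipSlow z.1 0 (μ s) (μ s) z.2 0 (hμ s) (hμ s)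
      haveI := (hμ s).1
      rw [W2_self, sub_zero, sub_zero, add_zero] at h2
      have h3 := mul_le_mul_of_nonneg_right ((le_abs_self _).trans L1)
        (by positivity : 0 ≤ ‖z.1‖ + ‖z.2‖)
      have h4 := norm_nonneg (C.K z.1 (μ s) z.2 - C.K 0 (μ s) 0)
      have h5 := norm_nonneg (C.σ z.1 (μ s) z.2 - C.σ 0 (μ s) 0)
      linarith
    have h2 : ‖e • C.K z.1 (μ s) z.2‖ ≤ e * (LL C H P * (1 + ‖z.2‖)) := by
      rw [norm_smul, Real.norm_of_nonneg e0.le]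
      refine mul_le_mul_of_nonneg_left ?_ e0.le
      have := gr z.1 s z.2
      linarith [norm_nonneg (C.f z.1 (μ s) z.2), norm_nonneg (C.h z.1 (μ s) z.2),
        norm_nonneg (C.σ z.1 (μ s) z.2)]
    have h3 : (BB C ε μ s z).1 - C.b 0 (μ s) 0 =
        (C.b z.1 (μ s) z.2 - C.b 0 (μ s) 0) + e • C.K z.1 (μ s) z.2 := by
      simp only [BB, hee]; abel
    rw [h3]
    exact (norm_add_le _ _).trans (add_le_add h1 h2)
  · intro s z
    have h1 : ⟪z.2, C.f z.1 (μ s) z.2⟫ ≤ -(H.γ / 2) * ‖z.2‖ ^ 2 + LL C H P * ‖z.2‖ := by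
      have h2 := H.dissip z.1 (μ s) z.2 0 (hμ s)
      rw [sub_zero, inner_sub_left] at h2
      have h3 := gr z.1 s 0
      rw [norm_zero, add_zero, mul_one] at h3
      have h4 : ‖C.f z.1 (μ s) 0‖ ≤ LL C H P := by
        linarith [norm_nonneg (C.K z.1 (μ s) 0), norm_nonneg (C.h z.1 (μ s) 0),
          norm_nonneg (C.σ z.1 (μ s) 0)]
      have h5 := real_inner_le_norm (C.f z.1 (μ s) 0) z.2
      have h6 := mul_le_mul_of_nonneg_right h4 (norm_nonneg z.2)
      have h7 := sq_nonneg ‖C.g z.1 (μ s) z.2 - C.g z.1 (μ s) 0‖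
      rw [real_inner_comm]
      linarith
    have h2 : ⟪z.2, C.h z.1 (μ s) z.2⟫ ≤ LL C H P * (1 + ‖z.2‖) * ‖z.2‖ := by
      have h3 := gr z.1 s z.2
      have h4 : ‖C.h z.1 (μ s) z.2‖ ≤ LL C H P * (1 + ‖z.2‖) := by
        linarith [norm_nonneg (C.K z.1 (μ s) z.2), norm_nonneg (C.f z.1 (μ s) z.2),
          norm_nonneg (C.σ z.1 (μ s) z.2)]
      have h5 := real_inner_le_norm z.2 (C.h z.1 (μ s) z.2)
      have h6 := mul_le_mul_of_nonneg_right h4 (norm_nonneg z.2)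
      linarith
    simp only [BB]
    rw [inner_add_right, inner_smul_right, inner_smul_right, e2]
    exact add_le_add (mul_le_mul_of_nonneg_left h1 (by positivity))
      (mul_le_mul_of_nonneg_left h2 e0.le)
  · intro k s z
    have h3 := gr z.1 s z.2
    have h4 := app_single_le (C.σ z.1 (μ s) z.2) k
    simp only [SS]
    linarith [norm_nonneg (C.K z.1 (μ s) z.2), norm_nonneg (C.f z.1 (μ s) z.2),
      norm_nonneg (C.h z.1 (μ s) z.2)]
  · intro k s z
    have h4 := app_single_le (C.g z.1 (μ s) z.2) k
    simp only [SS]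
    rw [norm_smul, Real.norm_of_nonneg e0.le]
    refine mul_le_mul_of_nonneg_left (h4.trans ((H.growthg _ _ _ (hμ s)).trans ?_)) e0.le
    exact mul_le_mul_of_nonneg_right ((le_abs_self _).trans L2) (by positivity)

lemma inst_MP (C : Coeffs n m d) (H : SA C) {ε : ℝ} (hε : ε ∈ Set.Ioo (0 : ℝ) 1)
    {ℱ : Filtration ℝ mΩ} {X : ℝ → Ω → Vec n} {Y : ℝ → Ω → Vec m} {ξ : Ω → Vec n} {ζ : Ω → Vec m}
    (hs : IsSFSolution C ε P ℱ X Y ξ ζ) (μ : ℝ → Measure (Vec n))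
    (hμd : μ = fun s => P.map (X (max s 0))) :
    (Measurable fun s => C.b 0 (μ s) 0) ∧
    MP P ℱ (fun t ω => (X t ω, Y t ω)) (BB C ε μ) (SS C ε μ) (fun s => ‖C.b 0 (μ s) 0‖)
      (LL C H P * (2 + 2 * (Real.sqrt ε)⁻¹ + (Real.sqrt ε)⁻¹ ^ 2)) := by
  have hμ : ∀ s, memP2 (μ s) := fun s => by rw [hμd]; exact hs.lawP2X _ (le_max_right _ _)
  have bd := inst_Bd (P := P) C H hε μ hμ
  have he := bd.he
  have hL := bd.hL
  have e2 : ε⁻¹ = (Real.sqrt ε)⁻¹ ^ 2 := by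
    rw [inv_pow, Real.sq_sqrt hε.1.le]
  have L2 : |H.CG| ≤ LL C H P := by
    unfold LL; linarith [abs_nonneg H.CL, norm_nonneg (C.b 0 (P.map (fun _ => (0 : Vec n))) 0)]
  have gr : ∀ x s y, ‖C.K x (μ s) y‖ + ‖C.f x (μ s) y‖ + ‖C.h x (μ s) y‖ + ‖C.σ x (μ s) y‖ ≤
      LL C H P * (1 + ‖y‖) := fun x s y =>
    (H.growth x (μ s) y (hμ s)).trans
      (mul_le_mul_of_nonneg_right ((le_abs_self _).trans L2) (by positivity))
  -- measurability
  have cm : ∀ {k : ℕ} {F : Vec n → Measure (Vec n) → Vec m → Vec k},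
      (∀ x1 x2 μ1 μ2 y1 y2, memP2 μ1 → memP2 μ2 → ‖F x1 μ1 y1 - F x2 μ2 y2‖ ≤
        H.CL * (‖x1 - x2‖ + ‖y1 - y2‖ + W2 μ1 μ2)) →
      Measurable (fun q : ℝ × (Vec n × Vec m) => F q.2.1 (μ q.1) q.2.2) := by
    intro k F hF
    rw [hμd]
    refine coeff_meas (X := fun s => X (max s 0)) (abs_nonneg H.CL) ?_ (fun s => hs.measX _) ?_ ?_
    · intro x1 x2 μ1 μ2 y1 y2 h1 h2
      refine (hF x1 x2 μ1 μ2 y1 y2 h1 h2).trans (mul_le_mul_of_nonneg_right (le_abs_self _) ?_)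
      have := W2_nonneg μ1 μ2
      positivity
    · intro ω
      exact (hs.contX ω).comp (continuous_id.max continuous_const)
    · intro s
      exact (memP2_map (hs.measX _)).1 (hs.lawP2X _ (le_max_right _ _))
  have mb : Measurable (fun q : ℝ × (Vec n × Vec m) => C.b q.2.1 (μ q.1) q.2.2) :=
    cm fun x1 x2 μ1 μ2 y1 y2 h1 h2 => by
      have := H.lipSlow x1 x2 μ1 μ2 y1 y2 h1 h2
      linarith [norm_nonneg (C.K x1 μ1 y1 - C.K x2 μ2 y2),
        norm_nonneg (C.σ x1 μ1 y1 - C.σ x2 μ2 y2)]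
  have mK : Measurable (fun q : ℝ × (Vec n × Vec m) => C.K q.2.1 (μ q.1) q.2.2) :=
    cm fun x1 x2 μ1 μ2 y1 y2 h1 h2 => by
      have := H.lipSlow x1 x2 μ1 μ2 y1 y2 h1 h2
      linarith [norm_nonneg (C.b x1 μ1 y1 - C.b x2 μ2 y2),
        norm_nonneg (C.σ x1 μ1 y1 - C.σ x2 μ2 y2)]
  have mσ : ∀ k : Fin d, Measurable (fun q : ℝ × (Vec n × Vec m) =>
      C.σ q.2.1 (μ q.1) q.2.2 (EuclideanSpace.single k (1 : ℝ))) := fun k =>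
    cm (F := fun x μ y => C.σ x μ y (EuclideanSpace.single k (1 : ℝ)))
      fun x1 x2 μ1 μ2 y1 y2 h1 h2 => by
      have := H.lipSlow x1 x2 μ1 μ2 y1 y2 h1 h2
      have h3 := app_single_le (C.σ x1 μ1 y1 - C.σ x2 μ2 y2) k
      rw [ContinuousLinearMap.sub_apply] at h3
      linarith [norm_nonneg (C.b x1 μ1 y1 - C.b x2 μ2 y2),
        norm_nonneg (C.K x1 μ1 y1 - C.K x2 μ2 y2)]
  have mf : Measurable (fun q : ℝ × (Vec n × Vec m) => C.f q.2.1 (μ q.1) q.2.2) :=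
    cm fun x1 x2 μ1 μ2 y1 y2 h1 h2 => by
      have := H.lipFast x1 x2 μ1 μ2 y1 y2 h1 h2
      linarith [norm_nonneg (C.h x1 μ1 y1 - C.h x2 μ2 y2),
        norm_nonneg (C.g x1 μ1 y1 - C.g x2 μ2 y2)]
  have mh : Measurable (fun q : ℝ × (Vec n × Vec m) => C.h q.2.1 (μ q.1) q.2.2) :=
    cm fun x1 x2 μ1 μ2 y1 y2 h1 h2 => by
      have := H.lipFast x1 x2 μ1 μ2 y1 y2 h1 h2
      linarith [norm_nonneg (C.f x1 μ1 y1 - C.f x2 μ2 y2),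
        norm_nonneg (C.g x1 μ1 y1 - C.g x2 μ2 y2)]
  have mg : ∀ k : Fin d, Measurable (fun q : ℝ × (Vec n × Vec m) =>
      C.g q.2.1 (μ q.1) q.2.2 (EuclideanSpace.single k (1 : ℝ))) := fun k =>
    cm (F := fun x μ y => C.g x μ y (EuclideanSpace.single k (1 : ℝ)))
      fun x1 x2 μ1 μ2 y1 y2 h1 h2 => by
      have := H.lipFast x1 x2 μ1 μ2 y1 y2 h1 h2
      have h3 := app_single_le (C.g x1 μ1 y1 - C.g x2 μ2 y2) k
      rw [ContinuousLinearMap.sub_apply] at h3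
      linarith [norm_nonneg (C.f x1 μ1 y1 - C.f x2 μ2 y2),
        norm_nonneg (C.h x1 μ1 y1 - C.h x2 μ2 y2)]
  have mβ : Measurable (fun s => C.b 0 (μ s) 0) :=
    mb.comp (measurable_id.prodMk (measurable_const (a := ((0, 0) : Vec n × Vec m))))
  refine ⟨mβ, ?_⟩
  have n1 : ∀ z : Vec n × Vec m, ‖z.1‖ ≤ ‖z‖ := fun z => norm_fst_le z
  have n2 : ∀ z : Vec n × Vec m, ‖z.2‖ ≤ ‖z‖ := fun z => norm_snd_le z
  constructor
  · exact fun t => (hs.adaptX t).prodMk (hs.adaptY t)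
  · exact fun ω => (hs.contX ω).prodMk (hs.contY ω)
  · exact (mb.add (mK.fun_const_smul (Real.sqrt ε)⁻¹)).prodMk ((mf.fun_const_smul ε⁻¹).add (mh.fun_const_smul (Real.sqrt ε)⁻¹))
  · exact fun k => (mσ k).prodMk ((mg k).fun_const_smul (Real.sqrt ε)⁻¹)
  · exact mβ.norm
  · exact fun _ => norm_nonneg _
  · positivity
  · intro s z
    have b1 := bd.d1 s z
    have b2 : ‖(BB C ε μ s z).2‖ ≤ (Real.sqrt ε)⁻¹ ^ 2 * (LL C H P * (1 + ‖z.2‖)) +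
        (Real.sqrt ε)⁻¹ * (LL C H P * (1 + ‖z.2‖)) := by
      simp only [BB]
      refine (norm_add_le _ _).trans ?_
      have h3 := gr z.1 s z.2
      have k1 := norm_nonneg (C.K z.1 (μ s) z.2)
      have k2 := norm_nonneg (C.f z.1 (μ s) z.2)
      have k3 := norm_nonneg (C.h z.1 (μ s) z.2)
      have k4 := norm_nonneg (C.σ z.1 (μ s) z.2)
      rw [norm_smul, norm_smul, e2, Real.norm_of_nonneg (by positivity),
        Real.norm_of_nonneg (by positivity)]
      refine add_le_add (mul_le_mul_of_nonneg_left ?_ (by positivity))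
        (mul_le_mul_of_nonneg_left ?_ (by positivity)) <;> linarith
    have b3 : ‖(BB C ε μ s z).1‖ ≤ ‖(BB C ε μ s z).1 - C.b 0 (μ s) 0‖ + ‖C.b 0 (μ s) 0‖ := by
      have := norm_add_le ((BB C ε μ s z).1 - C.b 0 (μ s) 0) (C.b 0 (μ s) 0)
      simpa using this
    have z1 := n1 z
    have z2 := n2 z
    have z0 := norm_nonneg z
    have y0 := norm_nonneg z.2
    have β0 := norm_nonneg (C.b 0 (μ s) 0)
    generalize (Real.sqrt ε)⁻¹ = e at *
    generalize LL C H P = L at *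
    have c1 : L * (‖z.1‖ + ‖z.2‖) ≤ L * (2 * (1 + ‖z‖)) :=
      mul_le_mul_of_nonneg_left (by linarith) (by linarith)
    have c2 : L * (1 + ‖z.2‖) ≤ L * (1 + ‖z‖) :=
      mul_le_mul_of_nonneg_left (by linarith) (by linarith)
    have c3 : e * (L * (1 + ‖z.2‖)) ≤ e * (L * (1 + ‖z‖)) :=
      mul_le_mul_of_nonneg_left c2 (by linarith)
    have c4 : e ^ 2 * (L * (1 + ‖z.2‖)) ≤ e ^ 2 * (L * (1 + ‖z‖)) :=
      mul_le_mul_of_nonneg_left c2 (by positivity)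
    have c0 : 0 ≤ L * (1 + ‖z‖) := by positivity
    have c5 : 0 ≤ e * (L * (1 + ‖z‖)) := by positivity
    have c6 : 0 ≤ e ^ 2 * (L * (1 + ‖z‖)) := by positivity
    rw [Prod.norm_def]
    refine max_le ?_ ?_ <;> linarith
  · intro k s z
    have b1 := bd.s1 k s z
    have b2 := bd.s2 k s z
    have z2 := n2 z
    have z0 := norm_nonneg z
    have y0 := norm_nonneg z.2
    have yς := rpow_le_one_add y0 H.hς.1.le H.hς.2.le
    generalize (Real.sqrt ε)⁻¹ = e at *
    generalize LL C H P = L at *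
    have c2 : L * (1 + ‖z.2‖) ≤ L * (1 + ‖z‖) :=
      mul_le_mul_of_nonneg_left (by linarith) (by linarith)
    have c3 : e * (L * (1 + ‖z.2‖ ^ H.ς)) ≤ e * (L * (2 * (1 + ‖z‖))) :=
      mul_le_mul_of_nonneg_left (mul_le_mul_of_nonneg_left (by linarith) (by linarith))
        (by linarith)
    have c0 : 0 ≤ L * (1 + ‖z‖) := by positivity
    have c5 : 0 ≤ e * (L * (1 + ‖z‖)) := by positivity
    have c6 : 0 ≤ e ^ 2 * (L * (1 + ‖z‖)) := by positivity
    rw [Prod.norm_def]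
    refine max_le ?_ ?_ <;> linarith
  · intro φ hφ hφc
    have := hs.mart (fun x y => φ (x, y)) ⟨hφ, hφc⟩
    convert this using 4 with t ω
    refine setIntegral_congr_fun measurableSet_Ioc fun s hs' => ?_
    have e1 : P.map (X s) = μ s := by rw [hμd]; simp only [max_eq_left hs'.1.le]
    rw [e1]
    exact (genSF_eq C hε.1 μ hφ s (X s ω, Y s ω)).symm

end Inst


section Fin
variable {n m d : ℕ} {Ω : Type} [mΩ : MeasurableSpace Ω] {P : Measure Ω} [IsProbabilityMeasure P]

lemma pt_mom {x p q : ℝ} (hx : 0 ≤ x) (hp : 2 ≤ p) (hq : p ≤ q) :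
    (1 + x ^ 2) ^ (p / 2) ≤ 2 ^ p * (2 + x ^ q) := by
  have h1 : (1 + x ^ 2) ^ (p / 2) ≤ ((1 + x) ^ 2) ^ (p / 2) := by
    apply Real.rpow_le_rpow (by positivity) (by nlinarith) (by linarith)
  have h2 : ((1 + x) ^ 2) ^ (p / 2) = (1 + x) ^ p := by
    rw [← Real.rpow_natCast, ← Real.rpow_mul (by positivity)]
    congr 1; push_cast; ring
  have h3 := rpow_add_le2 zero_le_one hx (by linarith : 1 ≤ p)
  rw [Real.one_rpow] at h3
  have h4 : x ^ p ≤ 1 + x ^ q := by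
    rcases le_total x 1 with h | h
    · have := Real.rpow_le_one hx h (by linarith : 0 ≤ p)
      have := Real.rpow_nonneg hx q
      linarith
    · have := Real.rpow_le_rpow_of_exponent_le h hq
      linarith
  have h5 : (2 : ℝ) ^ p * (1 + x ^ p) ≤ 2 ^ p * (2 + x ^ q) :=
    mul_le_mul_of_nonneg_left (by linarith) (by positivity)
  linarith

lemma mom0 {k : ℕ} {Z ξ : Ω → Vec k} (hZ : Measurable Z) (hae : ∀ᵐ ω ∂P, Z ω = ξ ω) {p q : ℝ}
    (hp : 2 ≤ p) (hq : p ≤ q) (hfin : ∫⁻ ω, (‖ξ ω‖₊ : ℝ≥0∞) ^ q ∂P < ⊤) :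
    Integrable (fun ω => (1 + ‖Z ω‖ ^ 2) ^ (p / 2)) P ∧
      ∫ ω, (1 + ‖Z ω‖ ^ 2) ^ (p / 2) ∂P ≤ 2 ^ p * (2 + ∫ ω, ‖ξ ω‖ ^ q ∂P) := by
  have hq0 : 0 ≤ q := by linarith
  have i1 : Integrable (fun ω => ‖Z ω‖ ^ q) P := by
    refine ⟨(hZ.norm.pow_const q).aestronglyMeasurable, ?_⟩
    refine lt_of_le_of_lt (le_of_eq ?_) hfin
    refine lintegral_congr_ae ?_
    filter_upwards [hae] with ω h
    rw [← h, Real.enorm_of_nonneg (by positivity), ← ENNReal.ofReal_rpow_of_nonneg (norm_nonneg _) hq0,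
      ofReal_norm]
    rfl
  have e1 : ∫ ω, ‖Z ω‖ ^ q ∂P = ∫ ω, ‖ξ ω‖ ^ q ∂P := by
    refine integral_congr_ae ?_
    filter_upwards [hae] with ω h
    rw [h]
  have i2 : Integrable (fun ω => (2 : ℝ) ^ p * (2 + ‖Z ω‖ ^ q)) P :=
    ((integrable_const _).add i1).const_mul _
  have i3 : Integrable (fun ω => (1 + ‖Z ω‖ ^ 2) ^ (p / 2)) P := by
    refine i2.mono' ?_ (Eventually.of_forall fun ω => ?_)
    · exact (((hZ.norm.pow_const 2).const_add 1).pow_const (p / 2)).aestronglyMeasurable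
    · rw [Real.norm_of_nonneg (by positivity)]
      exact pt_mom (norm_nonneg _) hp hq
  refine ⟨i3, (integral_mono i3 i2 fun ω => pt_mom (norm_nonneg _) hp hq).trans ?_⟩
  rw [integral_const_mul, integral_add (integrable_const _) i1, e1]
  simp

lemma inst_Sys (C : Coeffs n m d) (H : SA C) {p : ℝ} (hp : 2 ≤ p) :
    ∃ c lam D : ℝ, 0 < c ∧ 0 < lam ∧ 0 ≤ D ∧
    ∀ (ε : ℝ), ε ∈ Set.Ioo (0 : ℝ) 1 →
    ∀ (ℱ : Filtration ℝ mΩ) (X : ℝ → Ω → Vec n) (Y : ℝ → Ω → Vec m) (ξ : Ω → Vec n) (ζ : Ω → Vec m),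
    IsSFSolution C ε P ℱ X Y ξ ζ →
    Integrable (fun ω => VX p 1 0 (X 0 ω, Y 0 ω)) P →
    Integrable (fun ω => WY p (X 0 ω, Y 0 ω)) P →
    ∃ (B : ℝ → Vec n × Vec m → Vec n × Vec m) (S : Fin d → ℝ → Vec n × Vec m → Vec n × Vec m)
      (βv : ℝ → Vec n) (Λ CU : ℝ),
      Sys P ℱ (fun t ω => (X t ω, Y t ω)) B S βv Λ CU p (LL C H P) c lam D (Real.sqrt ε)⁻¹ := by
  have hL : 1 ≤ LL C H P := by
    unfold LL
    linarith [abs_nonneg H.CL, abs_nonneg H.CG,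
      norm_nonneg (C.b 0 (P.map (fun _ => (0 : Vec n))) 0)]
  obtain ⟨lam, cY, D, hlam, hcY, hD, hY⟩ := genWY (H1 := Vec n) (H2 := Vec m) (ι := Fin d)
    (LL C H P) H.γ H.ς p d hL H.hγ H.hς.2 hp
  obtain ⟨cX, hcX, hX⟩ := genX (H1 := Vec n) (H2 := Vec m) (ι := Fin d)
    (LL C H P) H.γ H.ς p d hL hp
  refine ⟨cY + cX, lam, D, by positivity, hlam, hD, ?_⟩
  intro ε hε ℱ X Y ξ ζ hs ix iy
  set μ : ℝ → Measure (Vec n) := fun s => P.map (X (max s 0)) with hμd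
  have hμ : ∀ s, memP2 (μ s) := fun s => hs.lawP2X _ (le_max_right _ _)
  have bd := inst_Bd (P := P) C H hε μ hμ
  obtain ⟨mβ, mp⟩ := inst_MP C H hε hs μ hμd
  obtain ⟨CU, hCU, gU⟩ := bd.genU
  have he := bd.he
  have e0 : (0 : ℝ) ≤ (Real.sqrt ε)⁻¹ := by linarith
  have hcard : Fintype.card (Fin d) ≤ d := by simp
  have hL0 : 0 ≤ LL C H P := by linarith
  refine ⟨BB C ε μ, SS C ε μ, fun s => C.b 0 (μ s) 0, LL C H P * (2 + 2 * (Real.sqrt ε)⁻¹ + (Real.sqrt ε)⁻¹ ^ 2), CU, ?_⟩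
  refine ⟨mp, mβ, hp, hL, by positivity, hlam, hD, he, hCU, gU, ?_, ?_, ?_, ?_, ?_, ?_, ix, iy⟩
  · intro s z
    have h1 : Lop (BB C ε μ) (SS C ε μ) (WY p) s z ≤ (Real.sqrt ε)⁻¹ ^ 2 * (-lam * WY p z + D) +
      cY * WY p z := hY _ _ _ _ hcard bd s z
    have h2 := mul_nonneg hcX.le (WY_nonneg p z)
    linarith
  · intro s z
    have h1 : Lop (BB C ε μ) (SS C ε μ) (VX p 1 0) s z ≤
      (cX / 1 + p * ‖C.b 0 (μ s) 0‖) * VX p 1 0 z + cX * Rem p (Real.sqrt ε)⁻¹ 1 z :=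
      (hX _ _ _ _ hcard bd 1 1 one_pos one_pos 0 s z).1 le_rfl
    have h2 := mul_nonneg hcY.le (VX_nonneg p one_pos 0 z)
    have h3 := mul_nonneg hcY.le (Rem_nonneg' (p := p) one_pos e0 z)
    rw [div_one] at h1
    linarith
  · intro δ h hδ hh a s z
    have h1 : Lop (BB C ε μ) (SS C ε μ) (VX p δ a) s z ≤
      (cX / h) * VX p δ a z + cX * (Rem p (Real.sqrt ε)⁻¹ h z + h ^ (p - 1) * ‖C.b 0 (μ s) 0‖ ^ p) :=
      (hX _ _ _ _ hcard bd δ h hδ hh a s z).2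
    have h2 := mul_nonneg (div_nonneg hcY.le hh.le) (VX_nonneg p hδ a z)
    have h3 := mul_nonneg hcY.le (Rem_nonneg' (p := p) hh e0 z)
    have h4 : 0 ≤ cY * (h ^ (p - 1) * ‖C.b 0 (μ s) 0‖ ^ p) := by positivity
    rw [add_div]
    linarith
  · intro s h0
    exact (memP2_map (hs.measX s)).1 (hs.lawP2X s h0)
  · intro s h0
    have e1 : μ s = P.map (X s) := by simp only [hμd, max_eq_left h0]
    have m0 : memP2 (P.map (fun _ : Ω => (0 : Vec n))) :=
      (memP2_map measurable_const).2 (by simp)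
    have h1 := H.lipSlow 0 0 (μ s) (P.map (fun _ : Ω => (0 : Vec n))) 0 0 (hμ s) m0
    have h2 := W2_map_le (P := P) (hs.measX s) (measurable_const (a := (0 : Vec n)))
    rw [← e1] at h2
    simp only [sub_zero] at h2
    simp only [sub_self, norm_zero, zero_add] at h1
    have h3 := norm_nonneg (C.K 0 (μ s) 0 - C.K 0 (P.map (fun _ : Ω => (0 : Vec n))) 0)
    have h4 := norm_nonneg (C.σ 0 (μ s) 0 - C.σ 0 (P.map (fun _ : Ω => (0 : Vec n))) 0)
    have h5 := norm_le_norm_add_norm_sub' (C.b 0 (μ s) 0) (C.b 0 (P.map (fun _ : Ω => (0 : Vec n))) 0)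
    have w0 := W2_nonneg (μ s) (P.map (fun _ : Ω => (0 : Vec n)))
    have h6 : H.CL * W2 (μ s) (P.map (fun _ : Ω => (0 : Vec n))) ≤
        |H.CL| * Real.sqrt (∫ ω, ‖X s ω‖ ^ 2 ∂P) :=
      (mul_le_mul_of_nonneg_right (le_abs_self _) w0).trans
        (mul_le_mul_of_nonneg_left h2 (abs_nonneg _))
    have h7 : |H.CL| ≤ LL C H P := by
      unfold LL; linarith [abs_nonneg H.CG, norm_nonneg (C.b 0 (P.map (fun _ => (0 : Vec n))) 0)]
    have h8 : ‖C.b 0 (P.map (fun _ : Ω => (0 : Vec n))) 0‖ ≤ LL C H P := by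
      unfold LL; linarith [abs_nonneg H.CG, abs_nonneg H.CL]
    have h9 := mul_le_mul_of_nonneg_right h7 (Real.sqrt_nonneg (∫ ω, ‖X s ω‖ ^ 2 ∂P))
    show ‖C.b 0 (μ s) 0‖ ≤ LL C H P * (1 + Real.sqrt (∫ ω, ‖X s ω‖ ^ 2 ∂P))
    linarith
  · refine ⟨2 * LL C H P + (Real.sqrt ε)⁻¹ * LL C H P, fun s z => ?_⟩
    refine (bd.d1 s z).trans ?_
    have n1 : ‖z.1‖ ≤ ‖z‖ := norm_fst_le z
    have n2 : ‖z.2‖ ≤ ‖z‖ := norm_snd_le z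
    have a1 := mul_le_mul_of_nonneg_left (by linarith : ‖z.1‖ + ‖z.2‖ ≤ 2 * (1 + ‖z‖)) hL0
    have a2 := mul_le_mul_of_nonneg_left (mul_le_mul_of_nonneg_left
      (by linarith : 1 + ‖z.2‖ ≤ 1 + ‖z‖) hL0) e0
    linarith

/-- Arithmetic of the final constants. -/
lemma final_arith {p T c L AyB DL E1 E2 e ep vx wy m : ℝ}
    (hAy : AyB = 2 * (2 ^ (p + 1) + DL) * E1) (hT : 0 ≤ T) (hc : 0 < c) (hL : 1 ≤ L) (hDL : 0 ≤ DL)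
    (hE1 : 0 ≤ E1) (hE2 : 0 ≤ E2) (hep : 1 ≤ ep) (hepd : ep = e ^ p) (hm : 1 ≤ m)
    (hvx : vx ≤ 2 ^ (p + 1) * m) (hwy : wy ≤ 2 ^ (p + 1) * m) :
    2 * (wy + DL) * E1 ≤ AyB * m ∧
    2 * (vx + T * (c * (e ^ p + 1) * (2 * (wy + DL) * E1))) * E2 ≤
      2 * (2 ^ (p + 1) + 2 * T * c * AyB) * E2 * ep * m := by
  have q0 : (0 : ℝ) ≤ 2 ^ (p + 1) := by positivity
  have h1 : 2 * (wy + DL) * E1 ≤ AyB * m := by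
    have : wy + DL ≤ (2 ^ (p + 1) + DL) * m := by nlinarith
    rw [hAy]
    calc 2 * (wy + DL) * E1 ≤ 2 * ((2 ^ (p + 1) + DL) * m) * E1 := by gcongr
      _ = _ := by ring
  have hA0 : 0 ≤ AyB := by rw [hAy]; positivity
  refine ⟨h1, ?_⟩
  rw [← hepd]
  have m0 : 0 ≤ m := by linarith
  have ep0 : 0 ≤ ep := by linarith
  have h2 : c * (ep + 1) * (2 * (wy + DL) * E1) ≤ c * (2 * ep) * (AyB * m) := by
    have : c * (ep + 1) * (2 * (wy + DL) * E1) ≤ c * (ep + 1) * (AyB * m) :=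
      mul_le_mul_of_nonneg_left h1 (by positivity)
    refine this.trans ?_
    have : ep + 1 ≤ 2 * ep := by linarith
    gcongr
  have h3 : vx ≤ 2 ^ (p + 1) * m * ep :=
    hvx.trans (le_mul_of_one_le_right (by positivity) hep)
  calc 2 * (vx + T * (c * (ep + 1) * (2 * (wy + DL) * E1))) * E2
      ≤ 2 * (2 ^ (p + 1) * m * ep + T * (c * (2 * ep) * (AyB * m))) * E2 := by gcongr
    _ = _ := by ring

theorem main_est (C : Coeffs n m d) (H : SA C)
    (ℱ : Filtration ℝ mΩ) (X : ℝ → ℝ → Ω → Vec n) (Y : ℝ → ℝ → Ω → Vec m)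
    (ξ : Ω → Vec n) (ζ : Ω → Vec m)
    (hsol : ∀ ε ∈ Set.Ioo (0 : ℝ) 1, IsSFSolution C ε P ℱ (X ε) (Y ε) ξ ζ)
    (T : ℝ) (hT : 0 < T) (p : ℝ) (hp : 2 ≤ p)
    (hmom : (∫⁻ ω, (‖ξ ω‖₊ : ℝ≥0∞) ^ (3 * p / 2) ∂P) +
        (∫⁻ ω, (‖ζ ω‖₊ : ℝ≥0∞) ^ (3 * p) ∂P) < ⊤) :
    ∃ Cpt > (0 : ℝ), ∀ ε ∈ Set.Ioo (0 : ℝ) 1, ∀ t h : ℝ, 0 ≤ t → 0 ≤ h → t + h ≤ T →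
      ∫ ω, ‖X ε (t + h) ω - X ε t ω‖ ^ p ∂P ≤
        Cpt * (1 + (∫ ω, ‖ξ ω‖ ^ (3 * p / 2) ∂P) + ∫ ω, ‖ζ ω‖ ^ (3 * p) ∂P) *
          (h ^ (p / 2) + h ^ p / ε ^ (p / 2)) := by
  obtain ⟨hξ, hζ⟩ := ENNReal.add_lt_top.1 hmom
  obtain ⟨c, lam, D, hc, hlam, hD, hall⟩ := inst_Sys (P := P) C H hp
  have hL : 1 ≤ LL C H P := by
    unfold LL
    linarith [abs_nonneg H.CL, abs_nonneg H.CG,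
      norm_nonneg (C.b 0 (P.map (fun _ => (0 : Vec n))) 0)]
  set L := LL C H P with hLd
  have mx0 : 0 ≤ ∫ ω, ‖ξ ω‖ ^ (3 * p / 2) ∂P := integral_nonneg fun _ => by positivity
  have my0 : 0 ≤ ∫ ω, ‖ζ ω‖ ^ (3 * p) ∂P := integral_nonneg fun _ => by positivity
  set mx := ∫ ω, ‖ξ ω‖ ^ (3 * p / 2) ∂P with hmx
  set my := ∫ ω, ‖ζ ω‖ ^ (3 * p) ∂P with hmy
  set M := 1 + mx + my with hM
  have hM1 : 1 ≤ M := by linarith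
  set E1 := Real.exp (4 * c * T) with hE1
  set E2 := Real.exp (4 * (2 * c + c * (2 * L) ^ p) * T) with hE2
  set Ex := Real.exp (4 * c) with hEx
  have E10 : 0 < E1 := Real.exp_pos _
  have E20 : 0 < E2 := Real.exp_pos _
  have Ex0 : 0 < Ex := Real.exp_pos _
  obtain ⟨Ay, hAy⟩ : ∃ Ay, Ay = 2 * (2 ^ (p + 1) + D / lam) * E1 := ⟨_, rfl⟩
  have Ay0 : 0 ≤ Ay := by rw [hAy]; positivity
  obtain ⟨Ax, hAx⟩ : ∃ Ax, Ax = 2 * (2 ^ (p + 1) + 2 * T * c * Ay) * E2 := ⟨_, rfl⟩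
  have Ax0 : 0 ≤ Ax := by rw [hAx]; positivity
  have L0 : 0 ≤ (2 * L) ^ p := by positivity
  refine ⟨2 ^ p * (2 ^ (p / 2) * (1 + 2 * Ex) + 2 * Ex * (c * (Ax * (1 + (2 * L) ^ p) + 2 * Ay))),
    by positivity, ?_⟩
  intro ε hε t h ht hh htT
  have hs := hsol ε hε
  obtain ⟨ix, bx⟩ := mom0 (hs.measX 0) hs.initX hp (by linarith : p ≤ 3 * p / 2) hξ
  obtain ⟨iy, by'⟩ := mom0 (hs.measY 0) hs.initY hp (by linarith : p ≤ 3 * p) hζ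
  have ex : ∀ ω, VX p 1 0 (X ε 0 ω, Y ε 0 ω) = (1 + ‖X ε 0 ω‖ ^ 2) ^ (p / 2) := fun ω => by
    rw [VX_eq]; simp
  have ey : ∀ ω, WY p (X ε 0 ω, Y ε 0 ω) = (1 + ‖Y ε 0 ω‖ ^ 2) ^ (p / 2) := fun ω => WY_eq _ _
  simp only [← ex] at ix bx
  simp only [← ey] at iy by'
  obtain ⟨B, S, βv, Λ, CU, sys⟩ := hall ε hε ℱ (X ε) (Y ε) ξ ζ hs ix iy
  have two : (2 : ℝ) ^ (p + 1) = 2 ^ p * 2 := by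
    rw [Real.rpow_add two_pos, Real.rpow_one]
  have bx' : ∫ ω, VX p 1 0 (X ε 0 ω, Y ε 0 ω) ∂P ≤ 2 ^ (p + 1) * M := by
    refine bx.trans ?_
    rw [two, mul_assoc]
    exact mul_le_mul_of_nonneg_left (by linarith) (by positivity)
  have by2 : ∫ ω, WY p (X ε 0 ω, Y ε 0 ω) ∂P ≤ 2 ^ (p + 1) * M := by
    refine by'.trans ?_
    rw [two, mul_assoc]
    exact mul_le_mul_of_nonneg_left (by linarith) (by positivity)
  obtain ⟨ep, hepd⟩ : ∃ ep, ep = ((Real.sqrt ε)⁻¹) ^ p := ⟨_, rfl⟩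
  have hep : 1 ≤ ep := by
    rw [hepd]; exact Real.one_le_rpow sys.he (by linarith)
  have hep2 : h ^ p / ε ^ (p / 2) = h ^ p * ep := by
    rw [hepd, Real.inv_rpow (Real.sqrt_nonneg _), Real.sqrt_eq_rpow, ← Real.rpow_mul hε.1.le,
      div_eq_mul_inv]
    congr 3; ring
  rcases hh.eq_or_lt with h0 | h0
  · subst h0
    have : ∀ ω, ‖X ε (t + 0) ω - X ε t ω‖ ^ p = 0 := fun ω => by
      rw [add_zero, sub_self, norm_zero, Real.zero_rpow (by linarith)]
    simp only [this, integral_zero]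
    have := hε.1
    positivity
  obtain ⟨f1, f2⟩ := final_arith (p := p) hAy hT.le hc hL (div_nonneg hD hlam.le) E10.le E20.le hep
    hepd hM1 bx' by2
  have mom := sys.moments hT.le rfl
  have mom' : ∀ t ∈ Set.Icc 0 T, (Integrable (fun ω => WY p (X ε t ω, Y ε t ω)) P ∧
      ∫ ω, WY p (X ε t ω, Y ε t ω) ∂P ≤ Ay * M) ∧
      Integrable (fun ω => VX p 1 0 (X ε t ω, Y ε t ω)) P ∧
      ∫ ω, VX p 1 0 (X ε t ω, Y ε t ω) ∂P ≤ Ax * ep * M := by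
    intro t ht
    obtain ⟨⟨m1, m2⟩, m3, m4⟩ := mom t ht
    refine ⟨⟨m1, m2.trans f1⟩, m3, m4.trans ?_⟩
    rw [hAx]
    exact f2
  have fin := sys.incr mom' ht h0 htT
  refine fin.trans ?_
  rw [hep2, Real.mul_rpow two_pos.le h0.le, ← hepd, mul_assoc (2 ^ p * _), mul_assoc (2 ^ p)]
  refine mul_le_mul_of_nonneg_left ?_ (by positivity)
  have k1 : 0 ≤ h ^ (p / 2) := by positivity
  have k2 : 0 ≤ h ^ p * ep := by positivity
  have M0 : 0 ≤ M := by linarith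
  generalize h ^ (p / 2) = a at *
  have t1 : 2 ^ (p / 2) * a * (1 + 2 * Ex) ≤ 2 ^ (p / 2) * (1 + 2 * Ex) * (M * (a + h ^ p * ep)) := by
    have : a ≤ M * (a + h ^ p * ep) :=
      (le_mul_of_one_le_left k1 hM1).trans (mul_le_mul_of_nonneg_left (by linarith) M0)
    calc 2 ^ (p / 2) * a * (1 + 2 * Ex) = 2 ^ (p / 2) * (1 + 2 * Ex) * a := by ring
      _ ≤ _ := by gcongr
  have t2 : h ^ p * (Ax * ep * M * (1 + (2 * L) ^ p) + ep * (Ay * M)) + a * (Ay * M) ≤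
      (Ax * (1 + (2 * L) ^ p) + 2 * Ay) * (M * (a + h ^ p * ep)) := by
    have e1 : h ^ p * (Ax * ep * M * (1 + (2 * L) ^ p) + ep * (Ay * M)) + a * (Ay * M) =
      (h ^ p * ep) * (Ax * M * (1 + (2 * L) ^ p) + Ay * M) + a * (Ay * M) := by ring
    rw [e1]
    generalize h ^ p * ep = b at *
    have u1 : 0 ≤ Ax * (1 + (2 * L) ^ p) * (M * a) := by positivity
    have u2 : 0 ≤ Ay * (M * a) := by positivity
    have u3 : 0 ≤ Ay * (M * b) := by positivity
    linarith
  have t3 : 2 * Ex * (c * (h ^ p * (Ax * ep * M * (1 + (2 * L) ^ p) + ep * (Ay * M)) + a * (Ay * M))) ≤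
      2 * Ex * (c * ((Ax * (1 + (2 * L) ^ p) + 2 * Ay) * (M * (a + h ^ p * ep)))) := by
    gcongr
  linarith

end Fin
end DiffApprox
end Aux

namespace DiffApprox

/-- **Lemma 3.3, (3.17).** Under A1–A4, for any `T > 0` and `p ≥ 2` with
`E|ξ|^{3p/2} + E|ζ|^{3p} < ∞`, there is `C_{p,T} > 0` such that for all
`0 ≤ t ≤ t + h ≤ T` and `ε ∈ (0,1)`,
`E|X^ε_{t+h} − X^ε_t|ᵖ ≤ C_{p,T}(1 + E|ξ|^{3p/2} + E|ζ|^{3p})(h^{p/2} + hᵖ ε^{-p/2})`. -/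
theorem increment_estimate_slow {n m d : ℕ} (C : Coeffs n m d) (SAh : SA C)
    {Ω : Type} [mΩ : MeasurableSpace Ω] (P : Measure Ω) (hP : IsProbabilityMeasure P)
    (ℱ : Filtration ℝ mΩ) (X : ℝ → ℝ → Ω → Vec n) (Y : ℝ → ℝ → Ω → Vec m)
    (ξ : Ω → Vec n) (ζ : Ω → Vec m)
    (hsol : ∀ ε ∈ Set.Ioo (0 : ℝ) 1, IsSFSolution C ε P ℱ (X ε) (Y ε) ξ ζ)
    (T : ℝ) (hT : 0 < T) (p : ℝ) (hp : 2 ≤ p)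
    (hmom : (∫⁻ ω, (‖ξ ω‖₊ : ℝ≥0∞) ^ (3 * p / 2) ∂P) +
        (∫⁻ ω, (‖ζ ω‖₊ : ℝ≥0∞) ^ (3 * p) ∂P) < ⊤) :
    ∃ Cpt > (0 : ℝ), ∀ ε ∈ Set.Ioo (0 : ℝ) 1, ∀ t h : ℝ, 0 ≤ t → 0 ≤ h → t + h ≤ T →
      ∫ ω, ‖X ε (t + h) ω - X ε t ω‖ ^ p ∂P ≤
        Cpt * (1 + (∫ ω, ‖ξ ω‖ ^ (3 * p / 2) ∂P) + ∫ ω, ‖ζ ω‖ ^ (3 * p) ∂P) *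
          (h ^ (p / 2) + h ^ p / ε ^ (p / 2)) := by
  have := hP
  exact main_est C SAh ℱ X Y ξ ζ hsol T hT p hp hmom

end DiffApprox
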